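/- arXiv:2105.14315 — 3 statements merged into one kernel-verified Lean document; each statement's English description precedes it below -/
import Mathlib

section
/- Every nonnegative ternary quartic is a sum of squares of quadratic forms: if p in ℝ[x,y,z] is homogeneous of degree 4 and p(x,y,z) >= 0 for all real x, y, z, then there exist homogeneous polynomials q_1, ..., q_k in ℝ[x,y,z] of degree 2 with p = q_1^2 + ... + q_k^2. -/
open MvPolynomial

namespace TQ

def IsLin (l : ℝ → ℝ → ℝ → ℝ) : Prop :=
  ∃ a b c : ℝ, ∀ x y z, l x y z = a * x + b * y + c * z

def IsQuad (q : ℝ → ℝ → ℝ → ℝ) : Prop :=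
  ∃ a b c d e f : ℝ, ∀ x y z,
    q x y z = a * x ^ 2 + b * y ^ 2 + c * z ^ 2 + d * (x * y) + e * (x * z) + f * (y * z)

def IsQuartic (F : ℝ → ℝ → ℝ → ℝ) : Prop :=
  ∃ a0 a1 a2 b0 b1 b2 c0 c1 c2 c3 d0 d1 d2 d3 d4 : ℝ, ∀ x y z,
    F x y z = a0 * x ^ 4 + x ^ 3 * (a1 * y + a2 * z)
      + x ^ 2 * (b0 * y ^ 2 + b1 * y * z + b2 * z ^ 2)
      + x * (c0 * y ^ 3 + c1 * y ^ 2 * z + c2 * y * z ^ 2 + c3 * z ^ 3)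
      + (d0 * y ^ 4 + d1 * y ^ 3 * z + d2 * y ^ 2 * z ^ 2 + d3 * y * z ^ 3 + d4 * z ^ 4)

def Good (F : ℝ → ℝ → ℝ → ℝ) : Prop :=
  ∃ q, IsQuad q ∧ (∃ x y z, q x y z ≠ 0) ∧ ∀ x y z, (q x y z) ^ 2 ≤ F x y z

lemma IsLin.mul {l m : ℝ → ℝ → ℝ → ℝ} (hl : IsLin l) (hm : IsLin m) :
    IsQuad (fun x y z => l x y z * m x y z) := by
  obtain ⟨a, b, c, h⟩ := hl
  obtain ⟨a', b', c', h'⟩ := hm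
  refine ⟨a * a', b * b', c * c', a * b' + b * a', a * c' + c * a', b * c' + c * b', ?_⟩
  intro x y z
  simp only [h, h']; ring

lemma IsQuad.mul {l m : ℝ → ℝ → ℝ → ℝ} (hl : IsQuad l) (hm : IsQuad m) :
    IsQuartic (fun x y z => l x y z * m x y z) := by
  obtain ⟨a, b, c, d, e, f, h⟩ := hl
  obtain ⟨a', b', c', d', e', f', h'⟩ := hm
  refine ⟨a * a', a * d' + d * a', a * e' + e * a', a * b' + b * a' + d * d',
    a * f' + f * a' + d * e' + e * d', a * c' + c * a' + e * e',
    b * d' + d * b', b * e' + e * b' + d * f' + f * d', c * d' + d * c' + e * f' + f * e',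
    c * e' + e * c', b * b', b * f' + f * b', b * c' + c * b' + f * f', c * f' + f * c', c * c', ?_⟩
  intro x y z
  simp only [h, h']; ring

lemma IsQuartic.add {F G : ℝ → ℝ → ℝ → ℝ} (hl : IsQuartic F) (hm : IsQuartic G) :
    IsQuartic (fun x y z => F x y z + G x y z) := by
  obtain ⟨a0, a1, a2, b0, b1, b2, c0, c1, c2, c3, d0, d1, d2, d3, d4, h⟩ := hl
  obtain ⟨a0', a1', a2', b0', b1', b2', c0', c1', c2', c3', d0', d1', d2', d3', d4', h'⟩ := hm
  refine ⟨a0 + a0', a1 + a1', a2 + a2', b0 + b0', b1 + b1', b2 + b2', c0 + c0', c1 + c1',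
    c2 + c2', c3 + c3', d0 + d0', d1 + d1', d2 + d2', d3 + d3', d4 + d4', ?_⟩
  intro x y z
  simp only [h, h']; ring

lemma IsQuartic.smul {F : ℝ → ℝ → ℝ → ℝ} (k : ℝ) (hl : IsQuartic F) :
    IsQuartic (fun x y z => k * F x y z) := by
  obtain ⟨a0, a1, a2, b0, b1, b2, c0, c1, c2, c3, d0, d1, d2, d3, d4, h⟩ := hl
  refine ⟨k * a0, k * a1, k * a2, k * b0, k * b1, k * b2, k * c0, k * c1, k * c2, k * c3,
    k * d0, k * d1, k * d2, k * d3, k * d4, ?_⟩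
  intro x y z
  simp only [h]; ring

lemma IsQuartic.congr {F G : ℝ → ℝ → ℝ → ℝ} (hl : IsQuartic F)
    (h : ∀ x y z, G x y z = F x y z) : IsQuartic G := by
  have : G = F := by funext x y z; exact h x y z
  rwa [this]

lemma IsQuad.subst {q l m n : ℝ → ℝ → ℝ → ℝ} (hq : IsQuad q) (hl : IsLin l) (hm : IsLin m)
    (hn : IsLin n) : IsQuad (fun x y z => q (l x y z) (m x y z) (n x y z)) := by
  obtain ⟨a1, b1, c1, h1⟩ := hl
  obtain ⟨a2, b2, c2, h2⟩ := hm
  obtain ⟨a3, b3, c3, h3⟩ := hn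
  obtain ⟨a, b, c, d, e, f, h⟩ := hq
  refine ⟨q a1 a2 a3, q b1 b2 b3, q c1 c2 c3,
    q (a1 + b1) (a2 + b2) (a3 + b3) - q a1 a2 a3 - q b1 b2 b3,
    q (a1 + c1) (a2 + c2) (a3 + c3) - q a1 a2 a3 - q c1 c2 c3,
    q (b1 + c1) (b2 + c2) (b3 + c3) - q b1 b2 b3 - q c1 c2 c3, ?_⟩
  intro x y z
  simp only [h, h1, h2, h3]; ring

lemma IsQuartic.subst {F l m n : ℝ → ℝ → ℝ → ℝ} (hF : IsQuartic F) (hl : IsLin l) (hm : IsLin m)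
    (hn : IsLin n) : IsQuartic (fun x y z => F (l x y z) (m x y z) (n x y z)) := by
  obtain ⟨a0, a1, a2, b0, b1, b2, c0, c1, c2, c3, d0, d1, d2, d3, d4, h⟩ := hF
  have hll := hl.mul hl
  have hlm := hl.mul hm
  have hln := hl.mul hn
  have hmm := hm.mul hm
  have hmn := hm.mul hn
  have hnn := hn.mul hn
  refine (((hll.mul hll).smul a0).add <| ((hll.mul hlm).smul a1).add <|
    ((hll.mul hln).smul a2).add <| ((hll.mul hmm).smul b0).add <| ((hll.mul hmn).smul b1).add <|
    ((hll.mul hnn).smul b2).add <| ((hlm.mul hmm).smul c0).add <| ((hlm.mul hmn).smul c1).add <|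
    ((hlm.mul hnn).smul c2).add <| ((hln.mul hnn).smul c3).add <| ((hmm.mul hmm).smul d0).add <|
    ((hmm.mul hmn).smul d1).add <| ((hmm.mul hnn).smul d2).add <|
    ((hmn.mul hnn).smul d3).add <| ((hnn.mul hnn).smul d4)).congr ?_
  intro x y z
  simp only [h]; ring

/-- change of basis -/
lemma basis_change {F : ℝ → ℝ → ℝ → ℝ} (hF : IsQuartic F) (hpos : ∀ x y z, 0 ≤ F x y z)
    (hne : ∃ x y z, F x y z ≠ 0) (u1 u2 u3 v1 v2 v3 : ℝ)
    (hc : u2 * v3 - u3 * v2 ≠ 0 ∨ u3 * v1 - u1 * v3 ≠ 0 ∨ u1 * v2 - u2 * v1 ≠ 0) :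
    ∃ G, IsQuartic G ∧ (∀ x y z, 0 ≤ G x y z) ∧ (∃ x y z, G x y z ≠ 0) ∧
      (∀ x y, G x y 0 = F (u1 * x + v1 * y) (u2 * x + v2 * y) (u3 * x + v3 * y)) ∧
      (Good G → Good F) := by
  obtain ⟨m1, hm1⟩ : ∃ m1, m1 = u2 * v3 - u3 * v2 := ⟨_, rfl⟩
  obtain ⟨m2, hm2⟩ : ∃ m2, m2 = u3 * v1 - u1 * v3 := ⟨_, rfl⟩
  obtain ⟨m3, hm3⟩ : ∃ m3, m3 = u1 * v2 - u2 * v1 := ⟨_, rfl⟩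
  rw [← hm1, ← hm2, ← hm3] at hc
  obtain ⟨D, hD⟩ : ∃ D, D = m1 ^ 2 + m2 ^ 2 + m3 ^ 2 := ⟨_, rfl⟩
  have hD0 : D ≠ 0 := by
    rcases hc with h | h | h <;> · have := pow_pos (abs_pos.mpr h) 2; rw [sq_abs] at this; nlinarith [sq_nonneg m1, sq_nonneg m2, sq_nonneg m3]
  -- inverse rows : (v × m)/D, (m × u)/D, m/D
  let S1 : ℝ → ℝ → ℝ → ℝ := fun x y z =>
    (v2 * m3 - v3 * m2) / D * x + (v3 * m1 - v1 * m3) / D * y + (v1 * m2 - v2 * m1) / D * z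
  let S2 : ℝ → ℝ → ℝ → ℝ := fun x y z =>
    (m2 * u3 - m3 * u2) / D * x + (m3 * u1 - m1 * u3) / D * y + (m1 * u2 - m2 * u1) / D * z
  let S3 : ℝ → ℝ → ℝ → ℝ := fun x y z => m1 / D * x + m2 / D * y + m3 / D * z
  let T1 : ℝ → ℝ → ℝ → ℝ := fun x y z => u1 * x + v1 * y + m1 * z
  let T2 : ℝ → ℝ → ℝ → ℝ := fun x y z => u2 * x + v2 * y + m2 * z
  let T3 : ℝ → ℝ → ℝ → ℝ := fun x y z => u3 * x + v3 * y + m3 * z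
  have hS1 : IsLin S1 := ⟨_, _, _, fun x y z => rfl⟩
  have hS2 : IsLin S2 := ⟨_, _, _, fun x y z => rfl⟩
  have hS3 : IsLin S3 := ⟨_, _, _, fun x y z => rfl⟩
  have hT1 : IsLin T1 := ⟨_, _, _, fun x y z => rfl⟩
  have hT2 : IsLin T2 := ⟨_, _, _, fun x y z => rfl⟩
  have hT3 : IsLin T3 := ⟨_, _, _, fun x y z => rfl⟩
  have TS1 : ∀ x y z, T1 (S1 x y z) (S2 x y z) (S3 x y z) = x := by
    intro x y z; simp only [T1, S1, S2, S3]; field_simp; rw [hD, hm1, hm2, hm3]; ring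
  have TS2 : ∀ x y z, T2 (S1 x y z) (S2 x y z) (S3 x y z) = y := by
    intro x y z; simp only [T2, S1, S2, S3]; field_simp; rw [hD, hm1, hm2, hm3]; ring
  have TS3 : ∀ x y z, T3 (S1 x y z) (S2 x y z) (S3 x y z) = z := by
    intro x y z; simp only [T3, S1, S2, S3]; field_simp; rw [hD, hm1, hm2, hm3]; ring
  have ST1 : ∀ x y z, S1 (T1 x y z) (T2 x y z) (T3 x y z) = x := by
    intro x y z; simp only [T1, T2, T3, S1]; field_simp; rw [hD, hm1, hm2, hm3]; ring
  have ST2 : ∀ x y z, S2 (T1 x y z) (T2 x y z) (T3 x y z) = y := by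
    intro x y z; simp only [T1, T2, T3, S2]; field_simp; rw [hD, hm1, hm2, hm3]; ring
  have ST3 : ∀ x y z, S3 (T1 x y z) (T2 x y z) (T3 x y z) = z := by
    intro x y z; simp only [T1, T2, T3, S3]; field_simp; rw [hD, hm1, hm2, hm3]; ring
  refine ⟨fun x y z => F (T1 x y z) (T2 x y z) (T3 x y z), hF.subst hT1 hT2 hT3,
    fun x y z => hpos _ _ _, ?_, ?_, ?_⟩
  · obtain ⟨x, y, z, h⟩ := hne
    exact ⟨S1 x y z, S2 x y z, S3 x y z, by simp only [TS1, TS2, TS3]; exact h⟩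
  · intro x y; simp [T1, T2, T3]
  · rintro ⟨q, hq, ⟨x, y, z, h⟩, hle⟩
    refine ⟨_, hq.subst hS1 hS2 hS3, ⟨T1 x y z, T2 x y z, T3 x y z, ?_⟩, ?_⟩
    · simp only [ST1, ST2, ST3]; exact h
    · intro x y z
      have := hle (S1 x y z) (S2 x y z) (S3 x y z)
      simp only [TS1, TS2, TS3] at this
      exact this

lemma good_of_scaled {F : ℝ → ℝ → ℝ → ℝ} (k : ℝ) (hk : 0 < k) (q : ℝ → ℝ → ℝ → ℝ)
    (hq : IsQuad q) (hne : ∃ x y z, q x y z ≠ 0) (h : ∀ x y z, (q x y z) ^ 2 ≤ k * F x y z) :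
    Good F := by
  have hs : 0 < √k := Real.sqrt_pos.mpr hk
  obtain ⟨a, b, c, d, e, f, h'⟩ := hq
  refine ⟨fun x y z => q x y z / √k, ⟨a / √k, b / √k, c / √k, d / √k, e / √k, f / √k, ?_⟩, ?_, ?_⟩
  · intro x y z; simp only [h']; ring
  · obtain ⟨x, y, z, h0⟩ := hne
    exact ⟨x, y, z, div_ne_zero h0 hs.ne'⟩
  · intro x y z
    rw [div_pow, Real.sq_sqrt hk.le, div_le_iff₀ hk]
    linarith [h x y z]

lemma sphere_bound {n : ℕ} (D : (Fin (n + 1) → ℝ) → ℝ) (hD : Continuous D) (k : ℕ) (hk : k ≠ 0)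
    (hh : ∀ t v, D (t • v) = t ^ (2 * k) * D v) (hpos : ∀ v, v ≠ 0 → 0 < D v) :
    ∃ ε > 0, ∀ v, ε * (∑ i, v i ^ 2) ^ k ≤ D v := by
  let S : Set (Fin (n + 1) → ℝ) := {v | ∑ i, v i ^ 2 = 1}
  have hcl : IsClosed S := isClosed_eq (by fun_prop) continuous_const
  have hS : IsCompact S := by
    refine Metric.isCompact_of_isClosed_isBounded hcl ?_
    refine (Metric.isBounded_closedBall (x := (0 : Fin (n + 1) → ℝ)) (r := 1)).subset ?_
    intro v hv
    rw [mem_closedBall_zero_iff, pi_norm_le_iff_of_nonneg zero_le_one]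
    intro i
    have h1 : v i ^ 2 ≤ ∑ i, v i ^ 2 :=
      Finset.single_le_sum (f := fun i => v i ^ 2) (fun _ _ => sq_nonneg _) (Finset.mem_univ i)
    have h2 : ∑ i, v i ^ 2 = 1 := hv
    rw [Real.norm_eq_abs, ← sq_le_one_iff_abs_le_one]
    linarith
  have hSne : S.Nonempty := by
    refine ⟨Pi.single 0 1, ?_⟩
    change ∑ i, _ = (1 : ℝ)
    rw [Finset.sum_eq_single 0] <;> simp +contextual
  obtain ⟨w, hw, hmin⟩ := hS.exists_isMinOn hSne hD.continuousOn
  have hw0 : w ≠ 0 := by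
    rintro rfl
    have : ∑ i : Fin (n + 1), (0 : Fin (n + 1) → ℝ) i ^ 2 = 1 := hw
    simp at this
  refine ⟨D w, hpos w hw0, ?_⟩
  intro v
  by_cases hv : v = 0
  · subst hv
    have := hh 0 0
    simp [hk] at this
    simp [this, hk]
  · obtain ⟨N, hN⟩ : ∃ N, N = ∑ i, v i ^ 2 := ⟨_, rfl⟩
    have hNpos : 0 < N := by
      rw [hN]
      obtain ⟨i, hi⟩ := Function.ne_iff.mp hv
      have h1 : v i ^ 2 ≤ ∑ i, v i ^ 2 :=
        Finset.single_le_sum (f := fun i => v i ^ 2) (fun _ _ => sq_nonneg _) (Finset.mem_univ i)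
      have : 0 < v i ^ 2 := by have : v i ≠ 0 := hi
                               positivity
      linarith
    have hs : 0 < √N := Real.sqrt_pos.mpr hNpos
    have hmem : (√N)⁻¹ • v ∈ S := by
      change ∑ i, _ = (1 : ℝ)
      simp only [Pi.smul_apply, smul_eq_mul, mul_pow]
      rw [← Finset.mul_sum, ← hN, inv_pow, Real.sq_sqrt hNpos.le, inv_mul_cancel₀ hNpos.ne']
    have h2 : D w ≤ D ((√N)⁻¹ • v) := hmin hmem
    rw [hh, inv_pow, pow_mul, Real.sq_sqrt hNpos.le] at h2
    rw [← hN]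
    have hNk : 0 < N ^ k := by positivity
    rw [inv_mul_eq_div, le_div_iff₀ hNk] at h2
    exact h2

lemma bound2 (D : ℝ → ℝ → ℝ) (hD : Continuous fun v : ℝ × ℝ => D v.1 v.2) (k : ℕ) (hk : k ≠ 0)
    (hh : ∀ t y z, D (t * y) (t * z) = t ^ (2 * k) * D y z)
    (hpos : ∀ y z, (y ≠ 0 ∨ z ≠ 0) → 0 < D y z) :
    ∃ ε > 0, ∀ y z, ε * (y ^ 2 + z ^ 2) ^ k ≤ D y z := by
  obtain ⟨ε, h0, h⟩ := sphere_bound (n := 1) (fun v => D (v 0) (v 1))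
    (hD.comp (f := fun v : Fin 2 → ℝ => (v 0, v 1)) (by fun_prop)) k hk
    (fun t v => by simp [hh]) (fun v hv => hpos _ _ (by
      by_contra hcon; push Not at hcon
      exact hv (by ext i; fin_cases i <;> simp [hcon])))
  exact ⟨ε, h0, fun y z => by simpa [Fin.sum_univ_two] using h ![y, z]⟩

lemma bound3 (D : ℝ → ℝ → ℝ → ℝ) (hD : Continuous fun v : ℝ × ℝ × ℝ => D v.1 v.2.1 v.2.2)
    (k : ℕ) (hk : k ≠ 0)
    (hh : ∀ t x y z, D (t * x) (t * y) (t * z) = t ^ (2 * k) * D x y z)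
    (hpos : ∀ x y z, (x ≠ 0 ∨ y ≠ 0 ∨ z ≠ 0) → 0 < D x y z) :
    ∃ ε > 0, ∀ x y z, ε * (x ^ 2 + y ^ 2 + z ^ 2) ^ k ≤ D x y z := by
  obtain ⟨ε, h0, h⟩ := sphere_bound (n := 2) (fun v => D (v 0) (v 1) (v 2))
    (hD.comp (f := fun v : Fin 3 → ℝ => (v 0, v 1, v 2)) (by fun_prop)) k hk
    (fun t v => by simp [hh]) (fun v hv => hpos _ _ _ (by
      by_contra hcon; push Not at hcon
      exact hv (by ext i; fin_cases i <;> simp [hcon])))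
  exact ⟨ε, h0, fun x y z => by simpa [Fin.sum_univ_three] using h ![x, y, z]⟩

/-- limiting argument -/
lemma nonneg_of_ne (f : ℝ → ℝ) (hf : Continuous f) (a : ℝ) (h : ∀ t, t ≠ a → 0 ≤ f t) (t : ℝ) :
    0 ≤ f t := by
  have hcl : IsClosed {t | 0 ≤ f t} := isClosed_le continuous_const hf
  have hd : Dense ({a}ᶜ : Set ℝ) := dense_compl_singleton a
  have : closure ({a}ᶜ : Set ℝ) ⊆ {t | 0 ≤ f t} := hcl.closure_subset_iff.mpr (fun t ht => h t ht)
  exact this (hd t)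

lemma lin_zero (a b c d : ℝ) (h : ∀ t : ℝ, 0 ≤ a * t + b * t ^ 2 + c * t ^ 3 + d * t ^ 4) :
    a = 0 := by
  have hd : HasDerivAt (fun t : ℝ => a * t + b * t ^ 2 + c * t ^ 3 + d * t ^ 4) a 0 := by
    have := ((((hasDerivAt_id (0 : ℝ)).const_mul a).add (((hasDerivAt_pow 2 (0 : ℝ))).const_mul b)).add
      (((hasDerivAt_pow 3 (0 : ℝ))).const_mul c)).add (((hasDerivAt_pow 4 (0 : ℝ))).const_mul d)
    refine this.congr_deriv ?_
    simp
  have hm : IsLocalMin (fun t : ℝ => a * t + b * t ^ 2 + c * t ^ 3 + d * t ^ 4) 0 := by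
    refine Filter.Eventually.of_forall fun t => ?_
    simpa using h t
  exact hm.hasDerivAt_eq_zero hd

lemma quad_nonneg {A B C : ℝ} (h : ∀ x : ℝ, 0 ≤ A * x ^ 2 + B * x + C) :
    0 ≤ A ∧ 0 ≤ C ∧ B ^ 2 ≤ 4 * A * C := by
  have h1 := discrim_le_zero (a := A) (b := B) (c := C) (fun x => by nlinarith [h x])
  rw [discrim] at h1
  have hC : 0 ≤ C := by simpa using h 0
  refine ⟨?_, hC, by linarith⟩
  by_contra hA
  push Not at hA
  have : B ^ 2 ≤ 0 := by nlinarith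
  have hB : B = 0 := by nlinarith
  subst hB
  have h2 := h (1 + C / (-A))
  have h3 : C / (-A) * (-A) = C := div_mul_cancel₀ _ (by linarith)
  have h4 : 0 ≤ C / (-A) := by apply div_nonneg hC; linarith
  nlinarith

end TQ

namespace TQ

/-- f rank one at the zero (1,0,0). -/
lemma good_rank_one {F : ℝ → ℝ → ℝ → ℝ} (hpos : ∀ x y z, 0 ≤ F x y z)
    (γ c1 c2 c3 d0 d1 d2 d3 d4 : ℝ) (hγ : 0 < γ)
    (hF : ∀ x y z, F x y z = x ^ 2 * (γ * z ^ 2)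
      + x * (c1 * y ^ 2 * z + c2 * y * z ^ 2 + c3 * z ^ 3)
      + (d0 * y ^ 4 + d1 * y ^ 3 * z + d2 * y ^ 2 * z ^ 2 + d3 * y * z ^ 3 + d4 * z ^ 4)) :
    Good F := by
  have key : ∀ y z, 0 ≤ 4 * γ * (d0 * y ^ 4 + d1 * y ^ 3 * z + d2 * y ^ 2 * z ^ 2
      + d3 * y * z ^ 3 + d4 * z ^ 4) - (c1 * y ^ 2 + c2 * y * z + c3 * z ^ 2) ^ 2 := by
    intro y
    refine nonneg_of_ne _ (by fun_prop) 0 ?_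
    intro z hz
    have := hpos (-(c1 * y ^ 2 + c2 * y * z + c3 * z ^ 2) / (2 * γ * z)) y z
    have h2 : 4 * γ * F (-(c1 * y ^ 2 + c2 * y * z + c3 * z ^ 2) / (2 * γ * z)) y z =
      4 * γ * (d0 * y ^ 4 + d1 * y ^ 3 * z + d2 * y ^ 2 * z ^ 2
      + d3 * y * z ^ 3 + d4 * z ^ 4) - (c1 * y ^ 2 + c2 * y * z + c3 * z ^ 2) ^ 2 := by
      rw [hF]; field_simp; ring
    rw [← h2]; positivity
  refine good_of_scaled (4 * γ) (by positivity)
    (fun x y z => 2 * γ * (x * z) + (c1 * y ^ 2 + c2 * (y * z) + c3 * z ^ 2))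
    ⟨0, c1, c3, 0, 2 * γ, c2, fun x y z => by ring⟩ ?_ ?_
  · by_contra! hcon
    have h1 := hcon 1 0 1
    have h2 := hcon (-1) 0 1
    linarith
  · intro x y z
    have := key y z
    rw [hF]
    linarith

/-- F vanishes on a line. -/
lemma good_line {F : ℝ → ℝ → ℝ → ℝ} (hF : IsQuartic F) (hpos : ∀ x y z, 0 ≤ F x y z)
    (hne : ∃ x y z, F x y z ≠ 0) (h0 : ∀ x y, F x y 0 = 0) : Good F := by
  obtain ⟨a0, a1, a2, b0, b1, b2, c0, c1, c2, c3, d0, d1, d2, d3, d4, h⟩ := hF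
  have hlin : ∀ x y, a2 * x ^ 3 + b1 * x ^ 2 * y + c1 * x * y ^ 2 + d1 * y ^ 3 = 0 := by
    intro x y
    refine lin_zero _ (b2 * x ^ 2 + c2 * x * y + d2 * y ^ 2) (c3 * x + d3 * y) d4 ?_
    intro t
    have h1 := hpos x y t
    have h2 := h0 x y
    rw [h] at h1 h2
    linarith
  have hF' : ∀ x y z, F x y z = z ^ 2 * (b2 * x ^ 2 + c2 * x * y + d2 * y ^ 2
      + (c3 * x + d3 * y) * z + d4 * z ^ 2) := by
    intro x y z
    have h1 := hlin x y
    have h2 := h0 x y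
    rw [h] at h2 ⊢
    linear_combination h2 + z * h1
  clear hlin h
  have hQ : ∀ x y z, 0 ≤ b2 * x ^ 2 + c2 * x * y + d2 * y ^ 2
      + (c3 * x + d3 * y) * z + d4 * z ^ 2 := by
    intro x y
    refine nonneg_of_ne _ (by fun_prop) 0 ?_
    intro z hz
    have := hpos x y z
    rw [hF'] at this
    have hz2 : 0 < z ^ 2 := by positivity
    exact nonneg_of_mul_nonneg_right this hz2
  have hx : ∀ y z, 0 ≤ b2 ∧ 0 ≤ d2 * y ^ 2 + d3 * y * z + d4 * z ^ 2 ∧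
      (c2 * y + c3 * z) ^ 2 ≤ 4 * b2 * (d2 * y ^ 2 + d3 * y * z + d4 * z ^ 2) := by
    intro y z
    refine quad_nonneg fun x => ?_
    linarith [hQ x y z]
  have hy : ∀ z, 0 ≤ d2 ∧ 0 ≤ d4 * z ^ 2 ∧ (d3 * z) ^ 2 ≤ 4 * d2 * (d4 * z ^ 2) := by
    intro z
    refine quad_nonneg fun y => ?_
    linarith [(hx y z).2.1]
  rcases (hx 0 0).1.lt_or_eq with hb | hb
  · refine good_of_scaled (4 * b2) (by positivity)
      (fun x y z => 2 * b2 * (x * z) + c2 * (y * z) + c3 * z ^ 2)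
      ⟨0, 0, c3, 0, 2 * b2, c2, fun x y z => by ring⟩ ?_ ?_
    · by_contra! hcon
      have h1 := hcon 1 0 1
      have h2 := hcon (-1) 0 1
      linarith
    · intro x y z
      have := mul_le_mul_of_nonneg_left (hx y z).2.2 (sq_nonneg z)
      rw [hF']
      linarith
  have hc2 : c2 = 0 := by
    have := (hx 1 0).2.2
    rw [← hb] at this
    nlinarith
  have hc3 : c3 = 0 := by
    have := (hx 0 1).2.2
    rw [← hb] at this
    nlinarith
  subst hc2 hc3 hb
  rcases (hy 0).1.lt_or_eq with hd | hd
  · refine good_of_scaled (4 * d2) (by positivity)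
      (fun x y z => 2 * d2 * (y * z) + d3 * z ^ 2)
      ⟨0, 0, d3, 0, 0, 2 * d2, fun x y z => by ring⟩ ?_ ?_
    · by_contra! hcon
      have h1 := hcon 0 1 1
      have h2 := hcon 0 (-1) 1
      linarith
    · intro x y z
      have := mul_le_mul_of_nonneg_left (hy z).2.2 (sq_nonneg z)
      rw [hF']
      linarith
  have hd3 : d3 = 0 := by
    have := (hy 1).2.2
    rw [← hd] at this
    nlinarith
  subst hd3 hd
  have hd4 : 0 ≤ d4 := by have := (hy 1).2.1; linarith
  have hd4' : d4 ≠ 0 := by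
    rintro rfl
    obtain ⟨x, y, z, h⟩ := hne
    exact h (by rw [hF']; ring)
  have : 0 < d4 := lt_of_le_of_ne hd4 hd4'.symm
  refine good_of_scaled d4 this (fun x y z => d4 * z ^ 2)
    ⟨0, 0, d4, 0, 0, 0, fun x y z => by ring⟩ ⟨0, 0, 1, by simpa using hd4'⟩ ?_
  intro x y z
  rw [hF']
  apply le_of_eq
  ring

lemma zero_coeffs {F : ℝ → ℝ → ℝ → ℝ} (hF : IsQuartic F) (hpos : ∀ x y z, 0 ≤ F x y z)
    (h0 : F 1 0 0 = 0) : ∃ b0 b1 b2 c0 c1 c2 c3 d0 d1 d2 d3 d4 : ℝ, ∀ x y z,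
    F x y z = x ^ 2 * (b0 * y ^ 2 + b1 * y * z + b2 * z ^ 2)
      + x * (c0 * y ^ 3 + c1 * y ^ 2 * z + c2 * y * z ^ 2 + c3 * z ^ 3)
      + (d0 * y ^ 4 + d1 * y ^ 3 * z + d2 * y ^ 2 * z ^ 2 + d3 * y * z ^ 3 + d4 * z ^ 4) := by
  obtain ⟨a0, a1, a2, b0, b1, b2, c0, c1, c2, c3, d0, d1, d2, d3, d4, h⟩ := hF
  have ha0 : a0 = 0 := by rw [h] at h0; linarith
  have ha1 : a1 = 0 := by
    refine lin_zero _ b0 c0 d0 fun t => ?_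
    have := hpos 1 t 0
    rw [h, ha0] at this
    linarith
  have ha2 : a2 = 0 := by
    refine lin_zero _ b2 c3 d4 fun t => ?_
    have := hpos 1 0 t
    rw [h, ha0] at this
    linarith
  refine ⟨b0, b1, b2, c0, c1, c2, c3, d0, d1, d2, d3, d4, fun x y z => ?_⟩
  rw [h, ha0, ha1, ha2]; ring

/-- zero at e1, and the Hessian at that zero is degenerate. -/
lemma good_degenerate {F : ℝ → ℝ → ℝ → ℝ} (hF : IsQuartic F) (hpos : ∀ x y z, 0 ≤ F x y z)
    (hne : ∃ x y z, F x y z ≠ 0) (h0 : F 1 0 0 = 0) (b c : ℝ) (hbc : b ≠ 0 ∨ c ≠ 0)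
    (hd : F 1 b c + F (-1) b c = 2 * F 0 b c) : Good F := by
  obtain ⟨G, hG, Gpos, Gne, hGF, hgood⟩ := basis_change hF hpos hne 1 0 0 0 b c (by
    rcases hbc with h | h
    · right; right; simpa using h
    · right; left; simpa using h)
  refine hgood ?_
  have e1 : G 1 0 0 = 0 := by rw [hGF]; simpa using h0
  have e2 : G 1 1 0 + G (-1) 1 0 = 2 * G 0 1 0 := by simp only [hGF]; simpa using hd
  clear hgood hGF hd hbc h0 hne hpos hF F b c
  obtain ⟨b0, b1, b2, c0, c1, c2, c3, d0, d1, d2, d3, d4, h⟩ := zero_coeffs hG Gpos e1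
  have hb0 : b0 = 0 := by simp only [h] at e2; linarith
  subst hb0
  have hq : ∀ y z, 0 ≤ b1 * y * z + b2 * z ^ 2 ∧ 0 ≤ (d0 * y ^ 4 + d1 * y ^ 3 * z
        + d2 * y ^ 2 * z ^ 2 + d3 * y * z ^ 3 + d4 * z ^ 4) ∧
      (c0 * y ^ 3 + c1 * y ^ 2 * z + c2 * y * z ^ 2 + c3 * z ^ 3) ^ 2 ≤
      4 * (b1 * y * z + b2 * z ^ 2) * (d0 * y ^ 4 + d1 * y ^ 3 * z + d2 * y ^ 2 * z ^ 2
        + d3 * y * z ^ 3 + d4 * z ^ 4) := by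
    intro y z
    refine quad_nonneg fun x => ?_
    have := Gpos x y z
    rw [h] at this
    linarith
  have hb1 : b1 = 0 := by
    refine lin_zero _ b2 0 0 fun t => ?_
    have := (hq 1 t).1
    linarith
  subst hb1
  have hb2 : 0 ≤ b2 := by have := (hq 0 1).1; linarith
  have hc0 : c0 = 0 := by have := (hq 1 0).2.2; nlinarith
  subst hc0
  rcases hb2.lt_or_eq with hb2 | hb2
  · refine good_rank_one Gpos b2 c1 c2 c3 d0 d1 d2 d3 d4 hb2 fun x y z => ?_
    rw [h]; ring
  subst hb2
  have hG' : ∀ x y z, G x y z = d0 * y ^ 4 + d1 * y ^ 3 * z + d2 * y ^ 2 * z ^ 2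
        + d3 * y * z ^ 3 + d4 * z ^ 4 := by
    intro x y z
    have h1 := (hq y z).2.2
    have h2 : 0 * y ^ 3 + c1 * y ^ 2 * z + c2 * y * z ^ 2 + c3 * z ^ 3 = 0 := by
      have : (0 * y ^ 3 + c1 * y ^ 2 * z + c2 * y * z ^ 2 + c3 * z ^ 3) ^ 2 ≤ 0 := by linarith
      nlinarith
    rw [h]
    linear_combination x * h2
  by_cases hz : ∃ b c, (b ≠ 0 ∨ c ≠ 0) ∧ G 0 b c = 0
  · obtain ⟨b, c, hbc, hz⟩ := hz
    obtain ⟨H, hH, Hpos, Hne, hHG, hgood⟩ := basis_change hG Gpos Gne 1 0 0 0 b c (by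
      rcases hbc with h | h
      · right; right; simpa using h
      · right; left; simpa using h)
    refine hgood (good_line hH Hpos Hne fun x y => ?_)
    rw [hHG, hG']
    rw [hG'] at hz
    linear_combination y ^ 4 * hz
  · push Not at hz
    obtain ⟨ε, hε, hb⟩ := bound2 (fun y z => G 0 y z) (by simp only [hG']; fun_prop) 2 (by simp)
      (fun t y z => by simp only [hG']; ring)
      (fun y z hyz => lt_of_le_of_ne (Gpos _ _ _) (hz y z hyz).symm)
    refine good_of_scaled ε⁻¹ (by positivity) (fun x y z => y ^ 2 + z ^ 2)
      ⟨0, 1, 1, 0, 0, 0, fun x y z => by ring⟩ ⟨0, 1, 0, by norm_num⟩ ?_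
    intro x y z
    have := hb y z
    rw [inv_mul_eq_div, le_div_iff₀ hε]
    simp only [hG'] at this ⊢
    linarith

/-- Both zeros, `h = κ ℓ²`, `g = ℓ m`. -/
lemma good_h_core {F : ℝ → ℝ → ℝ → ℝ} (f0 f1 f2 l1 l2 m1 m2 κ : ℝ) (hf0 : 0 < f0)
    (hl : l1 ≠ 0 ∨ l2 ≠ 0) (hκ : 0 ≤ κ)
    (hF : ∀ x y z, F x y z = x ^ 2 * (f0 * y ^ 2 + f1 * y * z + f2 * z ^ 2)
      + 2 * x * z * ((l1 * y + l2 * z) * (m1 * y + m2 * z)) + z ^ 2 * (κ * (l1 * y + l2 * z) ^ 2))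
    (hK : ∀ y z, ((l1 * y + l2 * z) * (m1 * y + m2 * z)) ^ 2 ≤
      (f0 * y ^ 2 + f1 * y * z + f2 * z ^ 2) * (κ * (l1 * y + l2 * z) ^ 2))
    (hf : ∀ y z, 0 ≤ f0 * y ^ 2 + f1 * y * z + f2 * z ^ 2) : Good F := by
  have hm' : ∀ y z, l1 * y + l2 * z ≠ 0 → 0 ≤ κ * (f0 * y ^ 2 + f1 * y * z + f2 * z ^ 2)
      - (m1 * y + m2 * z) ^ 2 := by
    intro y z hyz
    have h2 : 0 < (l1 * y + l2 * z) ^ 2 := by positivity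
    have := hK y z
    refine nonneg_of_mul_nonneg_right (a := (l1 * y + l2 * z) ^ 2) ?_ h2
    linarith
  have hm : ∀ y z, 0 ≤ κ * (f0 * y ^ 2 + f1 * y * z + f2 * z ^ 2) - (m1 * y + m2 * z) ^ 2 := by
    intro y z
    have h2 : 0 < l1 ^ 2 + l2 ^ 2 := by rcases hl with h | h <;> positivity
    have := nonneg_of_ne (fun t => κ * (f0 * (y + t * l1) ^ 2 + f1 * (y + t * l1) * (z + t * l2)
      + f2 * (z + t * l2) ^ 2) - (m1 * (y + t * l1) + m2 * (z + t * l2)) ^ 2) (by fun_prop)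
      (-(l1 * y + l2 * z) / (l1 ^ 2 + l2 ^ 2)) (fun t ht => hm' _ _ (fun h => ht (by
        rw [eq_div_iff h2.ne']; linarith))) 0
    simpa using this
  rcases hκ.lt_or_eq with hκ | hκ
  · refine good_of_scaled κ hκ
      (fun x y z => κ * (z * (l1 * y + l2 * z)) + x * (m1 * y + m2 * z))
      ⟨0, 0, κ * l2, m1, m2, κ * l1, fun x y z => by ring⟩ ?_ ?_
    · by_contra! hcon
      have h1 := hcon 0 0 1
      have h2 := hcon 0 1 1
      have h3 : κ * l2 = 0 := by linarith
      have h4 : κ * l1 = 0 := by linarith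
      rcases hl with h | h
      · exact (mul_ne_zero hκ.ne' h) h4
      · exact (mul_ne_zero hκ.ne' h) h3
    · intro x y z
      have := mul_nonneg (sq_nonneg x) (hm y z)
      rw [hF]
      linarith
  · subst hκ
    have hq : 0 ≤ f0 ∧ 0 ≤ f2 ∧ f1 ^ 2 ≤ 4 * f0 * f2 := quad_nonneg fun y => by
      have := hf y 1; linarith
    refine good_of_scaled (4 * f0) (by positivity) (fun x y z => x * (2 * f0 * y + f1 * z))
      ⟨0, 0, 0, 2 * f0, f1, 0, fun x y z => by ring⟩ ?_ ?_
    · refine ⟨1, 1, 0, ?_⟩; simpa using hf0.ne'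
    · intro x y z
      have h1 : m1 * y + m2 * z = 0 := by have := hm y z; nlinarith
      rw [hF, h1]
      have := mul_nonneg (sub_nonneg.mpr hq.2.2) (sq_nonneg (x * z))
      linarith

lemma good_h {F : ℝ → ℝ → ℝ → ℝ} (f0 f1 f2 g0 g1 g2 h0 h1 h2 : ℝ) (hf0 : 0 < f0)
    (hF : ∀ x y z, F x y z = x ^ 2 * (f0 * y ^ 2 + f1 * y * z + f2 * z ^ 2)
      + 2 * x * z * (g0 * y ^ 2 + g1 * y * z + g2 * z ^ 2)
      + z ^ 2 * (h0 * y ^ 2 + h1 * y * z + h2 * z ^ 2))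
    (hK : ∀ x y z, 0 ≤ (f0 * y ^ 2 + f1 * y * z + f2 * z ^ 2) * x ^ 2
      + 2 * (g0 * y ^ 2 + g1 * y * z + g2 * z ^ 2) * x
      + (h0 * y ^ 2 + h1 * y * z + h2 * z ^ 2)) (b c : ℝ) (hbc : b ≠ 0 ∨ c ≠ 0)
    (hz : h0 * b ^ 2 + h1 * b * c + h2 * c ^ 2 = 0) : Good F := by
  have hq := fun y z => quad_nonneg fun x => hK x y z
  have hg : g0 * b ^ 2 + g1 * b * c + g2 * c ^ 2 = 0 := by
    have := (hq b c).2.2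
    rw [hz] at this
    nlinarith
  have hh := fun y z => (hq y z).2.1
  by_cases hc : c = 0
  · subst hc
    have hb : b ≠ 0 := by simpa using hbc
    have hh0 : h0 = 0 := by simpa [hb] using hz
    have hg0 : g0 = 0 := by simpa [hb] using hg
    subst hh0 hg0
    have hh1 : h1 = 0 := lin_zero _ h2 0 0 fun t => by have := hh 1 t; linarith
    subst hh1
    refine good_h_core f0 f1 f2 0 1 g1 g2 h2 hf0 (by simp) (by simpa using hh 0 1) ?_ ?_ ?_
    · intro x y z; rw [hF]; ring
    · intro y z; have := (hq y z).2.2; linarith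
    · intro y z; exact (hq y z).1
  · obtain ⟨t, ht⟩ : ∃ t, t = b / c := ⟨_, rfl⟩
    have hb : b = t * c := by rw [ht]; field_simp
    subst hb
    have hc2 : c ^ 2 ≠ 0 := by positivity
    have hz' : h2 = -(h0 * t ^ 2 + h1 * t) := by
      apply mul_left_cancel₀ hc2; linarith
    have hg' : g2 = -(g0 * t ^ 2 + g1 * t) := by
      apply mul_left_cancel₀ hc2; linarith
    have hh1 : 2 * h0 * t + h1 = 0 := lin_zero _ h0 0 0 fun s => by
      have := hh (t + s) 1; rw [hz'] at this; linarith
    have hh1' : h1 = - (2 * h0 * t) := by linarith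
    subst hh1'
    have hh0 : 0 ≤ h0 := by have := hh 1 0; linarith
    refine good_h_core f0 f1 f2 1 (-t) g0 (g1 + g0 * t) h0 hf0 (by simp) hh0 ?_ ?_ ?_
    · intro x y z; rw [hF, hz', hg']; ring
    · intro y z; have := (hq y z).2.2; rw [hz', hg'] at this; linarith
    · intro y z; exact (hq y z).1

lemma good_shear {F : ℝ → ℝ → ℝ → ℝ} (s : ℝ) (h : Good (fun x y z => F (x + s * z) y z)) :
    Good F := by
  obtain ⟨q, hq, ⟨x, y, z, h0⟩, hle⟩ := h
  refine ⟨_, hq.subst (l := fun x y z => x - s * z) (m := fun x y z => y) (n := fun x y z => z)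
    ⟨1, 0, -s, fun x y z => by ring⟩ ⟨0, 1, 0, fun x y z => by ring⟩
    ⟨0, 0, 1, fun x y z => by ring⟩, ⟨x + s * z, y, z, by simpa using h0⟩, fun x y z => ?_⟩
  simpa using hle (x - s * z) y z

lemma quad_upper (a b c : ℝ) : ∃ M > 0, ∀ y z : ℝ, a * y ^ 2 + b * y * z + c * z ^ 2 ≤
    M * (y ^ 2 + z ^ 2) := by
  refine ⟨|a| + |b| + |c| + 1, by positivity, fun y z => ?_⟩
  have h1 : a * y ^ 2 ≤ |a| * y ^ 2 := mul_le_mul_of_nonneg_right (le_abs_self a) (sq_nonneg y)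
  have h2 : c * z ^ 2 ≤ |c| * z ^ 2 := mul_le_mul_of_nonneg_right (le_abs_self c) (sq_nonneg z)
  have h3 : b * y * z ≤ |b| * (y ^ 2 + z ^ 2) := by
    have h4 := le_abs_self b
    have h5 := neg_abs_le b
    nlinarith [sq_nonneg (y + z), sq_nonneg (y - z), mul_nonneg (sub_nonneg.mpr h4) (sq_nonneg (y - z)), mul_nonneg (by linarith : 0 ≤ |b| + b) (sq_nonneg (y-z)), mul_nonneg (by linarith : 0 ≤ |b| - b) (sq_nonneg (y+z)), abs_nonneg b, sq_nonneg y, sq_nonneg z]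
  nlinarith [mul_nonneg (abs_nonneg a) (sq_nonneg z), mul_nonneg (abs_nonneg c) (sq_nonneg y),
    sq_nonneg y, sq_nonneg z]

lemma good_two_zeros {F : ℝ → ℝ → ℝ → ℝ} (hF : IsQuartic F) (hpos : ∀ x y z, 0 ≤ F x y z)
    (hne : ∃ x y z, F x y z ≠ 0) (hz1 : F 1 0 0 = 0) (hz2 : F 0 1 0 = 0) : Good F := by
  by_cases hdeg : ∃ b c, (b ≠ 0 ∨ c ≠ 0) ∧ F 1 b c + F (-1) b c = 2 * F 0 b c
  · obtain ⟨b, c, hbc, hd⟩ := hdeg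
    exact good_degenerate hF hpos hne hz1 b c hbc hd
  push Not at hdeg
  obtain ⟨f0, f1, f2, c0, c1, c2, c3, d0, d1, h0, h1, h2, h⟩ := zero_coeffs hF hpos hz1
  have hd0 : d0 = 0 := by rw [h] at hz2; linarith
  subst hd0
  have hc0 : c0 = 0 := lin_zero _ f0 0 0 fun t => by
    have := hpos t 1 0; rw [h] at this; linarith
  subst hc0
  have hd1 : d1 = 0 := lin_zero _ h0 h1 h2 fun t => by
    have := hpos 0 1 t; rw [h] at this; linarith
  subst hd1
  obtain ⟨g0, hg0⟩ : ∃ g0, g0 = c1 / 2 := ⟨_, rfl⟩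
  obtain ⟨g1, hg1⟩ : ∃ g1, g1 = c2 / 2 := ⟨_, rfl⟩
  obtain ⟨g2, hg2⟩ : ∃ g2, g2 = c3 / 2 := ⟨_, rfl⟩
  have hF' : ∀ x y z, F x y z = x ^ 2 * (f0 * y ^ 2 + f1 * y * z + f2 * z ^ 2)
      + 2 * x * z * (g0 * y ^ 2 + g1 * y * z + g2 * z ^ 2)
      + z ^ 2 * (h0 * y ^ 2 + h1 * y * z + h2 * z ^ 2) := by
    intro x y z; rw [h, hg0, hg1, hg2]; ring
  clear h hg0 hg1 hg2 c1 c2 c3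
  have hK : ∀ x y z, 0 ≤ (f0 * y ^ 2 + f1 * y * z + f2 * z ^ 2) * x ^ 2
      + 2 * (g0 * y ^ 2 + g1 * y * z + g2 * z ^ 2) * x
      + (h0 * y ^ 2 + h1 * y * z + h2 * z ^ 2) := by
    intro x y
    refine nonneg_of_ne _ (by fun_prop) 0 fun z hz => ?_
    have := hpos (x * z) y z
    rw [hF'] at this
    have hz2 : 0 < z ^ 2 := by positivity
    refine nonneg_of_mul_nonneg_right (a := z ^ 2) ?_ hz2
    linarith
  have hq := fun y z => quad_nonneg fun x => hK x y z
  have hfpos : ∀ y z, (y ≠ 0 ∨ z ≠ 0) → 0 < f0 * y ^ 2 + f1 * y * z + f2 * z ^ 2 := by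
    intro y z hyz
    refine lt_of_le_of_ne (hq y z).1 fun h => hdeg y z hyz ?_
    simp only [hF']
    linear_combination -2 * h
  have hf0 : 0 < f0 := by simpa using hfpos 1 0 (by simp)
  by_cases hz : ∃ b c, (b ≠ 0 ∨ c ≠ 0) ∧ (f0 * b ^ 2 + f1 * b * c + f2 * c ^ 2) *
      (h0 * b ^ 2 + h1 * b * c + h2 * c ^ 2) = (g0 * b ^ 2 + g1 * b * c + g2 * c ^ 2) ^ 2
  · obtain ⟨b, c, hbc, hz⟩ := hz
    obtain ⟨s, hs⟩ : ∃ s, s = -(g0 * b ^ 2 + g1 * b * c + g2 * c ^ 2) /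
      (f0 * b ^ 2 + f1 * b * c + f2 * c ^ 2) := ⟨_, rfl⟩
    have hfb := hfpos b c hbc
    have hs' : s * (f0 * b ^ 2 + f1 * b * c + f2 * c ^ 2) =
      -(g0 * b ^ 2 + g1 * b * c + g2 * c ^ 2) := by rw [hs]; exact div_mul_cancel₀ _ hfb.ne'
    refine good_shear s (good_h f0 f1 f2 (g0 + s * f0) (g1 + s * f1) (g2 + s * f2)
      (h0 + 2 * s * g0 + s ^ 2 * f0) (h1 + 2 * s * g1 + s ^ 2 * f1) (h2 + 2 * s * g2 + s ^ 2 * f2)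
      hf0 ?_ ?_ b c hbc ?_)
    · intro x y z; rw [hF']; ring
    · intro x y z
      have := hK (x + s) y z
      linarith
    · apply mul_left_cancel₀ hfb.ne'
      linear_combination hz + ((g0 * b ^ 2 + g1 * b * c + g2 * c ^ 2) + s * (f0 * b ^ 2 + f1 * b * c + f2 * c ^ 2)) * hs'
  · push Not at hz
    obtain ⟨ε, hε, hb⟩ := bound2 (fun y z => (f0 * y ^ 2 + f1 * y * z + f2 * z ^ 2) *
      (h0 * y ^ 2 + h1 * y * z + h2 * z ^ 2) - (g0 * y ^ 2 + g1 * y * z + g2 * z ^ 2) ^ 2)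
      (by fun_prop) 2 (by simp) (fun t y z => by ring) (fun y z hyz => by
        have := (hq y z).2.2
        have h2 := hz y z hyz
        refine lt_of_le_of_ne (by linarith) fun h3 => h2 (by linarith))
    obtain ⟨M, hM, hMb⟩ := quad_upper f0 f1 f2
    refine good_of_scaled (M / ε) (by positivity) (fun x y z => z ^ 2)
      ⟨0, 0, 1, 0, 0, 0, fun x y z => by ring⟩ ⟨0, 0, 1, by norm_num⟩ ?_
    intro x y z
    rw [div_mul_eq_mul_div, le_div_iff₀ hε]
    by_cases hyz : y ≠ 0 ∨ z ≠ 0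
    · have hN : 0 < y ^ 2 + z ^ 2 := by rcases hyz with h | h <;> positivity
      refine le_of_mul_le_mul_left ?_ hN
      have hfM := hMb y z
      have hby := hb y z
      have h3 := hpos x y z
      have h4 : (f0 * y ^ 2 + f1 * y * z + f2 * z ^ 2) * F x y z =
        (x * (f0 * y ^ 2 + f1 * y * z + f2 * z ^ 2) + z * (g0 * y ^ 2 + g1 * y * z + g2 * z ^ 2)) ^ 2
        + z ^ 2 * ((f0 * y ^ 2 + f1 * y * z + f2 * z ^ 2) *
      (h0 * y ^ 2 + h1 * y * z + h2 * z ^ 2) - (g0 * y ^ 2 + g1 * y * z + g2 * z ^ 2) ^ 2) := by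
        rw [hF']; ring
      have h5 : z ^ 2 * (ε * (y ^ 2 + z ^ 2) ^ 2) ≤ (f0 * y ^ 2 + f1 * y * z + f2 * z ^ 2) * F x y z := by
        rw [h4]
        have := mul_le_mul_of_nonneg_left hby (sq_nonneg z)
        have := sq_nonneg (x * (f0 * y ^ 2 + f1 * y * z + f2 * z ^ 2) + z * (g0 * y ^ 2 + g1 * y * z + g2 * z ^ 2))
        linarith
      have h6 := mul_le_mul_of_nonneg_right hfM h3
      have h7 : 0 ≤ ε * (z ^ 2 * y ^ 2 * (y ^ 2 + z ^ 2)) := by positivity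
      linarith
    · push Not at hyz
      have := mul_nonneg hM.le (hpos x y z)
      rw [hyz.2]; rw [hyz.2] at this; linarith

lemma good_one_zero {F : ℝ → ℝ → ℝ → ℝ} (hF : IsQuartic F) (hpos : ∀ x y z, 0 ≤ F x y z)
    (hne : ∃ x y z, F x y z ≠ 0) (hz1 : F 1 0 0 = 0) : Good F := by
  by_cases hdeg : ∃ b c, (b ≠ 0 ∨ c ≠ 0) ∧ F 1 b c + F (-1) b c = 2 * F 0 b c
  · obtain ⟨b, c, hbc, hd⟩ := hdeg
    exact good_degenerate hF hpos hne hz1 b c hbc hd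
  push Not at hdeg
  by_cases hz : ∃ a b c, (b ≠ 0 ∨ c ≠ 0) ∧ F a b c = 0
  · obtain ⟨a, b, c, hbc, hz⟩ := hz
    obtain ⟨H, hH, Hpos, Hne, hHG, hgood⟩ := basis_change hF hpos hne 1 0 0 a b c (by
      rcases hbc with h | h
      · right; right; simpa using h
      · right; left; simpa using h)
    refine hgood (good_two_zeros hH Hpos Hne ?_ ?_)
    · rw [hHG]; simpa using hz1
    · rw [hHG]; simpa using hz
  push Not at hz
  obtain ⟨b0, b1, b2, c0, c1, c2, c3, d0, d1, d2, d3, d4, h⟩ := zero_coeffs hF hpos hz1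
  have hq := fun y z => quad_nonneg (A := b0 * y ^ 2 + b1 * y * z + b2 * z ^ 2)
    (B := c0 * y ^ 3 + c1 * y ^ 2 * z + c2 * y * z ^ 2 + c3 * z ^ 3)
    (C := d0 * y ^ 4 + d1 * y ^ 3 * z + d2 * y ^ 2 * z ^ 2 + d3 * y * z ^ 3 + d4 * z ^ 4)
    fun x => by have := hpos x y z; rw [h] at this; linarith
  have hfpos : ∀ y z, (y ≠ 0 ∨ z ≠ 0) → 0 < b0 * y ^ 2 + b1 * y * z + b2 * z ^ 2 := by
    intro y z hyz
    refine lt_of_le_of_ne (hq y z).1 fun h' => hdeg y z hyz ?_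
    simp only [h]
    linear_combination -2 * h'
  obtain ⟨ε, hε, hb⟩ := bound2 (fun y z => 4 * (b0 * y ^ 2 + b1 * y * z + b2 * z ^ 2) *
      (d0 * y ^ 4 + d1 * y ^ 3 * z + d2 * y ^ 2 * z ^ 2 + d3 * y * z ^ 3 + d4 * z ^ 4)
      - (c0 * y ^ 3 + c1 * y ^ 2 * z + c2 * y * z ^ 2 + c3 * z ^ 3) ^ 2)
      (by fun_prop) 3 (by simp) (fun t y z => by ring) (fun y z hyz => by
        have h1 := (hq y z).2.2
        have h2 := hfpos y z hyz
        refine lt_of_le_of_ne (by linarith) fun h3 => hz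
          (-(c0 * y ^ 3 + c1 * y ^ 2 * z + c2 * y * z ^ 2 + c3 * z ^ 3) /
            (2 * (b0 * y ^ 2 + b1 * y * z + b2 * z ^ 2))) y z hyz ?_
        rw [h]
        generalize b0 * y ^ 2 + b1 * y * z + b2 * z ^ 2 = f at *
        generalize c0 * y ^ 3 + c1 * y ^ 2 * z + c2 * y * z ^ 2 + c3 * z ^ 3 = g at *
        field_simp
        linear_combination -h3)
  obtain ⟨M, hM, hMb⟩ := quad_upper b0 b1 b2
  refine good_of_scaled (4 * M / ε) (by positivity) (fun x y z => y ^ 2 + z ^ 2)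
    ⟨0, 1, 1, 0, 0, 0, fun x y z => by ring⟩ ⟨0, 0, 1, by norm_num⟩ ?_
  intro x y z
  rw [div_mul_eq_mul_div, le_div_iff₀ hε]
  by_cases hyz : y ≠ 0 ∨ z ≠ 0
  · have hN : 0 < y ^ 2 + z ^ 2 := by rcases hyz with h | h <;> positivity
    refine le_of_mul_le_mul_left ?_ hN
    have h1 := hMb y z
    have h2 := hb y z
    have h3 := hpos x y z
    have h4 := h x y z
    generalize b0 * y ^ 2 + b1 * y * z + b2 * z ^ 2 = f at *
    generalize c0 * y ^ 3 + c1 * y ^ 2 * z + c2 * y * z ^ 2 + c3 * z ^ 3 = g at *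
    generalize d0 * y ^ 4 + d1 * y ^ 3 * z + d2 * y ^ 2 * z ^ 2 + d3 * y * z ^ 3 + d4 * z ^ 4 = k at *
    have h5 : ε * (y ^ 2 + z ^ 2) ^ 3 ≤ 4 * f * F x y z := by
      rw [h4]
      have := sq_nonneg (2 * f * x + g)
      linarith
    have h6 := mul_le_mul_of_nonneg_right h1 h3
    linarith
  · push Not at hyz
    have := mul_nonneg hM.le (hpos x y z)
    rw [hyz.1, hyz.2]; rw [hyz.1, hyz.2] at this; linarith

theorem good_of_nonneg {F : ℝ → ℝ → ℝ → ℝ} (hF : IsQuartic F) (hpos : ∀ x y z, 0 ≤ F x y z)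
    (hne : ∃ x y z, F x y z ≠ 0) : Good F := by
  by_cases hz : ∃ a b c, (a ≠ 0 ∨ b ≠ 0 ∨ c ≠ 0) ∧ F a b c = 0
  · obtain ⟨a, b, c, habc, hz⟩ := hz
    have : ∃ v1 v2 v3 : ℝ, b * v3 - c * v2 ≠ 0 ∨ c * v1 - a * v3 ≠ 0 ∨ a * v2 - b * v1 ≠ 0 := by
      rcases habc with h | h | h
      · exact ⟨0, 1, 0, by right; right; simpa using h⟩
      · exact ⟨0, 0, 1, by left; simpa using h⟩
      · exact ⟨1, 0, 0, by right; left; simpa using h⟩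
    obtain ⟨v1, v2, v3, hv⟩ := this
    obtain ⟨H, hH, Hpos, Hne, hHG, hgood⟩ := basis_change hF hpos hne a b c v1 v2 v3 hv
    refine hgood (good_one_zero hH Hpos Hne ?_)
    rw [hHG]; simpa using hz
  · push Not at hz
    obtain ⟨a0, a1, a2, b0, b1, b2, c0, c1, c2, c3, d0, d1, d2, d3, d4, h⟩ := hF
    obtain ⟨ε, hε, hb⟩ := bound3 F (by simp only [h]; fun_prop) 2 (by simp)
      (fun t x y z => by simp only [h]; ring)
      (fun x y z hxyz => lt_of_le_of_ne (hpos _ _ _) (hz x y z hxyz).symm)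
    refine good_of_scaled ε⁻¹ (by positivity) (fun x y z => x ^ 2 + y ^ 2 + z ^ 2)
      ⟨1, 1, 1, 0, 0, 0, fun x y z => by ring⟩ ⟨1, 0, 0, by norm_num⟩ ?_
    intro x y z
    have := hb x y z
    rw [inv_mul_eq_div, le_div_iff₀ hε]
    linarith

end TQ

namespace TQ

lemma IsQuartic.zero : IsQuartic (fun _ _ _ => 0) :=
  ⟨0, 0, 0, 0, 0, 0, 0, 0, 0, 0, 0, 0, 0, 0, 0, fun x y z => by ring⟩

lemma IsQuartic.sum {ι : Type*} (s : Finset ι) (F : ι → ℝ → ℝ → ℝ → ℝ)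
    (h : ∀ i ∈ s, IsQuartic (F i)) : IsQuartic (fun x y z => ∑ i ∈ s, F i x y z) := by
  classical
  induction s using Finset.induction_on with
  | empty => simpa using IsQuartic.zero
  | insert a s ha ih =>
    refine ((h a (by simp)).add (ih fun i hi => h i (by simp [hi]))).congr fun x y z => ?_
    rw [Finset.sum_insert ha]

lemma isQuartic_mono (i j k : ℕ) (h : i + j + k = 4) :
    IsQuartic (fun x y z => x ^ i * y ^ j * z ^ k) := by
  let δ : ℕ → ℕ → ℝ := fun a b => if i = a ∧ j = b then 1 else 0
  refine ⟨δ 4 0, δ 3 1, δ 3 0, δ 2 2, δ 2 1, δ 2 0, δ 1 3, δ 1 2, δ 1 1, δ 1 0, δ 0 4, δ 0 3,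
    δ 0 2, δ 0 1, δ 0 0, fun x y z => ?_⟩
  have hi : i ≤ 4 := by omega
  have hj : j ≤ 4 - i := by omega
  obtain rfl : k = 4 - i - j := by omega
  clear h
  simp only [δ]
  clear δ
  interval_cases i <;> simp only [Nat.reduceSub] at hj <;> interval_cases j <;> simp <;> try ring

lemma isQuartic_eval (p : MvPolynomial (Fin 3) ℝ) (hhom : p.IsHomogeneous 4) :
    IsQuartic (fun x y z => eval ![x, y, z] p) := by
  have := IsQuartic.sum p.support (fun m x y z => p.coeff m * (x ^ m 0 * y ^ m 1 * z ^ m 2))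
    (fun m hm => (isQuartic_mono _ _ _ (by
      have h := hhom (mem_support_iff.mp hm)
      rw [Finsupp.weight_apply, Finsupp.sum_fintype _ _ (by simp)] at h
      simpa [Fin.sum_univ_three] using h)).smul _)
  refine this.congr fun x y z => ?_
  rw [eval_eq']
  simp [Fin.prod_univ_three]

def mv (x y z : ℝ) : Fin 6 → ℝ := ![x ^ 2, y ^ 2, z ^ 2, x * y, x * z, y * z]

lemma isQuad_mv (i : Fin 6) : IsQuad (fun x y z => mv x y z i) := by
  refine ⟨if i = 0 then 1 else 0, if i = 1 then 1 else 0, if i = 2 then 1 else 0,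
    if i = 3 then 1 else 0, if i = 4 then 1 else 0, if i = 5 then 1 else 0, fun x y z => ?_⟩
  fin_cases i <;> simp [mv]

open Matrix in
lemma isQuartic_gram (G : Matrix (Fin 6) (Fin 6) ℝ) :
    IsQuartic (fun x y z => mv x y z ⬝ᵥ G *ᵥ mv x y z) := by
  refine (IsQuartic.sum Finset.univ (fun i x y z => ∑ j, G i j * (mv x y z i * mv x y z j))
    (fun i _ => IsQuartic.sum Finset.univ _ fun j _ =>
      ((isQuad_mv i).mul (isQuad_mv j)).smul (G i j))).congr fun x y z => ?_
  simp only [dotProduct, mulVec, Finset.mul_sum]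
  refine Finset.sum_congr rfl fun i _ => Finset.sum_congr rfl fun j _ => by ring

open Matrix in
lemma entry_bound (G : Matrix (Fin 6) (Fin 6) ℝ) (hG : G.PosSemidef) (C : ℝ)
    (h : ∀ i, G i i ≤ C) (i j : Fin 6) : G i j ∈ Set.Icc (-C) C := by
  have key : ∀ s : ℝ, 0 ≤ G i i + s * G i j + s * G j i + s ^ 2 * G j j := by
    intro s
    have := hG.dotProduct_mulVec_nonneg (Pi.single i 1 + Pi.single j s)
    simp [mulVec_add, add_dotProduct, dotProduct_add, mulVec_single, single_dotProduct] at this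
    linarith
  have hs : G j i = G i j := by simpa using hG.1.apply i j
  have h1 := key 1
  have h2 := key (-1)
  have h3 := h i
  have h4 := h j
  rw [hs] at h1 h2
  constructor <;> linarith

open Matrix in
lemma diag_bound (F : ℝ → ℝ → ℝ → ℝ) : ∃ C : ℝ, ∀ G : Matrix (Fin 6) (Fin 6) ℝ, G.PosSemidef →
    (∀ x y z, mv x y z ⬝ᵥ G *ᵥ mv x y z ≤ F x y z) → ∀ i, G i i ≤ C := by
  refine ⟨|F 1 0 0| + |F 0 1 0| + |F 0 0 1| + |F 1 1 0| + |F 1 (-1) 0| + |F 1 0 1| + |F 1 0 (-1)|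
    + |F 0 1 1| + |F 0 1 (-1)|, fun G hG h i => ?_⟩
  have q1 := hG.dotProduct_mulVec_nonneg ![1, 1, 0, 0, 0, 0]
  have q2 := hG.dotProduct_mulVec_nonneg ![1, 0, 1, 0, 0, 0]
  have q3 := hG.dotProduct_mulVec_nonneg ![0, 1, 1, 0, 0, 0]
  have e1 := (h 1 0 0).trans (le_abs_self _)
  have e2 := (h 0 1 0).trans (le_abs_self _)
  have e3 := (h 0 0 1).trans (le_abs_self _)
  have e4 := (h 1 1 0).trans (le_abs_self _)
  have e5 := (h 1 (-1) 0).trans (le_abs_self _)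
  have e6 := (h 1 0 1).trans (le_abs_self _)
  have e7 := (h 1 0 (-1)).trans (le_abs_self _)
  have e8 := (h 0 1 1).trans (le_abs_self _)
  have e9 := (h 0 1 (-1)).trans (le_abs_self _)
  have p1 := abs_nonneg (F 1 0 0)
  have p2 := abs_nonneg (F 0 1 0)
  have p3 := abs_nonneg (F 0 0 1)
  have p4 := abs_nonneg (F 1 1 0)
  have p5 := abs_nonneg (F 1 (-1) 0)
  have p6 := abs_nonneg (F 1 0 1)
  have p7 := abs_nonneg (F 1 0 (-1))
  have p8 := abs_nonneg (F 0 1 1)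
  have p9 := abs_nonneg (F 0 1 (-1))
  simp [mv, dotProduct, mulVec, Fin.sum_univ_six] at e1 e2 e3 e4 e5 e6 e7 e8 e9 q1 q2 q3
  fin_cases i <;> simp <;> linarith

open Matrix in
theorem exists_gram {F : ℝ → ℝ → ℝ → ℝ} (hF : IsQuartic F) (hpos : ∀ x y z, 0 ≤ F x y z) :
    ∃ G : Matrix (Fin 6) (Fin 6) ℝ, G.PosSemidef ∧
      ∀ x y z, F x y z = mv x y z ⬝ᵥ G *ᵥ mv x y z := by
  let K : Set (Matrix (Fin 6) (Fin 6) ℝ) :=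
    {G | G.PosSemidef ∧ ∀ x y z, mv x y z ⬝ᵥ G *ᵥ mv x y z ≤ F x y z}
  have hcl : IsClosed K := by
    have : K = {G | G.conjTranspose = G} ∩ (⋂ v : Fin 6 → ℝ, {G | 0 ≤ star v ⬝ᵥ G *ᵥ v}) ∩
        (⋂ x, ⋂ y, ⋂ z, {G | mv x y z ⬝ᵥ G *ᵥ mv x y z ≤ F x y z}) := by
      ext G
      simp only [K, posSemidef_iff_dotProduct_mulVec, Set.mem_setOf_eq, Set.mem_inter_iff,
        Set.mem_iInter, IsHermitian]
    rw [this]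
    refine ((isClosed_eq (by fun_prop) (by fun_prop)).inter
      (isClosed_iInter fun v => isClosed_le (by fun_prop) (by fun_prop))).inter
      (isClosed_iInter fun x => isClosed_iInter fun y => isClosed_iInter fun z =>
        isClosed_le (by fun_prop) (by fun_prop))
  obtain ⟨C, hC⟩ := diag_bound F
  have hcomp : IsCompact K := by
    have hbox : IsCompact (Set.univ.pi fun _ : Fin 6 => Set.univ.pi fun _ : Fin 6 =>
        Set.Icc (-C) C) := isCompact_univ_pi fun _ => isCompact_univ_pi fun _ => isCompact_Icc
    refine IsCompact.of_isClosed_subset hbox hcl ?_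
    intro G hG i _ j _
    exact entry_bound G hG.1 C (hC G hG.1 hG.2) i j
  have hne : K.Nonempty := ⟨0, PosSemidef.zero, fun x y z => by simpa using hpos x y z⟩
  obtain ⟨G, hG, hmax⟩ := hcomp.exists_isMaxOn (f := fun G => G.trace) hne
    (Continuous.continuousOn (by fun_prop))
  refine ⟨G, hG.1, ?_⟩
  by_contra! hcon
  obtain ⟨x, y, z, hxyz⟩ := hcon
  have hR : IsQuartic (fun x y z => F x y z - mv x y z ⬝ᵥ G *ᵥ mv x y z) :=
    (hF.add ((isQuartic_gram G).smul (-1))).congr fun x y z => by ring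
  obtain ⟨q, ⟨a, b, c, d, e, f, hq⟩, ⟨x', y', z', hne'⟩, hle⟩ := good_of_nonneg hR
    (fun x y z => sub_nonneg.mpr (hG.2 x y z)) ⟨x, y, z, sub_ne_zero.mpr hxyz⟩
  let w : Fin 6 → ℝ := ![a, b, c, d, e, f]
  have hqw : ∀ x y z, q x y z = w ⬝ᵥ mv x y z := by
    intro x y z
    rw [hq]; simp [w, mv, dotProduct, Fin.sum_univ_six]
  have hmem : G + vecMulVec w w ∈ K := by
    refine ⟨hG.1.add (by simpa using posSemidef_vecMulVec_self_star w), fun x y z => ?_⟩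
    have h1 := hle x y z
    rw [hqw] at h1
    rw [add_mulVec, dotProduct_add, vecMulVec_mulVec]
    have h2 : mv x y z ⬝ᵥ MulOpposite.op (w ⬝ᵥ mv x y z) • w = (w ⬝ᵥ mv x y z) ^ 2 := by
      rw [op_smul_eq_smul, dotProduct_smul, dotProduct_comm, smul_eq_mul, sq]
    rw [h2]
    linarith
  have htr := hmax hmem
  have h3 : G.trace + w ⬝ᵥ w ≤ G.trace := by simpa [trace_add, trace_vecMulVec] using htr
  have h4 : w ⬝ᵥ w = 0 := le_antisymm (by linarith) (by
    simpa using dotProduct_star_self_nonneg w)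
  have h5 : w = 0 := dotProduct_self_eq_zero.mp h4
  exact hne' (by rw [hqw, h5, zero_dotProduct])

end TQ

/-- Hilbert's theorem on ternary quartics: every nonnegative ternary quartic form is a
sum of squares of quadratic forms. -/
theorem nonneg_ternary_quartic_sum_of_squares (p : MvPolynomial (Fin 3) ℝ)
    (hhom : p.IsHomogeneous 4) (hnonneg : ∀ v : Fin 3 → ℝ, 0 ≤ eval v p) :
    ∃ (k : ℕ) (q : Fin k → MvPolynomial (Fin 3) ℝ),
      (∀ i, (q i).IsHomogeneous 2) ∧ p = ∑ i, (q i) ^ 2 := by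
  obtain ⟨G, hG, hGF⟩ := TQ.exists_gram (TQ.isQuartic_eval p hhom) (fun x y z => hnonneg _)
  obtain ⟨B, rfl⟩ : ∃ B : Matrix (Fin 6) (Fin 6) ℝ, G = B.conjTranspose * B := by
    open scoped MatrixOrder in
    exact (CStarAlgebra.nonneg_iff_eq_star_mul_self).mp hG.nonneg
  let M : Fin 6 → MvPolynomial (Fin 3) ℝ :=
    ![X 0 * X 0, X 1 * X 1, X 2 * X 2, X 0 * X 1, X 0 * X 2, X 1 * X 2]
  refine ⟨6, fun i => ∑ j, C (B i j) * M j, fun i => ?_, ?_⟩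
  · refine IsHomogeneous.sum _ _ _ fun j _ => ?_
    have hM : (M j).IsHomogeneous 2 := by
      fin_cases j <;> exact (isHomogeneous_X ℝ _).mul (isHomogeneous_X ℝ _)
    simpa using (isHomogeneous_C (Fin 3) (B i j)).mul hM
  · refine MvPolynomial.funext fun v => ?_
    have hv : v = ![v 0, v 1, v 2] := by ext i; fin_cases i <;> rfl
    have h1 := hGF (v 0) (v 1) (v 2)
    rw [← hv] at h1
    rw [h1, ← Matrix.mulVec_mulVec, Matrix.dotProduct_mulVec, Matrix.vecMul_conjTranspose]
    simp only [map_sum, map_pow, map_mul, eval_C, dotProduct, Matrix.mulVec]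
    have hM : ∀ j, eval v (M j) = TQ.mv (v 0) (v 1) (v 2) j := by
      intro j; fin_cases j <;> simp [M, TQ.mv, sq]
    simp [hM, sq, Matrix.mulVec, dotProduct]
end

section
/- Artin's solution of Hilbert's 17th problem: for every polynomial p in ℝ[x_1,...,x_n] with p(x) >= 0 for all x in ℝ^n, there exists a nonzero polynomial σ in ℝ[x_1,...,x_n] that is a sum of squares of polynomials such that σ · p is a sum of squares of polynomials. Equivalently, p is a sum of squares of rational functions. -/
section Helpers
open Polynomial
set_option linter.unusedSectionVars false

def PIVT (R : Type*) [Field R] [LinearOrder R] : Prop :=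
  ∀ (f : R[X]) (a b : R), a < b → f.eval a * f.eval b < 0 → ∃ c, a < c ∧ c < b ∧ f.eval c = 0

section A
variable {R : Type*} [Field R] [LinearOrder R] [IsStrictOrderedRing R]

theorem rolle_aux (h : PIVT R) (f : R[X]) (hf : f ≠ 0) (a b : R) (hab : a < b)
    (ha : f.eval a = 0) (hb : f.eval b = 0) (hno : ∀ c, a < c → c < b → f.eval c ≠ 0) :
    ∃ c, a < c ∧ c < b ∧ f.derivative.eval c = 0 := by
  obtain ⟨g0, hg0, hd0⟩ := exists_eq_pow_rootMultiplicity_mul_and_not_dvd f hf a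
  have hm : 0 < f.rootMultiplicity a := (rootMultiplicity_pos hf).2 ha
  obtain ⟨m, hm'⟩ := Nat.exists_eq_succ_of_ne_zero hm.ne'
  rw [hm'] at hg0
  have hg0z : g0 ≠ 0 := by rintro rfl; simp at hd0
  have hg0b : g0.eval b = 0 := by
    have := hb
    rw [hg0] at this
    simpa [sub_ne_zero.2 hab.ne'] using this
  obtain ⟨g, hg, hd⟩ := exists_eq_pow_rootMultiplicity_mul_and_not_dvd g0 hg0z b
  have hn : 0 < g0.rootMultiplicity b := (rootMultiplicity_pos hg0z).2 hg0b
  obtain ⟨n, hn'⟩ := Nat.exists_eq_succ_of_ne_zero hn.ne'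
  rw [hn'] at hg
  have hga : g.eval a ≠ 0 := by
    intro h0
    apply hd0
    rw [dvd_iff_isRoot, IsRoot, hg]
    simp [h0]
  have hgb : g.eval b ≠ 0 := by
    intro h0
    apply hd
    rw [dvd_iff_isRoot, IsRoot, h0]
  have hpos : 0 < g.eval a * g.eval b := by
    rcases lt_trichotomy (g.eval a * g.eval b) 0 with h1 | h1 | h1
    · obtain ⟨c, h2, h3, h4⟩ := h g a b hab h1
      exact absurd (by rw [hg0, hg]; simp [h4]) (hno c h2 h3)
    · exact absurd h1 (mul_ne_zero hga hgb)
    · exact h1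
  let g1 : R[X] := C ((m:R)+1) * (X - C b) * g + C ((n:R)+1) * (X - C a) * g
    + (X - C a) * (X - C b) * derivative g
  have hfd : derivative f = (X - C a)^m * (X - C b)^n * g1 := by
    rw [hg0, hg]
    simp only [g1, derivative_mul, derivative_pow_succ, derivative_sub, derivative_X, derivative_C,
      Nat.succ_eq_add_one]
    simp only [map_add, map_natCast, map_one]
    ring
  have h1 : g1.eval a * g1.eval b < 0 := by
    have e : g1.eval a * g1.eval b
      = - (((m:R)+1) * ((n:R)+1) * (b-a)^2 * (g.eval a * g.eval b)) := by
      simp [g1]; ring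
    rw [e]
    have : 0 < b - a := sub_pos.2 hab
    have : 0 < (((m:R)+1) * ((n:R)+1) * (b-a)^2 * (g.eval a * g.eval b)) := by positivity
    linarith
  obtain ⟨c, h2, h3, h4⟩ := h g1 a b hab h1
  exact ⟨c, h2, h3, by rw [hfd]; simp [h4]⟩

theorem rolle0 (h : PIVT R) (f : R[X]) (a b : R) (hab : a < b)
    (ha : f.eval a = 0) (hb : f.eval b = 0) :
    ∃ c, a < c ∧ c < b ∧ f.derivative.eval c = 0 := by
  by_cases hf : f = 0
  · exact ⟨(a+b)/2, by linarith, by linarith, by simp [hf]⟩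
  obtain ⟨b', hb', hmin⟩ := (f.roots.toFinset.filter (fun x => a < x)).exists_min_image id
    ⟨b, by simp [hf, hab, hb]⟩
  simp only [Finset.mem_filter, Multiset.mem_toFinset, mem_roots hf, IsRoot, id] at hb' hmin
  obtain ⟨c, h1, h2, h3⟩ := rolle_aux h f hf a b' hb'.2 ha hb'.1
    (fun c h1 h2 h3 => absurd (hmin c ⟨h3, h1⟩) (not_le.2 h2))
  exact ⟨c, h1, h2.trans_le (hmin b ⟨hb, hab⟩), h3⟩

theorem rolle (h : PIVT R) (f : R[X]) (a b : R) (hab : a < b)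
    (he : f.eval a = f.eval b) :
    ∃ c, a < c ∧ c < b ∧ f.derivative.eval c = 0 := by
  simpa using rolle0 h (f - C (f.eval b)) a b hab (by simp [he]) (by simp)

theorem cell_pos (h : PIVT R) (f : R[X]) (a b : R)
    (hd : ∀ c, a < c → c < b → f.derivative.eval c ≠ 0)
    (ha : 0 ≤ f.eval a) (hb : 0 ≤ f.eval b) (x : R) (hx : a < x) (hx' : x < b) :
    0 < f.eval x := by
  by_contra hc
  push Not at hc
  have h1 : f.eval a ≠ f.eval x := fun he => by
    obtain ⟨c, h1, h2, h3⟩ := rolle h f a x hx he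
    exact hd c h1 (h2.trans hx') h3
  have h2 : f.eval x ≠ f.eval b := fun he => by
    obtain ⟨c, h1, h2, h3⟩ := rolle h f x b hx' he
    exact hd c (hx.trans h1) h2 h3
  have h1' : f.eval x < f.eval a := lt_of_le_of_ne (hc.trans ha) h1.symm
  have h2' : f.eval x < f.eval b := lt_of_le_of_ne (hc.trans hb) h2
  obtain ⟨v, hv1, hv2⟩ := exists_between (lt_min h1' h2')
  have hva := hv2.trans_le (min_le_left _ _)
  have hvb := hv2.trans_le (min_le_right _ _)
  obtain ⟨c, c1, c2, c3⟩ := h (f - C v) a x hx (by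
    simp only [eval_sub, eval_C]; exact mul_neg_of_pos_of_neg (by linarith) (by linarith))
  obtain ⟨d, d1, d2, d3⟩ := h (f - C v) x b hx' (by
    simp only [eval_sub, eval_C]; exact mul_neg_of_neg_of_pos (by linarith) (by linarith))
  simp only [eval_sub, eval_C] at c3 d3
  obtain ⟨e, e1, e2, e3⟩ := rolle h f c d (c2.trans d1) (by linarith)
  exact hd e (c1.trans e1) (e2.trans d2) e3

theorem cell_neg (h : PIVT R) (f : R[X]) (a b : R)
    (hd : ∀ c, a < c → c < b → f.derivative.eval c ≠ 0)
    (ha : f.eval a ≤ 0) (hb : f.eval b ≤ 0) (x : R) (hx : a < x) (hx' : x < b) :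
    f.eval x < 0 := by
  have := cell_pos h (-f) a b (by simpa using hd) (by simpa using ha) (by simpa using hb) x hx hx'
  simpa using this

theorem cell_sign (h : PIVT R) (f : R[X]) (a b : R)
    (hd : ∀ c, a < c → c < b → f.derivative.eval c ≠ 0) :
    (0 ≤ f.eval a → 0 ≤ f.eval b → ∀ x ∈ Set.Ioo a b, SignType.sign (f.eval x) = 1) ∧
    (f.eval a ≤ 0 → f.eval b ≤ 0 → ∀ x ∈ Set.Ioo a b, SignType.sign (f.eval x) = -1) :=
  ⟨fun h1 h2 x hx => sign_eq_one_iff.2 (cell_pos h f a b hd h1 h2 x hx.1 hx.2),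
    fun h1 h2 x hx => sign_eq_neg_one_iff.2 (cell_neg h f a b hd h1 h2 x hx.1 hx.2)⟩
end A

section B
variable {R L : Type*} [Field R] [LinearOrder R] [IsStrictOrderedRing R]
  [Field L] [LinearOrder L] [IsStrictOrderedRing L]

/-- Two intervals are cut into cells with matching signs. -/
inductive Good (S : Set (R[X] × L[X])) : R → R → L → L → Prop
  | base (a b : R) (c d : L) (hab : a < b) (hcd : c < d)
      (hs : ∀ f ∈ S, ∀ x ∈ Set.Ioo a b, ∀ y ∈ Set.Ioo c d,
        SignType.sign (f.1.eval x) = SignType.sign (f.2.eval y)) : Good S a b c d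
  | glue (a m b : R) (c m' d : L) (h1 : Good S a m c m') (h2 : Good S m b m' d)
      (hs : ∀ f ∈ S, SignType.sign (f.1.eval m) = SignType.sign (f.2.eval m'))
      (hg : ∃ g ∈ S, g.1 ≠ 0 ∧ g.2 ≠ 0 ∧ g.1.eval m = 0 ∧ g.2.eval m' = 0) : Good S a b c d

theorem Good.extract {S : Set (R[X] × L[X])} {a b : R} {c d : L} (h : Good S a b c d) :
    ∀ y ∈ Set.Ioo c d, ∃ x, ∀ f ∈ S,
      SignType.sign (f.1.eval x) = SignType.sign (f.2.eval y) := by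
  induction h with
  | base a b c d hab hcd hs =>
    intro y hy
    obtain ⟨x, hx⟩ := exists_between hab
    exact ⟨x, fun f hf => hs f hf x hx y hy⟩
  | glue a m b c m' d h1 h2 hs hg ih1 ih2 =>
    intro y hy
    rcases lt_trichotomy y m' with h | h | h
    · exact ih1 y ⟨hy.1, h⟩
    · subst h; exact ⟨m, hs⟩
    · exact ih2 y ⟨h, hy.2⟩

theorem no_root_of_const_sign (f : R[X]) (hf : f ≠ 0) (a b : R) (hab : a < b)
    (h : ∀ x ∈ Set.Ioo a b, ∀ y ∈ Set.Ioo a b, f.eval x = 0 → f.eval y = 0) :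
    ∀ x ∈ Set.Ioo a b, f.eval x ≠ 0 := by
  intro x hx h0
  apply hf
  apply Polynomial.eq_zero_of_infinite_isRoot
  exact (Set.Ioo_infinite hab).mono (fun y hy => h x hx y hy h0)

theorem Good.step (hR : PIVT R) (hL : PIVT L) {S : Set (R[X] × L[X])} (f : R[X] × L[X])
    (hd : (f.1.derivative ≠ 0 ∧ f.2.derivative ≠ 0 ∧ (f.1.derivative, f.2.derivative) ∈ S) ∨
      (∀ x y, SignType.sign (f.1.eval x) = SignType.sign (f.2.eval y)))
    (hr : ∀ g ∈ S, g.1 ≠ 0 → g.2 ≠ 0 → ∀ x y, g.1.eval x = 0 → g.2.eval y = 0 →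
      (∀ r ∈ S, SignType.sign (r.1.eval x) = SignType.sign (r.2.eval y)) →
      SignType.sign (f.1.eval x) = SignType.sign (f.2.eval y))
    {a b : R} {c d : L} (h : Good S a b c d) :
    SignType.sign (f.1.eval a) = SignType.sign (f.2.eval c) →
    SignType.sign (f.1.eval b) = SignType.sign (f.2.eval d) → Good (insert f S) a b c d := by
  induction h with
  | glue a m b c m' d h1 h2 hs hg ih1 ih2 =>
    intro ha hb
    obtain ⟨g, hgS, g1, g2, g3, g4⟩ := hg
    have hm := hr g hgS g1 g2 m m' g3 g4 hs
    refine Good.glue a m b c m' d (ih1 ha hm) (ih2 hm hb) ?_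
      ⟨g, Set.mem_insert_of_mem _ hgS, g1, g2, g3, g4⟩
    rintro k (rfl | hk)
    exacts [hm, hs k hk]
  | base a b c d hab hcd hs =>
    intro ha hb
    have ins : ∀ a' b' c' d', a ≤ a' → a' < b' → b' ≤ b → c ≤ c' → c' < d' → d' ≤ d →
        (∀ x ∈ Set.Ioo a' b', ∀ y ∈ Set.Ioo c' d',
          SignType.sign (f.1.eval x) = SignType.sign (f.2.eval y)) →
        Good (insert f S) a' b' c' d' := by
      intro a' b' c' d' h1 h2 h3 h4 h5 h6 h7
      refine Good.base _ _ _ _ h2 h5 ?_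
      rintro k (rfl | hk) x hx y hy
      · exact h7 x hx y hy
      · exact hs k hk x ⟨h1.trans_lt hx.1, hx.2.trans_le h3⟩ y ⟨h4.trans_lt hy.1, hy.2.trans_le h6⟩
    rcases hd with ⟨hd1, hd2, hdS⟩ | hd
    swap
    · exact ins a b c d le_rfl hab le_rfl le_rfl hcd le_rfl (fun x _ y _ => hd x y)
    obtain ⟨x0, hx0⟩ := exists_between hab
    obtain ⟨y0, hy0⟩ := exists_between hcd
    have n1 : ∀ x ∈ Set.Ioo a b, f.1.derivative.eval x ≠ 0 := by
      apply no_root_of_const_sign _ hd1 _ _ hab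
      intro x hx y hy h0
      have e1 := hs _ hdS x hx y0 hy0
      have e2 := hs _ hdS y hy y0 hy0
      rw [← e1] at e2
      simpa [h0] using e2
    have n2 : ∀ x ∈ Set.Ioo c d, f.2.derivative.eval x ≠ 0 := by
      apply no_root_of_const_sign _ hd2 _ _ hcd
      intro x hx y hy h0
      have e1 := hs _ hdS x0 hx0 x hx
      have e2 := hs _ hdS x0 hx0 y hy
      rw [e1] at e2
      simpa [h0] using e2.symm
    have s1 := cell_sign hR f.1
    have s2 := cell_sign hL f.2
    -- the crossing case
    have cross : (f.1.eval a * f.1.eval b < 0) → (f.2.eval c * f.2.eval d < 0) →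
        Good (insert f S) a b c d := by
      intro hm1 hm2
      obtain ⟨m, m1, m2, m3⟩ := hR f.1 a b hab hm1
      obtain ⟨m', m1', m2', m3'⟩ := hL f.2 c d hcd hm2
      refine Good.glue a m b c m' d ?_ ?_ ?_ ⟨f, Set.mem_insert _ _, ?_, ?_, m3, m3'⟩
      · refine ins _ _ _ _ le_rfl m1 m2.le le_rfl m1' m2'.le ?_
        have t1 := s1 a m (fun x h1 h2 => n1 x ⟨h1, h2.trans m2⟩)
        have t2 := s2 c m' (fun x h1 h2 => n2 x ⟨h1, h2.trans m2'⟩)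
        intro x hx y hy
        rcases le_total 0 (f.1.eval a) with hh | hh
        · have hh2 : 0 ≤ f.2.eval c := by
            rwa [← sign_nonneg_iff, ha.symm, sign_nonneg_iff]
          rw [t1.1 hh m3.ge x hx, t2.1 hh2 m3'.ge y hy]
        · have hh2 : f.2.eval c ≤ 0 := by
            rwa [← sign_nonpos_iff, ha.symm, sign_nonpos_iff]
          rw [t1.2 hh m3.le x hx, t2.2 hh2 m3'.le y hy]
      · refine ins _ _ _ _ m1.le m2 le_rfl m1'.le m2' le_rfl ?_
        have t1 := s1 m b (fun x h1 h2 => n1 x ⟨m1.trans h1, h2⟩)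
        have t2 := s2 m' d (fun x h1 h2 => n2 x ⟨m1'.trans h1, h2⟩)
        intro x hx y hy
        rcases le_total 0 (f.1.eval b) with hh | hh
        · have hh2 : 0 ≤ f.2.eval d := by
            rwa [← sign_nonneg_iff, hb.symm, sign_nonneg_iff]
          rw [t1.1 m3.ge hh x hx, t2.1 m3'.ge hh2 y hy]
        · have hh2 : f.2.eval d ≤ 0 := by
            rwa [← sign_nonpos_iff, hb.symm, sign_nonpos_iff]
          rw [t1.2 m3.le hh x hx, t2.2 m3'.le hh2 y hy]
      · rintro k (rfl | hk)
        · rw [m3, m3', sign_zero, sign_zero]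
        · exact hs k hk m ⟨m1, m2⟩ m' ⟨m1', m2'⟩
      · rintro h0; simp [h0] at hd1
      · rintro h0; simp [h0] at hd2
    have t1 := s1 a b (fun x h1 h2 => n1 x ⟨h1, h2⟩)
    have t2 := s2 c d (fun x h1 h2 => n2 x ⟨h1, h2⟩)
    by_cases p1 : 0 ≤ f.1.eval a ∧ 0 ≤ f.1.eval b
    · have q1 : 0 ≤ f.2.eval c := by rw [← sign_nonneg_iff, ha.symm, sign_nonneg_iff]; exact p1.1
      have q2 : 0 ≤ f.2.eval d := by rw [← sign_nonneg_iff, hb.symm, sign_nonneg_iff]; exact p1.2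
      refine ins _ _ _ _ le_rfl hab le_rfl le_rfl hcd le_rfl (fun x hx y hy => ?_)
      rw [t1.1 p1.1 p1.2 x hx, t2.1 q1 q2 y hy]
    by_cases p2 : f.1.eval a ≤ 0 ∧ f.1.eval b ≤ 0
    · have q1 : f.2.eval c ≤ 0 := by rw [← sign_nonpos_iff, ha.symm, sign_nonpos_iff]; exact p2.1
      have q2 : f.2.eval d ≤ 0 := by rw [← sign_nonpos_iff, hb.symm, sign_nonpos_iff]; exact p2.2
      refine ins _ _ _ _ le_rfl hab le_rfl le_rfl hcd le_rfl (fun x hx y hy => ?_)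
      rw [t1.2 p2.1 p2.2 x hx, t2.2 q1 q2 y hy]
    have hneg : f.1.eval a * f.1.eval b < 0 := by
      rcases lt_trichotomy (f.1.eval a) 0 with u | u | u
      · refine mul_neg_of_neg_of_pos u ?_
        by_contra hh; exact p2 ⟨u.le, not_lt.1 hh⟩
      · rcases le_total 0 (f.1.eval b) with hh | hh
        · exact absurd ⟨u.ge, hh⟩ p1
        · exact absurd ⟨u.le, hh⟩ p2
      · refine mul_neg_of_pos_of_neg u ?_
        by_contra hh; exact p1 ⟨u.le, not_lt.1 hh⟩
    refine cross hneg ?_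
    rw [← sign_eq_neg_one_iff, sign_mul, ← ha, ← hb, ← sign_mul, sign_eq_neg_one_iff]
    exact hneg
end B
section C

theorem exists_pos_bound {R : Type*} [Field R] [LinearOrder R] [IsStrictOrderedRing R] :
    ∀ (n : ℕ) (f : R[X]), f.natDegree = n → 0 < f.leadingCoeff →
    ∃ M δ : R, 0 < δ ∧ ∀ x, M ≤ x → δ ≤ f.eval x := by
  intro n
  induction n with
  | zero =>
    intro f hf h
    rw [natDegree_eq_zero] at hf
    obtain ⟨c, rfl⟩ := hf
    exact ⟨0, c, by simpa using h, by simp⟩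
  | succ n ih =>
    intro f hf h
    have hd : f.divX.natDegree = n := by rw [natDegree_divX_eq_natDegree_tsub_one, hf]; rfl
    have hl : f.divX.leadingCoeff = f.leadingCoeff := by
      rw [leadingCoeff, leadingCoeff, coeff_divX, hd, hf]
    obtain ⟨M, δ, hδ, hM⟩ := ih f.divX hd (hl ▸ h)
    refine ⟨max M ((|f.coeff 0| + 1)/δ), 1, one_pos, fun x hx => ?_⟩
    have h1 := hM x ((le_max_left _ _).trans hx)
    have h2 := (le_max_right _ _).trans hx
    rw [div_le_iff₀ hδ] at h2
    have hx0 : 0 ≤ x := by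
      have : 0 ≤ |f.coeff 0| := abs_nonneg _
      by_contra hc
      push Not at hc
      nlinarith
    have e : f.eval x = f.divX.eval x * x + f.coeff 0 := by
      conv_lhs => rw [← divX_mul_X_add f]
      simp
    have := neg_abs_le (f.coeff 0)
    rw [e]
    nlinarith

theorem exists_sign_bound {R : Type*} [Field R] [LinearOrder R] [IsStrictOrderedRing R]
    (f : R[X]) : ∃ M : R, ∀ x, M ≤ x →
      SignType.sign (f.eval x) = SignType.sign f.leadingCoeff := by
  rcases lt_trichotomy f.leadingCoeff 0 with h | h | h
  · obtain ⟨M, δ, hδ, hM⟩ := exists_pos_bound _ (-f) rfl (by simpa using h)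
    refine ⟨M, fun x hx => ?_⟩
    have := hM x hx
    rw [eval_neg] at this
    rw [sign_eq_neg_one_iff.2 h, sign_eq_neg_one_iff]
    linarith
  · rw [leadingCoeff_eq_zero] at h
    exact ⟨0, by simp [h]⟩
  · obtain ⟨M, δ, hδ, hM⟩ := exists_pos_bound _ f rfl h
    refine ⟨M, fun x hx => ?_⟩
    have := hM x hx
    rw [sign_eq_one_iff.2 h, sign_eq_one_iff]
    linarith

theorem exists_sign_bound2 {R : Type*} [Field R] [LinearOrder R] [IsStrictOrderedRing R]
    (f : R[X]) : ∃ M : R, ∀ x, M ≤ x →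
      SignType.sign (f.eval x) = SignType.sign f.leadingCoeff ∧
      SignType.sign (f.eval (-x)) = SignType.sign ((-1) ^ f.natDegree * f.leadingCoeff) := by
  obtain ⟨M, hM⟩ := exists_sign_bound f
  obtain ⟨N, hN⟩ := exists_sign_bound (f.comp (-X))
  refine ⟨max M N, fun x hx => ⟨hM x ((le_max_left _ _).trans hx), ?_⟩⟩
  have := hN x ((le_max_right _ _).trans hx)
  rw [eval_comp, leadingCoeff_comp (by simp)] at this
  simpa [mul_comm] using this

theorem exists_sign_bound_finset {R ι : Type*} [Field R] [LinearOrder R] [IsStrictOrderedRing R]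
    (F : ι → R[X]) (s : Finset ι) (N : R) : ∃ M : R, N < M ∧ ∀ i ∈ s,
      SignType.sign ((F i).eval M) = SignType.sign (F i).leadingCoeff ∧
      SignType.sign ((F i).eval (-M)) =
        SignType.sign ((-1) ^ (F i).natDegree * (F i).leadingCoeff) := by
  choose M hM using fun i => exists_sign_bound2 (F i)
  classical
  obtain ⟨B, hB⟩ := (s.image M).exists_le
  refine ⟨max B (N+1), lt_of_lt_of_le (lt_add_one N) (le_max_right _ _), fun i hi => ?_⟩
  exact hM i _ ((hB _ (Finset.mem_image_of_mem _ hi)).trans (le_max_left _ _))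

theorem exists_pseudo {A : Type*} [CommRing A] (g : A[X]) (hg : 0 < g.natDegree) :
    ∀ (n : ℕ) (f : A[X]), f.natDegree ≤ n → ∃ (k : ℕ) (q r : A[X]),
      r.natDegree < g.natDegree ∧ C g.leadingCoeff ^ k * f = q * g + r := by
  intro n
  induction n with
  | zero => 
    intro f hf
    exact ⟨0, 0, f, by omega, by simp⟩
  | succ n ih =>
    intro f hf
    by_cases h : f.natDegree < g.natDegree
    · exact ⟨0, 0, f, by omega, by simp⟩
    push Not at h
    let f1 := C g.leadingCoeff * f - C f.leadingCoeff * X ^ (f.natDegree - g.natDegree) * g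
    have hf1 : f1.natDegree ≤ n := by
      rw [natDegree_le_iff_coeff_eq_zero]
      intro N hN
      simp only [f1, coeff_sub, coeff_C_mul, mul_assoc, coeff_X_pow_mul']
      by_cases h1 : N = f.natDegree
      · subst h1
        rw [if_pos (by omega), Nat.sub_sub_self h]
        simp only [coeff_natDegree]; ring
      · have h2 : f.natDegree < N := by omega
        rw [if_pos (by omega), coeff_eq_zero_of_natDegree_lt h2,
          coeff_eq_zero_of_natDegree_lt (p := g) (by omega)]
        simp
    obtain ⟨k, q, r, hr, e⟩ := ih f1 hf1
    refine ⟨k+1, q + C g.leadingCoeff ^ k * (C f.leadingCoeff * X ^ (f.natDegree - g.natDegree)),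
      r, hr, ?_⟩
    have : C g.leadingCoeff ^ (k+1) * f = C g.leadingCoeff ^ k * f1 +
      C g.leadingCoeff ^ k * (C f.leadingCoeff * X ^ (f.natDegree - g.natDegree)) * g := by
      simp only [f1]; ring
    rw [this, e]; ring

theorem exists_pseudo_even {A : Type*} [CommRing A] (f g : A[X]) : ∃ (r : A[X]),
    0 < g.natDegree → r.natDegree < g.natDegree ∧ ∃ (k : ℕ) (q : A[X]),
      C g.leadingCoeff ^ (2*k) * f = q * g + r := by
  by_cases hg : 0 < g.natDegree
  · obtain ⟨k, q, r, hr, e⟩ := exists_pseudo g hg _ f le_rfl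
    refine ⟨C (g.leadingCoeff ^ k) * r, fun _ => ⟨?_, k, C g.leadingCoeff ^ k * q, ?_⟩⟩
    · exact (natDegree_C_mul_le _ _).trans_lt hr
    · rw [two_mul, pow_add, mul_assoc, e, C_pow]; ring
  · exact ⟨0, fun h => absurd h hg⟩

noncomputable def psrem {A : Type*} [CommRing A] (f g : A[X]) : A[X] :=
  (exists_pseudo_even f g).choose

theorem psrem_spec {A : Type*} [CommRing A] (f g : A[X]) (hg : 0 < g.natDegree) :
    (psrem f g).natDegree < g.natDegree ∧ ∃ (k : ℕ) (q : A[X]),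
      C g.leadingCoeff ^ (2*k) * f = q * g + psrem f g :=
  (exists_pseudo_even f g).choose_spec hg

/-- Sets closed under the operations of the algorithm, above degree `d`. -/
def ClosedAbove {A : Type*} [CommRing A] (d : ℕ) (T : Finset A[X]) : Prop :=
  ∀ f ∈ T, d < f.natDegree → f.derivative ∈ T ∧ f.eraseLead ∈ T ∧
    ∀ g ∈ T, d < g.natDegree → g.natDegree ≤ f.natDegree → psrem f g ∈ T

theorem exists_closure_aux {A : Type*} [CommRing A] (S : Finset A[X]) (D : ℕ)
    (hD : ∀ f ∈ S, f.natDegree ≤ D) :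
    ∀ (e d : ℕ), d + e = D → ∃ T : Finset A[X], S ⊆ T ∧ (∀ f ∈ T, f.natDegree ≤ D) ∧
      ClosedAbove d T := by
  classical
  intro e
  induction e with
  | zero =>
    rintro d rfl
    exact ⟨S, subset_rfl, hD, fun f hf h => absurd (hD f hf) (by omega)⟩
  | succ e ih =>
    intro d hd
    obtain ⟨T, hST, hTD, hT⟩ := ih (d+1) (by omega)
    let U := T.filter (fun f => d < f.natDegree)
    let V := U.image derivative ∪ U.image eraseLead ∪
      ((U ×ˢ U).filter (fun p => p.2.natDegree ≤ p.1.natDegree)).image (fun p => psrem p.1 p.2)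
    have hder : ∀ f : A[X], d < f.natDegree → f.derivative.natDegree < f.natDegree :=
      fun f hf => natDegree_derivative_lt (by omega)
    have hera : ∀ f : A[X], d < f.natDegree → f.eraseLead.natDegree < f.natDegree :=
      fun f hf => lt_of_le_of_lt f.eraseLead_natDegree_le (by omega)
    have hU : ∀ f, f ∈ U ↔ f ∈ T ∧ d < f.natDegree := fun f => by simp [U]
    have hV : ∀ v ∈ V, v ∈ T ∨ v.natDegree ≤ d := by
      intro v hv
      simp only [V, Finset.mem_union, Finset.mem_image, Finset.mem_filter, Finset.mem_product] at hv
      rcases hv with (⟨f, hf, rfl⟩ | ⟨f, hf, rfl⟩) | ⟨⟨f, g⟩, ⟨⟨hf, hg⟩, hfg⟩, rfl⟩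
      · rw [hU] at hf
        by_cases h : d + 1 < f.natDegree
        · exact Or.inl (hT f hf.1 h).1
        · have := hder f hf.2
          exact Or.inr (by omega)
      · rw [hU] at hf
        by_cases h : d + 1 < f.natDegree
        · exact Or.inl (hT f hf.1 h).2.1
        · have := hera f hf.2
          exact Or.inr (by omega)
      · rw [hU] at hf hg
        dsimp only at hf hg hfg ⊢
        by_cases h : d + 1 < g.natDegree
        · exact Or.inl ((hT f hf.1 (by omega)).2.2 g hg.1 h hfg)
        · have := (psrem_spec f g (by omega)).1
          exact Or.inr (by omega)
    refine ⟨T ∪ V, hST.trans Finset.subset_union_left, ?_, ?_⟩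
    · intro f hf
      rcases Finset.mem_union.1 hf with hf | hf
      · exact hTD f hf
      · rcases hV f hf with h | h
        · exact hTD f h
        · omega
    · have key : ∀ f ∈ T ∪ V, d < f.natDegree → f ∈ U := by
        intro f hf hd
        rw [hU]
        rcases Finset.mem_union.1 hf with hf | hf
        · exact ⟨hf, hd⟩
        · rcases hV f hf with h | h
          · exact ⟨h, hd⟩
          · omega
      intro f hf hdf
      have hfU := key f hf hdf
      refine ⟨Finset.mem_union_right _ ?_, Finset.mem_union_right _ ?_, fun g hg hdg hgf =>
        Finset.mem_union_right _ ?_⟩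
      · simp only [V, Finset.mem_union, Finset.mem_image]
        exact Or.inl (Or.inl ⟨f, hfU, rfl⟩)
      · simp only [V, Finset.mem_union, Finset.mem_image]
        exact Or.inl (Or.inr ⟨f, hfU, rfl⟩)
      · simp only [V, Finset.mem_union, Finset.mem_image, Finset.mem_filter, Finset.mem_product]
        exact Or.inr ⟨(f, g), ⟨⟨hfU, key g hg hdg⟩, hgf⟩, rfl⟩

theorem exists_closure {A : Type*} [CommRing A] (S : Finset A[X]) :
    ∃ T : Finset A[X], S ⊆ T ∧ ClosedAbove 0 T := by
  obtain ⟨T, h1, _, h2⟩ := exists_closure_aux S (S.sup natDegree)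
    (fun f hf => Finset.le_sup hf) (S.sup natDegree) 0 (by omega)
  exact ⟨T, h1, h2⟩

section
variable {A R L : Type*} [CommRing A] [Field R] [LinearOrder R] [IsStrictOrderedRing R]
  [Field L] [LinearOrder L] [IsStrictOrderedRing L]

theorem sign_eq_zero_iff' (φ : A →+* R) (ψ : A →+* L) {a : A}
    (h : SignType.sign (φ a) = SignType.sign (ψ a)) : φ a = 0 ↔ ψ a = 0 := by
  rw [← sign_eq_zero_iff, h, sign_eq_zero_iff]

theorem map_eraseLead_of_zero {B : Type*} [CommRing B] (φ : A →+* B) (f : A[X])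
    (h : φ f.leadingCoeff = 0) : f.eraseLead.map φ = f.map φ := by
  have e := congrArg (Polynomial.map φ) f.eraseLead_add_C_mul_X_pow
  rw [Polynomial.map_add, Polynomial.map_mul, Polynomial.map_C, h] at e
  simpa using e

theorem normalize_poly (T : Finset A[X]) (hT : ClosedAbove 0 T) (φ : A →+* R) (ψ : A →+* L)
    (hs : ∀ f ∈ T, SignType.sign (φ f.leadingCoeff) = SignType.sign (ψ f.leadingCoeff)) :
    ∀ (n : ℕ) (f : A[X]), f ∈ T → f.natDegree ≤ n → ∃ g ∈ T, (g = f ∨ g.natDegree < f.natDegree) ∧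
      g.map φ = f.map φ ∧ g.map ψ = f.map ψ ∧ ((f.map φ = 0 ∧ f.map ψ = 0) ∨
        (φ g.leadingCoeff ≠ 0 ∧ ψ g.leadingCoeff ≠ 0)) := by
  intro n
  induction n with
  | zero =>
    intro f hf hn
    refine ⟨f, hf, Or.inl rfl, rfl, rfl, ?_⟩
    have hn' : f.natDegree = 0 := by omega
    have h2 := sign_eq_zero_iff' φ ψ (hs f hf)
    by_cases h : φ f.leadingCoeff = 0
    · left
      rw [natDegree_eq_zero] at hn'
      obtain ⟨c, rfl⟩ := hn'
      simp only [leadingCoeff_C] at h h2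
      simp [h, h2.1 h]
    · exact Or.inr ⟨h, fun h' => h (h2.2 h')⟩
  | succ n ih =>
    intro f hf hn
    have h2 := sign_eq_zero_iff' φ ψ (hs f hf)
    by_cases h : φ f.leadingCoeff = 0
    · by_cases h0 : f.natDegree = 0
      · exact ih f hf (by omega)
      have hl := lt_of_le_of_lt f.eraseLead_natDegree_le (show f.natDegree - 1 < f.natDegree by omega)
      obtain ⟨g, hg, h3, h4, h5, h6⟩ := ih f.eraseLead (hT f hf (by omega)).2.1 (by omega)
      rw [map_eraseLead_of_zero φ f h] at h4 h6
      rw [map_eraseLead_of_zero ψ f (h2.1 h)] at h5 h6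
      refine ⟨g, hg, Or.inr ?_, h4, h5, h6⟩
      rcases h3 with rfl | h3
      · exact hl
      · exact h3.trans hl
    · exact ⟨f, hf, Or.inl rfl, rfl, rfl, Or.inr ⟨h, fun h' => h (h2.2 h')⟩⟩

theorem sign_psrem {f g : A[X]} (hg : 0 < g.natDegree) (φ : A →+* R) (h : φ g.leadingCoeff ≠ 0)
    (x : R) (hx : (g.map φ).eval x = 0) :
    SignType.sign ((f.map φ).eval x) = SignType.sign (((psrem f g).map φ).eval x) := by
  obtain ⟨_, k, q, e⟩ := psrem_spec f g hg
  have e2 := congrArg (fun p => (p.map φ).eval x) e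
  simp only [Polynomial.map_mul, Polynomial.map_add, Polynomial.map_pow, Polynomial.map_C,
    eval_mul, eval_add, eval_pow, eval_C, hx, mul_zero, zero_add] at e2
  have hpos : 0 < φ g.leadingCoeff ^ (2*k) := by
    rw [pow_mul]; positivity
  rw [← e2, sign_mul, sign_eq_one_iff.2 hpos, one_mul]

theorem good_of_closed (hR : PIVT R) (hL : PIVT L)
    (T : Finset A[X]) (hT : ClosedAbove 0 T) (φ : A →+* R) (ψ : A →+* L)
    (hs : ∀ f ∈ T, SignType.sign (φ f.leadingCoeff) = SignType.sign (ψ f.leadingCoeff))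
    (a b : R) (c d : L) (hab : a < b) (hcd : c < d)
    (hac : ∀ f ∈ T, SignType.sign ((f.map φ).eval a) = SignType.sign ((f.map ψ).eval c))
    (hbd : ∀ f ∈ T, SignType.sign ((f.map φ).eval b) = SignType.sign ((f.map ψ).eval d))
    (s : Finset A[X]) : s ⊆ T → (∀ x ∈ s, ∀ y ∈ T, y.natDegree < x.natDegree → y ∈ s) →
    Good (Set.image (fun f : A[X] => (f.map φ, f.map ψ)) (s : Set A[X])) a b c d := by
  classical
  induction s using Finset.induction_on_max_value (fun f : A[X] => f.natDegree) with
  | empty =>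
    intro _ _
    exact Good.base _ _ _ _ hab hcd (by simp)
  | insert f s hfs hmax ih =>
    intro hsT hdown
    have hfT : f ∈ T := hsT (Finset.mem_insert_self _ _)
    have hsT' : s ⊆ T := fun x hx => hsT (Finset.mem_insert_of_mem hx)
    have hlow : ∀ y ∈ T, y.natDegree < f.natDegree → y ∈ s := by
      intro y hy hlt
      rcases Finset.mem_insert.1 (hdown f (Finset.mem_insert_self _ _) y hy hlt) with rfl | h
      · omega
      · exact h
    have hG := ih hsT' (fun x hx y hy hlt => hlow y hy (hlt.trans_le (hmax x hx)))
    rw [Finset.coe_insert, Set.image_insert_eq]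
    have hz := sign_eq_zero_iff' φ ψ (hs f hfT)
    by_cases h0 : f.natDegree = 0
    · have hcst : ∀ x y, SignType.sign ((f.map φ).eval x) = SignType.sign ((f.map ψ).eval y) := by
        have h1 := hs f hfT
        rw [natDegree_eq_zero] at h0
        obtain ⟨c, rfl⟩ := h0
        simpa using h1
      exact Good.step hR hL (f.map φ, f.map ψ) (Or.inr hcst) (fun _ _ _ _ x y _ _ _ => hcst x y)
        hG (hac f hfT) (hbd f hfT)
    by_cases h : φ f.leadingCoeff = 0
    · have : f.eraseLead ∈ s := hlow _ (hT f hfT (by omega)).2.1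
        (lt_of_le_of_lt f.eraseLead_natDegree_le (by omega))
      rw [Set.insert_eq_of_mem]
      · exact hG
      · refine ⟨f.eraseLead, this, ?_⟩
        simp only
        rw [map_eraseLead_of_zero φ f h, map_eraseLead_of_zero ψ f (hz.1 h)]
    · have h' : ψ f.leadingCoeff ≠ 0 := fun hh => h (hz.2 hh)
      refine Good.step hR hL (f.map φ, f.map ψ) (Or.inl ⟨?_, ?_, ?_⟩) ?_ hG (hac f hfT) (hbd f hfT)
      · intro hh
        have := derivative_eq_zero.1 hh
        simp only at this
        rw [natDegree_map_of_leadingCoeff_ne_zero φ h] at this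
        exact h0 this
      · intro hh
        have := derivative_eq_zero.1 hh
        simp only at this
        rw [natDegree_map_of_leadingCoeff_ne_zero ψ h'] at this
        exact h0 this
      · refine ⟨f.derivative, hlow _ (hT f hfT (by omega)).1 (natDegree_derivative_lt h0), ?_⟩
        simp [derivative_map]
      · rintro _ ⟨g, hg, rfl⟩ hg1 hg2 x y hx hy hS
        simp only at hg1 hg2 hx hy ⊢
        obtain ⟨g', hg', k1, k2, k3, k4⟩ := normalize_poly T hT φ ψ hs _ g (hsT' hg) le_rfl
        rw [← k2] at hg1 hx
        rw [← k3] at hg2 hy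
        have k4 : φ g'.leadingCoeff ≠ 0 ∧ ψ g'.leadingCoeff ≠ 0 := by
          rcases k4 with k4 | k4
          · exact absurd (k2.trans k4.1) hg1
          · exact k4
        have hdeg : g'.natDegree ≤ f.natDegree := by
          have := hmax g hg
          rcases k1 with rfl | k1
          · exact this
          · omega
        by_cases h00 : g'.natDegree = 0
        · rw [natDegree_eq_zero] at h00
          obtain ⟨c, rfl⟩ := h00
          simp only [Polynomial.map_C, eval_C, leadingCoeff_C] at hx k4
          exact absurd hx k4.1
        have hp := (hT f hfT (by omega)).2.2 g' hg' (by omega) hdeg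
        have hps := hlow _ hp ((psrem_spec f g' (by omega)).1.trans_le hdeg)
        rw [sign_psrem (by omega) φ k4.1 x hx, sign_psrem (by omega) ψ k4.2 y hy]
        exact hS _ ⟨_, hps, rfl⟩

theorem transfer_one (hR : PIVT R) (hL : PIVT L)
    (S : Finset A[X]) : ∃ T : Finset A, ∀ (φ : A →+* R) (ψ : A →+* L),
    (∀ a ∈ T, SignType.sign (φ a) = SignType.sign (ψ a)) →
    ∀ y : L, ∃ x : R, ∀ f ∈ S,
      SignType.sign ((f.map φ).eval x) = SignType.sign ((f.map ψ).eval y) := by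
  classical
  obtain ⟨T, hST, hT⟩ := exists_closure S
  refine ⟨T.image leadingCoeff, fun φ ψ hs y => ?_⟩
  have hs' : ∀ f ∈ T, SignType.sign (φ f.leadingCoeff) = SignType.sign (ψ f.leadingCoeff) :=
    fun f hf => hs _ (Finset.mem_image_of_mem _ hf)
  obtain ⟨M, hM0, hM⟩ := exists_sign_bound_finset (fun f : A[X] => f.map φ) T 0
  obtain ⟨N, hN0, hN⟩ := exists_sign_bound_finset (fun f : A[X] => f.map ψ) T |y|
  have hN00 : 0 < N := (abs_nonneg y).trans_lt hN0
  have hlead : ∀ f ∈ T, (f.map φ).natDegree = (f.map ψ).natDegree ∧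
      SignType.sign (f.map φ).leadingCoeff = SignType.sign (f.map ψ).leadingCoeff := by
    intro f hf
    obtain ⟨g, hg, -, k2, k3, k4⟩ := normalize_poly T hT φ ψ hs' _ f hf le_rfl
    rcases k4 with k4 | k4
    · simp [k4.1, k4.2]
    · rw [← k2, ← k3, natDegree_map_of_leadingCoeff_ne_zero φ k4.1,
        natDegree_map_of_leadingCoeff_ne_zero ψ k4.2,
        leadingCoeff_map_of_leadingCoeff_ne_zero φ k4.1,
        leadingCoeff_map_of_leadingCoeff_ne_zero ψ k4.2]
      exact ⟨rfl, hs' g hg⟩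
  have hG := good_of_closed hR hL T hT φ ψ hs' (-M) M (-N) N (by linarith) (by linarith)
    (fun f hf => by
      rw [(hM f hf).2, (hN f hf).2, sign_mul, sign_mul, (hlead f hf).1, (hlead f hf).2]
      congr 1
      rcases Nat.even_or_odd (f.map ψ).natDegree with h | h
      · simp [h.neg_one_pow]
      · simp [h.neg_one_pow])
    (fun f hf => by rw [(hM f hf).1, (hN f hf).1, (hlead f hf).2]) T subset_rfl
    (fun _ _ y hy _ => hy)
  obtain ⟨x, hx⟩ := hG.extract y (abs_lt.1 hN0)
  exact ⟨x, fun f hf => hx _ ⟨f, hST hf, rfl⟩⟩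
end

theorem finSucc_key {F K : Type*} [Field F] [Field K] {n : ℕ} (f : MvPolynomial (Fin (n+1)) F)
    (θ : F →+* K) (z0 : K) (z : Fin n → K) :
    ((MvPolynomial.finSuccEquiv F n f).map (MvPolynomial.eval₂Hom θ z)).eval z0 =
      MvPolynomial.eval₂Hom θ (Fin.cons z0 z : Fin (n+1) → K) f := by
  have : ((evalRingHom z0).comp ((mapRingHom (MvPolynomial.eval₂Hom θ z)).comp
      (MvPolynomial.finSuccEquiv F n).toRingEquiv.toRingHom)) =
      MvPolynomial.eval₂Hom θ (Fin.cons z0 z : Fin (n+1) → K) := by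
    apply MvPolynomial.ringHom_ext
    · intro r
      simp [MvPolynomial.finSuccEquiv_apply]
    · intro i
      refine Fin.cases ?_ (fun j => ?_) i
      · simp [MvPolynomial.finSuccEquiv_apply]
      · simp [MvPolynomial.finSuccEquiv_apply]
  exact RingHom.congr_fun this f

theorem transfer_many {F R L : Type*} [Field F] [Field R] [LinearOrder R] [IsStrictOrderedRing R]
    [Field L] [LinearOrder L] [IsStrictOrderedRing L] (hR : PIVT R) (hL : PIVT L)
    (φ : F →+* R) (ψ : F →+* L)
    (h : ∀ a, SignType.sign (φ a) = SignType.sign (ψ a)) :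
    ∀ (n : ℕ) (S : Finset (MvPolynomial (Fin n) F)) (y : Fin n → L), ∃ x : Fin n → R, ∀ f ∈ S,
      SignType.sign (MvPolynomial.eval₂Hom φ x f) = SignType.sign (MvPolynomial.eval₂Hom ψ y f) := by
  classical
  intro n
  induction n with
  | zero =>
    intro S y
    refine ⟨Fin.elim0, fun f _ => ?_⟩
    rw [MvPolynomial.eq_C_of_isEmpty f]
    simpa using h _
  | succ n ih =>
    intro S y
    obtain ⟨T, hT⟩ := transfer_one hR hL (S.image (MvPolynomial.finSuccEquiv F n))
    obtain ⟨x', hx'⟩ := ih T (Fin.tail y)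
    obtain ⟨x0, hx0⟩ := hT (MvPolynomial.eval₂Hom φ x') (MvPolynomial.eval₂Hom ψ (Fin.tail y)) hx'
      (y 0)
    refine ⟨Fin.cons x0 x', fun f hf => ?_⟩
    have e := hx0 _ (Finset.mem_image_of_mem _ hf)
    rw [finSucc_key, finSucc_key, Fin.cons_self_tail] at e
    exact e
end C
section D
variable {Ω : Type*} [Field Ω]

/-- A preordering of the subfield `P - P` of `Ω`. -/
structure IsPre (P : Subsemiring Ω) : Prop where
  neg_one : (-1 : Ω) ∉ P
  inv : ∀ x ∈ P, x⁻¹ ∈ P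
  sq : ∀ a ∈ P, ∀ b ∈ P, (a - b) * (a - b) ∈ P

/-- The subfield of differences. -/
def preField (P : Subsemiring Ω) (hP : IsPre P) : Subfield Ω where
  carrier := {x | ∃ a ∈ P, ∃ b ∈ P, x = a - b}
  one_mem' := ⟨1, one_mem _, 0, zero_mem _, by simp⟩
  zero_mem' := ⟨0, zero_mem _, 0, zero_mem _, by simp⟩
  add_mem' := by
    rintro _ _ ⟨a, ha, b, hb, rfl⟩ ⟨c, hc, d, hd, rfl⟩
    exact ⟨a + c, add_mem ha hc, b + d, add_mem hb hd, by ring⟩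
  mul_mem' := by
    rintro _ _ ⟨a, ha, b, hb, rfl⟩ ⟨c, hc, d, hd, rfl⟩
    exact ⟨a * c + b * d, add_mem (mul_mem ha hc) (mul_mem hb hd),
      a * d + b * c, add_mem (mul_mem ha hd) (mul_mem hb hc), by ring⟩
  neg_mem' := by
    rintro _ ⟨a, ha, b, hb, rfl⟩
    exact ⟨b, hb, a, ha, by ring⟩
  inv_mem' := by
    rintro _ ⟨a, ha, b, hb, rfl⟩
    have h := hP.inv _ (hP.sq a ha b hb)
    refine ⟨a * ((a - b) * (a - b))⁻¹, mul_mem ha h, b * ((a - b) * (a - b))⁻¹, mul_mem hb h, ?_⟩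
    rw [← sub_mul]
    by_cases h0 : a - b = 0
    · simp [h0]
    · field_simp

theorem mem_preField {P : Subsemiring Ω} (hP : IsPre P) {x : Ω} :
    x ∈ preField P hP ↔ ∃ a ∈ P, ∃ b ∈ P, x = a - b := Iff.rfl

theorem preField_sq {P : Subsemiring Ω} (hP : IsPre P) {x : Ω} (hx : x ∈ preField P hP) :
    x * x ∈ P := by
  obtain ⟨a, ha, b, hb, rfl⟩ := hx
  exact hP.sq a ha b hb

theorem le_preField {P : Subsemiring Ω} (hP : IsPre P) {x : Ω} (hx : x ∈ P) :
    x ∈ preField P hP := ⟨x, hx, 0, zero_mem _, by simp⟩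

theorem IsPre.extend {P : Subsemiring Ω} (hP : IsPre P) {x : Ω} (hx : x ∈ preField P hP)
    (hxP : x ∉ P) : ∃ P' : Subsemiring Ω, IsPre P' ∧ P ≤ P' ∧ -x ∈ P' := by
  have hxx := preField_sq hP hx
  let P' : Subsemiring Ω :=
    { carrier := {z | ∃ a ∈ P, ∃ b ∈ P, z = a - x * b}
      one_mem' := ⟨1, one_mem _, 0, zero_mem _, by simp⟩
      zero_mem' := ⟨0, zero_mem _, 0, zero_mem _, by simp⟩
      add_mem' := by
        rintro _ _ ⟨a, ha, b, hb, rfl⟩ ⟨c, hc, d, hd, rfl⟩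
        exact ⟨a + c, add_mem ha hc, b + d, add_mem hb hd, by ring⟩
      mul_mem' := by
        rintro _ _ ⟨a, ha, b, hb, rfl⟩ ⟨c, hc, d, hd, rfl⟩
        exact ⟨a * c + x * x * (b * d), add_mem (mul_mem ha hc) (mul_mem hxx (mul_mem hb hd)),
          a * d + b * c, add_mem (mul_mem ha hd) (mul_mem hb hc), by ring⟩ }
  have hmem : ∀ z, z ∈ P' ↔ ∃ a ∈ P, ∃ b ∈ P, z = a - x * b := fun z => Iff.rfl
  have hle : P ≤ P' := fun z hz => ⟨z, hz, 0, zero_mem _, by simp⟩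
  have hE : ∀ z ∈ P', z ∈ preField P hP := by
    rintro z ⟨a, ha, b, hb, rfl⟩
    exact sub_mem (le_preField hP ha) (mul_mem hx (le_preField hP hb))
  refine ⟨P', ⟨?_, ?_, ?_⟩, hle, ⟨0, zero_mem _, 1, one_mem _, by simp⟩⟩
  · rintro ⟨a, ha, b, hb, e⟩
    by_cases h0 : b = 0
    · apply hP.neg_one
      rw [e, h0]; simpa using ha
    · apply hxP
      have : x = (1 + a) * b⁻¹ := by
        field_simp
        linear_combination e
      rw [this]
      exact mul_mem (add_mem (one_mem _) ha) (hP.inv b hb)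
  · intro z hz
    have h1 := preField_sq hP (inv_mem (hE z hz))
    have : z⁻¹ = z * (z⁻¹ * z⁻¹) := by
      by_cases h0 : z = 0
      · simp [h0]
      · field_simp
    rw [this]
    exact mul_mem hz (hle h1)
  · intro a ha b hb
    exact hle (preField_sq hP (sub_mem (hE a ha) (hE b hb)))

theorem exists_maximal_pre {P : Subsemiring Ω} (hP : IsPre P) :
    ∃ Q : Subsemiring Ω, P ≤ Q ∧ Maximal IsPre Q := by
  refine zorn_le_nonempty₀ {Q : Subsemiring Ω | IsPre Q} ?_ P hP
  intro c hc hchain y hy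
  have hd := hchain.directedOn
  have hne : c.Nonempty := ⟨y, hy⟩
  have hm : ∀ x, x ∈ sSup c ↔ ∃ s ∈ c, x ∈ s := fun x => Subsemiring.mem_sSup_of_directedOn hne hd
  refine ⟨sSup c, ⟨?_, ?_, ?_⟩, fun z hz => le_sSup hz⟩
  · rw [hm]
    rintro ⟨s, hs, h⟩
    exact (hc hs).neg_one h
  · intro x hx
    rw [hm] at hx ⊢
    obtain ⟨s, hs, h⟩ := hx
    exact ⟨s, hs, (hc hs).inv x h⟩
  · intro a ha b hb
    rw [hm] at ha hb ⊢
    obtain ⟨s, hs, h⟩ := ha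
    obtain ⟨t, ht, h'⟩ := hb
    obtain ⟨u, hu, h1, h2⟩ := hd s hs t ht
    exact ⟨u, hu, (hc hu).sq a (h1 h) b (h2 h')⟩

theorem pivt_of_maximal [IsAlgClosed Ω] {P : Subsemiring Ω} (hP : IsPre P)
    (hmax : Maximal IsPre P) [LinearOrder (preField P hP)] [IsStrictOrderedRing (preField P hP)]
    (hle : ∀ x : preField P hP, 0 ≤ x ↔ (x : Ω) ∈ P) : PIVT (preField P hP) := by
  suffices H : ∀ (n : ℕ) (f : (preField P hP)[X]), f.natDegree = n → ∀ a b, a < b →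
      f.eval a * f.eval b < 0 → ∃ c, a < c ∧ c < b ∧ f.eval c = 0 from
    fun f a b hab h => H _ f rfl a b hab h
  intro n
  induction n using Nat.strong_induction_on with
  | _ n ih =>
  intro f hn a b hab hf
  have hf0 : f ≠ 0 := by rintro rfl; simp at hf
  have hfd : f.natDegree ≠ 0 := by
    intro h
    rw [natDegree_eq_zero] at h
    obtain ⟨c, rfl⟩ := h
    simp only [eval_C] at hf
    exact absurd (mul_self_nonneg c) (not_le.2 hf)
  have hfu : ¬ IsUnit f := fun h => hfd (natDegree_eq_zero_of_isUnit h)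
  by_cases hirr : Irreducible f
  swap
  · obtain ⟨g, hg, h, hh, e⟩ : ∃ g, ¬ IsUnit g ∧ ∃ h, ¬ IsUnit h ∧ f = g * h := by
      rw [irreducible_iff] at hirr
      push Not at hirr
      obtain ⟨g, h, e, h1, h2⟩ := hirr hfu
      exact ⟨g, h1, h, h2, e⟩
    have hg0 : g ≠ 0 := by rintro rfl; simp [e] at hf0
    have hh0 : h ≠ 0 := by rintro rfl; simp [e] at hf0
    have dg : g.natDegree ≠ 0 := fun hz => hg (by
      rw [isUnit_iff_degree_eq_zero, degree_eq_natDegree hg0, hz]; rfl)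
    have dh : h.natDegree ≠ 0 := fun hz => hh (by
      rw [isUnit_iff_degree_eq_zero, degree_eq_natDegree hh0, hz]; rfl)
    have hadd : g.natDegree + h.natDegree = n := by rw [← natDegree_mul hg0 hh0, ← e, hn]
    have e2 : (g.eval a * g.eval b) * (h.eval a * h.eval b) < 0 := by
      rw [e, eval_mul, eval_mul] at hf
      calc _ = _ := by ring
        _ < 0 := hf
    by_cases hga : g.eval a * g.eval b < 0
    · obtain ⟨c, c1, c2, c3⟩ := ih _ (by omega) g rfl a b hab hga
      exact ⟨c, c1, c2, by rw [e, eval_mul, c3, zero_mul]⟩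
    · have hha : h.eval a * h.eval b < 0 := by
        by_contra hc
        exact absurd (mul_nonneg (not_lt.1 hga) (not_lt.1 hc)) (not_le.2 e2)
      obtain ⟨c, c1, c2, c3⟩ := ih _ (by omega) h rfl a b hab hha
      exact ⟨c, c1, c2, by rw [e, eval_mul, c3, mul_zero]⟩
  obtain ⟨α, hα⟩ := IsAlgClosed.exists_aeval_eq_zero Ω f
    (by rw [degree_eq_natDegree hf0]; exact_mod_cast hfd)
  let ev : (preField P hP)[X] →+* Ω := (aeval α : (preField P hP)[X] →ₐ[preField P hP] Ω).toRingHom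
  have hev : ∀ q, ev q = aeval α q := fun q => rfl
  let M : Submonoid (preField P hP)[X] :=
    { carrier := {q | ∃ e, 0 ≤ e ∧ ∃ g, q = C e * (g * g)}
      one_mem' := ⟨1, zero_le_one, 1, by simp⟩
      mul_mem' := by
        rintro _ _ ⟨e, he, g, rfl⟩ ⟨e', he', g', rfl⟩
        exact ⟨e * e', mul_nonneg he he', g * g', by rw [C_mul]; ring⟩ }
  let Q := M.subsemiringClosure
  have hMQ : ∀ e, 0 ≤ e → ∀ g, C e * (g * g) ∈ Q := fun e he g => by
    rw [Submonoid.subsemiringClosure_mem]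
    exact AddSubmonoid.subset_closure ⟨e, he, g, rfl⟩
  have hQred : ∀ q ∈ Q, ∃ q', q'.natDegree ≤ 2 * (n - 1) ∧ ev q' = ev q ∧ ∀ c, 0 ≤ q'.eval c := by
    intro q hq
    rw [Submonoid.subsemiringClosure_mem] at hq
    induction hq using AddSubmonoid.closure_induction with
    | mem x hx =>
      obtain ⟨e, he, g, rfl⟩ := hx
      refine ⟨C e * ((g % f) * (g % f)), ?_, ?_, ?_⟩
      · have h1 : (g % f).natDegree < n := hn ▸ natDegree_mod_lt g hfd
        refine (natDegree_C_mul_le _ _).trans (natDegree_mul_le.trans ?_)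
        omega
      · have : ev (g % f) = ev g := by
          have := congrArg ev (EuclideanDomain.div_add_mod g f)
          rw [map_add, map_mul, hev f, hα, zero_mul, zero_add] at this
          exact this
        simp only [map_mul, this]
      · intro c
        simp only [eval_mul, eval_C]
        exact mul_nonneg he (mul_self_nonneg _)
    | zero => exact ⟨0, by simp, rfl, by simp⟩
    | add x y _ _ hx hy =>
      obtain ⟨x', h1, h2, h3⟩ := hx
      obtain ⟨y', k1, k2, k3⟩ := hy
      refine ⟨x' + y', (natDegree_add_le _ _).trans (max_le h1 k1), by simp [h2, k2], fun c => ?_⟩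
      rw [eval_add]
      exact add_nonneg (h3 c) (k3 c)
  have hcop : ∀ q, ¬ f ∣ q → ∃ v, ev v * ev q = 1 := by
    intro q hq
    obtain ⟨u, v, huv⟩ := (hirr.coprime_iff_not_dvd).2 hq
    refine ⟨v, ?_⟩
    have := congrArg ev huv
    rw [map_add, map_mul, map_mul, hev f, hα, mul_zero, zero_add, map_one] at this
    exact this
  let P' := Q.map ev
  have hPP' : P ≤ P' := by
    intro x hx
    refine ⟨C (⟨x, le_preField hP hx⟩ : preField P hP) * (1 * 1), hMQ _ ((hle _).2 hx) 1, ?_⟩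
    rw [hev]; simp; rfl
  have hsq' : ∀ q, ev q * ev q ∈ P' := fun q =>
    ⟨C 1 * (q * q), hMQ 1 zero_le_one q, by simp⟩
  have hP' : IsPre P' := by
    refine ⟨?_, ?_, ?_⟩
    · rintro ⟨q, hq, e⟩
      obtain ⟨q', h1, h2, h3⟩ := hQred q hq
      have e' : ev (1 + q') = 0 := by rw [map_add, map_one, h2, e]; ring
      have hdvd : f ∣ 1 + q' := by
        by_contra hc
        obtain ⟨v, hv⟩ := hcop _ hc
        rw [e', mul_zero] at hv
        exact zero_ne_one hv
      obtain ⟨h, hh⟩ := hdvd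
      have hpos : ∀ c, 0 < f.eval c * h.eval c := by
        intro c
        rw [← eval_mul, ← hh, eval_add, eval_one]
        have := h3 c
        linarith
      have hh0 : h ≠ 0 := by
        rintro rfl
        have := hpos a
        simp at this
      have hdeg : h.natDegree < n := by
        have h5 : (1 + q').natDegree ≤ 2 * (n-1) :=
          (natDegree_add_le _ _).trans (max_le (by simp) h1)
        rw [hh, natDegree_mul hf0 hh0, hn] at h5
        omega
      have hneg : h.eval a * h.eval b < 0 := by
        by_contra hc
        push Not at hc
        have h6 := mul_pos (hpos a) (hpos b)
        have h7 := mul_nonpos_of_nonpos_of_nonneg hf.le hc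
        have : f.eval a * h.eval a * (f.eval b * h.eval b) ≤ 0 := by
          calc _ = _ := by ring
            _ ≤ 0 := h7
        exact absurd h6 (not_lt.2 this)
      obtain ⟨c, -, -, c3⟩ := ih _ hdeg h rfl a b hab hneg
      have := hpos c
      rw [c3, mul_zero] at this
      exact lt_irrefl _ this
    · rintro _ ⟨q, hq, rfl⟩
      by_cases hd : f ∣ q
      · obtain ⟨k, rfl⟩ := hd
        have : ev (f * k) = 0 := by rw [map_mul, hev f, hα, zero_mul]
        rw [this, inv_zero]
        exact zero_mem _
      · obtain ⟨v, hv⟩ := hcop q hd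
        have : (ev q)⁻¹ = ev q * (ev v * ev v) := by
          exact inv_eq_of_mul_eq_one_right (by linear_combination (ev v * ev q + 1) * hv)
        rw [this]
        exact mul_mem ⟨q, hq, rfl⟩ (hsq' v)
    · rintro _ ⟨q, hq, rfl⟩ _ ⟨r, hr, rfl⟩
      rw [← map_sub]
      exact hsq' _
  have hP'P : P' ≤ P := hmax.2 hP' hPP'
  have hαE : α ∈ preField P hP := by
    refine ⟨_, hP'P (hsq' (C (1/2) * (X + 1))), _, hP'P (hsq' (C (1/2) * (X - 1))), ?_⟩
    rw [← map_mul, ← map_mul, ← map_sub]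
    have : C (1/2) * (X + 1) * (C (1/2) * (X + 1)) - C (1/2) * (X - 1) * (C (1/2) * (X - 1))
        = (X : (preField P hP)[X]) := by
      have h2 : (C (1/2) * C (1/2) * 4 : (preField P hP)[X]) = 1 := by
        rw [← C_mul, show (4 : (preField P hP)[X]) = C 4 from rfl, ← C_mul, ← C_1]
        congr 1
        norm_num
      linear_combination X * h2
    rw [this, hev, aeval_X]
  let r : preField P hP := ⟨α, hαE⟩
  have hr : f.eval r = 0 := by
    have : aeval (algebraMap (preField P hP) Ω r) f = 0 := hα
    rw [aeval_algebraMap_apply] at this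
    simpa using this
  have hdeg1 := degree_eq_one_of_irreducible_of_root hirr hr
  obtain ⟨k, hk⟩ := dvd_iff_isRoot.2 hr
  have hk0 : k ≠ 0 := by rintro rfl; simp [hk] at hf0
  have hkd : k.natDegree = 0 := by
    have h1 := natDegree_eq_of_degree_eq_some hdeg1
    rw [hk, natDegree_mul (X_sub_C_ne_zero r) hk0, natDegree_X_sub_C] at h1
    change 1 + k.natDegree = 1 at h1
    omega
  rw [natDegree_eq_zero] at hkd
  obtain ⟨c, rfl⟩ := hkd
  have hprod : (a - r) * (b - r) < 0 := by
    rw [hk] at hf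
    simp only [eval_mul, eval_sub, eval_X, eval_C] at hf
    by_contra hc
    push Not at hc
    have := mul_nonneg hc (mul_self_nonneg c)
    have e : (a - r) * c * ((b - r) * c) = (a - r) * (b - r) * (c * c) := by ring
    rw [e] at hf
    exact absurd this (not_le.2 hf)
  refine ⟨r, ?_, ?_, hr⟩
  · by_contra hc
    push Not at hc
    exact absurd (mul_nonneg (sub_nonneg.2 hc) (sub_nonneg.2 (hc.trans hab.le))) (not_le.2 hprod)
  · by_contra hc
    push Not at hc
    exact absurd (mul_nonneg_of_nonpos_of_nonpos (sub_nonpos.2 (hab.le.trans hc))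
      (sub_nonpos.2 hc)) (not_le.2 hprod)

theorem exists_pivt_field.{u} {K : Type u} [Field K] [CharZero K] (p : K) (hp : ¬ IsSumSq p) :
    ∃ (L : Type u) (_ : Field L) (_ : LinearOrder L) (_ : IsStrictOrderedRing L),
      PIVT L ∧ ∃ θ : K →+* L, θ p < 0 := by
  classical
  let Ω := AlgebraicClosure K
  let i : K →+* Ω := algebraMap K Ω
  let P0 : Subsemiring Ω := (Subsemiring.sumSq K).map i
  have hS : ∀ x : K, i x ∈ P0 ↔ IsSumSq x := by
    intro x
    constructor
    · rintro ⟨y, hy, e⟩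
      rw [← i.injective e]
      simpa using hy
    · intro h
      exact ⟨x, by simpa using h, rfl⟩
  have hsq : ∀ x : K, i x * i x ∈ P0 := fun x => by
    rw [← map_mul, hS]; exact IsSumSq.mul_self x
  have hdiff : ∀ x : K, x = ((x+1)/2) * ((x+1)/2) - ((x-1)/2) * ((x-1)/2) := fun x => by
    field_simp; ring
  have hP0 : IsPre P0 := by
    refine ⟨?_, ?_, ?_⟩
    · intro h
      have h : i (-1) ∈ P0 := by simpa using h
      rw [hS] at h
      apply hp
      rw [hdiff p, sub_eq_add_neg, neg_eq_neg_one_mul]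
      exact (IsSumSq.mul_self _).add (h.mul (IsSumSq.mul_self _))
    · rintro _ ⟨x, hx, rfl⟩
      have : (i x)⁻¹ = i x * (i x⁻¹ * i x⁻¹) := by
        rw [map_inv₀]
        by_cases h0 : i x = 0
        · simp [h0]
        · rw [← mul_assoc, mul_inv_cancel₀ h0, one_mul]
      rw [this]
      exact mul_mem ⟨x, hx, rfl⟩ (hsq _)
    · rintro _ ⟨x, hx, rfl⟩ _ ⟨y, hy, rfl⟩
      rw [← map_sub]
      exact hsq _
  have hpP0 : i p ∉ P0 := fun h => hp ((hS p).1 h)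
  have hpE : ∀ x, i x ∈ preField P0 hP0 := fun x =>
    ⟨_, hsq ((x+1)/2), _, hsq ((x-1)/2), by rw [← map_mul, ← map_mul, ← map_sub, ← hdiff]⟩
  obtain ⟨P1, hP1, h01, hpP1⟩ := hP0.extend (hpE p) hpP0
  obtain ⟨P, h1P, hmax⟩ := exists_maximal_pre hP1
  have hP : IsPre P := hmax.1
  have hzero : ∀ x : Ω, x ∈ P → -x ∈ P → x = 0 := by
    intro x h1 h2
    by_contra h0
    apply hP.neg_one
    have := mul_mem h2 (hP.inv x h1)
    rwa [neg_mul, mul_inv_cancel₀ h0] at this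
  let Cn : RingCone (preField P hP) :=
    { P.comap (preField P hP).subtype with
      eq_zero_of_mem_of_neg_mem' := by
        intro x h1 h2
        exact Subtype.ext (hzero x h1 h2) }
  have hCn : ∀ x : preField P hP, x ∈ Cn ↔ (x : Ω) ∈ P := fun x => Iff.rfl
  have : HasMemOrNegMem Cn := ⟨by
    intro x
    rw [hCn, hCn]
    by_contra hc
    push Not at hc
    obtain ⟨P', h1, h2, h3⟩ := hP.extend x.2 hc.1
    exact hc.2 (hmax.2 h1 h2 h3)⟩
  let _ : LinearOrder (preField P hP) := LinearOrder.mkOfAddGroupCone Cn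
  have : IsOrderedRing (preField P hP) := IsOrderedRing.mkOfCone Cn
  have : IsStrictOrderedRing (preField P hP) := IsOrderedRing.toIsStrictOrderedRing _
  have hle : ∀ x : preField P hP, 0 ≤ x ↔ (x : Ω) ∈ P := by
    intro x
    change x - 0 ∈ Cn ↔ _
    rw [sub_zero]; exact hCn x
  refine ⟨preField P hP, inferInstance, inferInstance, inferInstance,
    pivt_of_maximal hP hmax hle, ?_⟩
  have hiE : ∀ x, i x ∈ preField P hP := fun x => by
    obtain ⟨a, ha, b, hb, e⟩ := hpE x
    exact ⟨a, h1P (h01 ha), b, h1P (h01 hb), e⟩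
  refine ⟨i.codRestrict (preField P hP) hiE, ?_⟩
  refine lt_of_le_of_ne ?_ ?_
  · rw [← neg_nonneg, hle]
    exact h1P hpP1
  · intro h
    have h : i p = 0 := congrArg Subtype.val h
    rw [map_eq_zero] at h
    exact hp (h ▸ IsSumSq.zero)
end D

section Final

theorem pivt_real : PIVT ℝ := by
  intro f a b hab h
  have hc : ContinuousOn (fun x => f.eval x) (Set.Icc a b) := f.continuous.continuousOn
  rcases mul_neg_iff.1 h with ⟨h1, h2⟩ | ⟨h1, h2⟩
  · obtain ⟨c, hc1, hc2⟩ := intermediate_value_Ioo' hab.le hc ⟨h2, h1⟩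
    exact ⟨c, hc1.1, hc1.2, hc2⟩
  · obtain ⟨c, hc1, hc2⟩ := intermediate_value_Ioo hab.le hc ⟨h1, h2⟩
    exact ⟨c, hc1.1, hc1.2, hc2⟩

theorem isSumSq_frac {A : Type*} [CommRing A] [IsDomain A] {x : FractionRing A} (hx : IsSumSq x) :
    ∃ d : A, d ≠ 0 ∧ ∃ s : A, IsSumSq s ∧
      algebraMap A (FractionRing A) (d * d) * x = algebraMap A (FractionRing A) s := by
  induction hx with
  | zero => exact ⟨1, one_ne_zero, 0, IsSumSq.zero, by simp⟩
  | sq_add a _ ih =>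
    obtain ⟨d, hd, s, hs, e⟩ := ih
    obtain ⟨u, v, hv, rfl⟩ := IsFractionRing.div_surjective (A := A) a
    have hv0 : v ≠ 0 := nonZeroDivisors.ne_zero hv
    have hv1 : algebraMap A (FractionRing A) v ≠ 0 := by
      simpa using hv0
    refine ⟨d * v, mul_ne_zero hd hv0, (d * u) * (d * u) + (v * v) * s,
      (IsSumSq.mul_self _).add ((IsSumSq.mul_self _).mul hs), ?_⟩
    simp only [map_mul, map_add] at e ⊢
    rw [← e]
    field_simp

theorem isSumSq_fin {A : Type*} [CommRing A] {s : A} (hs : IsSumSq s) :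
    ∃ (k : ℕ) (q : Fin k → A), s = ∑ i, (q i) ^ 2 := by
  induction hs with
  | zero => exact ⟨0, Fin.elim0, by simp⟩
  | sq_add a _ ih =>
    obtain ⟨k, q, rfl⟩ := ih
    exact ⟨k + 1, Fin.cons a q, by simp [Fin.sum_univ_succ, sq]⟩

end Final
end Helpers

open MvPolynomial

/-- Artin's solution of Hilbert's 17th problem: every polynomial nonnegative on `ℝⁿ`
admits a nonzero sum-of-squares multiplier `σ` such that `σ · p` is a sum of squares;
equivalently, `p` is a sum of squares of rational functions. -/
theorem artin_hilbert17 {n : ℕ} (p : MvPolynomial (Fin n) ℝ)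
    (hp : ∀ x : Fin n → ℝ, 0 ≤ eval x p) :
    ∃ σ : MvPolynomial (Fin n) ℝ, σ ≠ 0 ∧
      (∃ (k : ℕ) (q : Fin k → MvPolynomial (Fin n) ℝ), σ = ∑ i, (q i) ^ 2) ∧
      (∃ (k : ℕ) (q : Fin k → MvPolynomial (Fin n) ℝ), σ * p = ∑ i, (q i) ^ 2) := by
  have inj := IsFractionRing.injective (MvPolynomial (Fin n) ℝ)
    (FractionRing (MvPolynomial (Fin n) ℝ))
  by_cases h : IsSumSq (algebraMap (MvPolynomial (Fin n) ℝ)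
      (FractionRing (MvPolynomial (Fin n) ℝ)) p)
  · obtain ⟨d, hd, s, hs, e⟩ := isSumSq_frac h
    refine ⟨d * d, mul_ne_zero hd hd, isSumSq_fin (IsSumSq.mul_self d), ?_⟩
    rw [← map_mul] at e
    rw [inj e]
    exact isSumSq_fin hs
  · exfalso
    have : CharZero (FractionRing (MvPolynomial (Fin n) ℝ)) :=
      (RingHom.charZero_iff inj).1 inferInstance
    obtain ⟨L, _, _, _, hL, θ, hθ⟩ := exists_pivt_field _ h
    let η : MvPolynomial (Fin n) ℝ →+* L := θ.comp (algebraMap _ _)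
    have hη : η p < 0 := hθ
    let ψ : ℝ →+* L := η.comp C
    have hnn : ∀ a : ℝ, 0 < a → 0 < ψ a := by
      intro a ha
      refine lt_of_le_of_ne ?_ (fun h0 => ?_)
      · rw [← Real.mul_self_sqrt ha.le, map_mul]
        exact mul_self_nonneg _
      · exact ha.ne' ((map_eq_zero ψ).1 h0.symm)
    have hsign : ∀ a : ℝ, SignType.sign (RingHom.id ℝ a) = SignType.sign (ψ a) := by
      intro a
      rw [RingHom.id_apply]
      rcases lt_trichotomy a 0 with ha | ha | ha
      · have := hnn (-a) (by linarith)
        rw [map_neg] at this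
        rw [sign_eq_neg_one_iff.2 ha, sign_eq_neg_one_iff.2 (by linarith)]
      · simp [ha]
      · rw [sign_eq_one_iff.2 ha, sign_eq_one_iff.2 (hnn a ha)]
    obtain ⟨x, hx⟩ := transfer_many pivt_real hL (RingHom.id ℝ) ψ hsign n {p} (fun i => η (X i))
    have e := hx p (Finset.mem_singleton_self p)
    have e1 : eval₂Hom ψ (fun i => η (X i)) = η := by
      apply MvPolynomial.ringHom_ext
      · intro r; simp [ψ]
      · intro i; simp
    rw [e1, sign_eq_neg_one_iff.2 hη, sign_eq_neg_one_iff] at e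
    exact absurd (hp x) (not_le.2 e)
end

section
/- Scheiderer's bound on the Pythagoras number of ternary forms: for every d >= 4, (a) every homogeneous polynomial in ℝ[x,y,z] of degree 2d that is a sum of squares of polynomials can be written as a sum of at most d + 2 squares of polynomials, and (b) there exists a homogeneous polynomial in ℝ[x,y,z] of degree 2d that is a sum of squares of polynomials but cannot be written as a sum of d squares of polynomials. In other words, the Pythagoras number Π(ν_d(ℙ^2)) equals d + 1 or d + 2. -/
open MvPolynomial


/-- Degrees in a sum of squares over a real ring cannot cancel. -/
theorem natDegree_le_of_sum_sq {R : Type*} [CommRing R] {ι : Type*} [Fintype ι]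
    (hR : ∀ c : ι → R, ∑ i, c i ^ 2 = 0 → ∀ i, c i = 0)
    (g : ι → Polynomial R) (d : ℕ) (h : (∑ i, g i ^ 2).natDegree ≤ 2 * d) (i : ι) :
    (g i).natDegree ≤ d := by
  have key : ∀ e : ℕ, (∀ i, (g i).natDegree ≤ d + e) → ∀ i, (g i).natDegree ≤ d := by
    intro e
    induction e with
    | zero => intro h i; simpa using h i
    | succ e ih =>
      intro hN
      apply ih
      have h0 : ∑ i, ((g i).coeff (d + (e + 1))) ^ 2 = 0 := by
        have h1 : (∑ i, g i ^ 2).coeff (2 * (d + (e + 1))) = 0 :=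
          Polynomial.coeff_eq_zero_of_natDegree_lt (by omega)
        rw [Polynomial.finsetSum_coeff] at h1
        rw [← h1]
        refine Finset.sum_congr rfl fun i _ => ?_
        rw [Polynomial.coeff_pow_of_natDegree_le (hN i)]
      have h2 := hR _ h0
      intro i
      have := hN i
      by_contra hc
      have h3 : (g i).natDegree = d + (e + 1) := by omega
      have h4 := h2 i
      rw [← h3, Polynomial.coeff_natDegree, Polynomial.leadingCoeff_eq_zero] at h4
      rw [h4] at h3
      simp at h3
  exact key (∑ i, (g i).natDegree)
    (fun i => le_trans (Finset.single_le_sum (f := fun i => (g i).natDegree)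
      (fun _ _ => Nat.zero_le _) (Finset.mem_univ i)) (by omega)) i

theorem real_sum_sq {ι : Type*} [Fintype ι] (c : ι → ℝ) (h : ∑ i, c i ^ 2 = 0) (i : ι) :
    c i = 0 := by
  have := (Finset.sum_eq_zero_iff_of_nonneg (fun i _ => sq_nonneg (c i))).1 h i (Finset.mem_univ i)
  simpa using this

/-- nodes -/
def nd (d : ℕ) (i : Fin (d + 1)) : ℝ := (i : ℝ)

theorem nd_inj (d : ℕ) : Function.Injective (nd d) := by
  intro i j h
  simp only [nd, Nat.cast_inj] at h
  exact Fin.ext h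

noncomputable def phi (d : ℕ) (i : Fin (d + 1)) : Polynomial ℝ :=
  Lagrange.nodal (Finset.univ.erase i) (nd d)

theorem phi_eval_ne (d : ℕ) {i j : Fin (d + 1)} (h : i ≠ j) : (phi d i).eval (nd d j) = 0 :=
  Lagrange.eval_nodal_at_node (by simp [h.symm])

theorem phi_eval_self (d : ℕ) (i : Fin (d + 1)) : (phi d i).eval (nd d i) ≠ 0 :=
  Lagrange.eval_nodal_not_at_node (fun j hj h => by
    rw [nd_inj d h] at hj
    simp at hj)

theorem phi_deriv_ne (d : ℕ) {i j : Fin (d + 1)} (h : i ≠ j) :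
    (Polynomial.derivative (phi d i)).eval (nd d j) ≠ 0 := by
  unfold phi
  rw [Lagrange.eval_nodal_derivative_eval_node_eq (by simp [h.symm])]
  exact Lagrange.eval_nodal_not_at_node (fun k hk h => by
    rw [nd_inj d h] at hk
    simp at hk)

theorem phi_natDegree (d : ℕ) (i : Fin (d + 1)) : (phi d i).natDegree = d := by
  unfold phi
  rw [Lagrange.natDegree_nodal]; simp

theorem phi_interp (d : ℕ) (g : Polynomial ℝ) (hg : g.natDegree ≤ d) :
    g = ∑ i, Polynomial.C (g.eval (nd d i) / (phi d i).eval (nd d i)) * phi d i := by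
  apply Polynomial.eq_of_degrees_lt_of_eval_index_eq (s := Finset.univ) (v := nd d)
    (hvs := (nd_inj d).injOn)
  · refine lt_of_le_of_lt Polynomial.degree_le_natDegree ?_
    simp only [Finset.card_univ, Fintype.card_fin]
    exact_mod_cast Nat.lt_succ_of_le hg
  · refine lt_of_le_of_lt Polynomial.degree_le_natDegree ?_
    have : (∑ i, Polynomial.C (g.eval (nd d i) / (phi d i).eval (nd d i)) * phi d i).natDegree ≤ d := by
      apply Polynomial.natDegree_sum_le_of_forall_le
      intro i _
      refine le_trans (Polynomial.natDegree_C_mul_le _ _) (phi_natDegree d i).le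
    simp only [Finset.card_univ, Fintype.card_fin]
    exact_mod_cast Nat.lt_succ_of_le this
  · intro i _
    rw [Polynomial.eval_finsetSum, Finset.sum_eq_single i]
    · simp only [Polynomial.eval_mul, Polynomial.eval_C]
      field_simp [phi_eval_self d i]
    · intro j _ hj
      simp [phi_eval_ne d hj]
    · simp

/-- Independence of the products `φ_i φ_j (a) φ_i φ_j (b)`. -/
theorem phi_indep (d : ℕ) (m : Fin (d + 1) → Fin (d + 1) → ℝ) (hsym : ∀ i j, m i j = m j i)
    (h : ∀ a b : ℝ, ∑ i, ∑ j, m i j * ((phi d i).eval a * (phi d i).eval b) *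
      ((phi d j).eval a * (phi d j).eval b) = 0) (k l : Fin (d + 1)) : m k l = 0 := by
  have hdiag : ∀ k, m k k = 0 := by
    intro k
    have h1 := h (nd d k) (nd d k)
    rw [Finset.sum_eq_single k, Finset.sum_eq_single k] at h1
    · have := phi_eval_self d k
      simpa [this] using h1
    · intro j _ hj; simp [phi_eval_ne d hj]
    · simp
    · intro j _ hj; simp [phi_eval_ne d hj]
    · simp
  by_cases hkl : k = l
  · rw [hkl]; exact hdiag l
  have h1 : ∀ b : ℝ, ∑ i, ∑ j, Polynomial.C (m i j * (phi d i).eval b * (phi d j).eval b) *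
      (phi d i * phi d j) = 0 := by
    intro b
    apply Polynomial.funext
    intro a
    rw [Polynomial.eval_finsetSum, Polynomial.eval_zero, ← h a b]
    refine Finset.sum_congr rfl fun i _ => ?_
    rw [Polynomial.eval_finsetSum]
    refine Finset.sum_congr rfl fun j _ => ?_
    simp only [Polynomial.eval_mul, Polynomial.eval_C]
    ring
  have h2 : ∀ b : ℝ, (phi d k).eval b * ∑ j, m k j * (phi d j).eval b *
      (Polynomial.derivative (phi d j)).eval (nd d k) = 0 := by
    intro b
    have h3 := congrArg (fun p => (Polynomial.derivative p).eval (nd d k)) (h1 b)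
    simp only [Polynomial.derivative_sum, Polynomial.eval_finsetSum,
      Polynomial.derivative_mul, Polynomial.eval_mul, Polynomial.eval_add, Polynomial.eval_C,
      Polynomial.derivative_zero, Polynomial.eval_zero, mul_add, Finset.sum_add_distrib,
      Polynomial.derivative_C, zero_mul, zero_add] at h3
    rw [Finset.sum_comm] at h3
    rw [Finset.sum_eq_single k, Finset.sum_eq_single (a := k) (f := fun x => ∑ y, _)] at h3
    · have hs := phi_eval_self d k
      have : (phi d k).eval (nd d k) * (2 * ((phi d k).eval b * ∑ j, m k j * (phi d j).eval b *
          (Polynomial.derivative (phi d j)).eval (nd d k))) = 0 := by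
        rw [← h3, two_mul, mul_add, Finset.mul_sum, Finset.mul_sum]
        congr 1
        · refine Finset.sum_congr rfl fun j _ => ?_
          rw [hsym j k]; ring
        · refine Finset.sum_congr rfl fun j _ => ?_
          ring
      have h4 := (mul_eq_zero.1 this).resolve_left hs
      linarith
    · intro i _ hi; simp [phi_eval_ne d hi]
    · simp
    · intro i _ hi; simp [phi_eval_ne d hi]
    · simp
  have h5 : phi d k * ∑ j, Polynomial.C (m k j *
      (Polynomial.derivative (phi d j)).eval (nd d k)) * phi d j = 0 := by
    apply Polynomial.funext
    intro b
    rw [Polynomial.eval_mul, Polynomial.eval_zero, ← h2 b, Polynomial.eval_finsetSum]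
    congr 1
    refine Finset.sum_congr rfl fun j _ => ?_
    simp only [Polynomial.eval_mul, Polynomial.eval_C]
    ring
  have hk0 : phi d k ≠ 0 := by
    intro h0
    have := phi_eval_self d k
    rw [h0] at this; simp at this
  have h6 := congrArg (Polynomial.eval (nd d l)) ((mul_eq_zero.1 h5).resolve_left hk0)
  rw [Polynomial.eval_finsetSum, Finset.sum_eq_single l] at h6
  · simp only [Polynomial.eval_mul, Polynomial.eval_C, Polynomial.eval_zero] at h6
    have a1 := phi_eval_self d l
    have a2 := phi_deriv_ne d (Ne.symm hkl)
    simpa [a1, a2] using h6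
  · intro j _ hj; simp [phi_eval_ne d hj]
  · simp

noncomputable def lin (d : ℕ) (i : Fin (d + 1)) : MvPolynomial (Fin 3) ℝ :=
  X 0 + C (nd d i) * X 1 + C (nd d i ^ 2) * X 2

theorem lin_hom (d : ℕ) (i : Fin (d + 1)) : (lin d i).IsHomogeneous 1 := by
  unfold lin
  exact ((isHomogeneous_X ℝ 0).add ((isHomogeneous_X ℝ 1).C_mul _)).add
    ((isHomogeneous_X ℝ 2).C_mul _)

noncomputable def starForm (d : ℕ) : MvPolynomial (Fin 3) ℝ :=
  ∑ i : Fin (d + 1), (∏ j ∈ Finset.univ.erase i, lin d j) ^ 2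

theorem starForm_hom (d : ℕ) : (starForm d).IsHomogeneous (2 * d) := by
  apply IsHomogeneous.sum
  intro i _
  have h1 : (∏ j ∈ Finset.univ.erase i, lin d j).IsHomogeneous (∑ j ∈ Finset.univ.erase i, 1) :=
    IsHomogeneous.prod _ _ _ (fun j _ => lin_hom d j)
  have h2 := h1.pow 2
  have h3 : (∑ j ∈ Finset.univ.erase i, 1) * 2 = 2 * d := by simp; ring
  rwa [h3] at h2

theorem starForm_eval (d : ℕ) (a b : ℝ) : eval ![a * b, -(a + b), 1] (starForm d) =
    ∑ i, ((phi d i).eval a * (phi d i).eval b) ^ 2 := by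
  simp only [starForm, map_sum, map_pow, map_prod, phi, Lagrange.eval_nodal]
  refine Finset.sum_congr rfl fun i _ => ?_
  rw [← Finset.prod_mul_distrib]
  congr 1
  refine Finset.prod_congr rfl fun j _ => ?_
  simp [lin]
  ring

theorem starForm_not (d : ℕ) : ¬ ∃ q : Fin d → MvPolynomial (Fin 3) ℝ,
    starForm d = ∑ i, (q i) ^ 2 := by
  rintro ⟨q, hq⟩
  -- the pulled back forms
  let G : Fin d → ℝ → ℝ → ℝ := fun k a b => eval ![a * b, -(a + b), 1] (q k)
  have hG : ∀ a b, ∑ i, ((phi d i).eval a * (phi d i).eval b) ^ 2 = ∑ k, G k a b ^ 2 := by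
    intro a b
    rw [← starForm_eval, hq]
    simp [G]
  have hsymG : ∀ k a b, G k a b = G k b a := by
    intro k a b
    simp only [G]
    rw [mul_comm, add_comm]
  let P : Fin d → ℝ → Polynomial ℝ := fun k b =>
    aeval ![Polynomial.X * Polynomial.C b, -(Polynomial.X + Polynomial.C b), 1] (q k)
  have hP : ∀ k a b, (P k b).eval a = G k a b := by
    intro k a b
    simp only [P, G]
    rw [← Polynomial.coe_evalRingHom, MvPolynomial.aeval_def, MvPolynomial.hom_eval₂, eval,
      coe_eval₂Hom]
    congr 1
    · ext x; simp
    · ext j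
      fin_cases j
      · simpa using mul_comm b a
      · simp
      · simp
  have hdeg : ∀ b k, (P k b).natDegree ≤ d := by
    intro b
    apply natDegree_le_of_sum_sq real_sum_sq
    have : ∑ k, P k b ^ 2 = ∑ i, (Polynomial.C ((phi d i).eval b) * phi d i) ^ 2 := by
      apply Polynomial.funext
      intro a
      simp only [Polynomial.eval_finsetSum, Polynomial.eval_pow, hP, Polynomial.eval_mul,
        Polynomial.eval_C, ← hG]
      refine Finset.sum_congr rfl fun i _ => ?_
      ring
    rw [this]
    apply Polynomial.natDegree_sum_le_of_forall_le
    intro i _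
    refine le_trans Polynomial.natDegree_pow_le (Nat.mul_le_mul_left 2 ?_)
    exact le_trans (Polynomial.natDegree_C_mul_le _ _) (phi_natDegree d i).le
  have hvan : ∀ k i j, i ≠ j → G k (nd d i) (nd d j) = 0 := by
    intro k i j hij
    apply real_sum_sq (fun k => G k (nd d i) (nd d j))
    rw [← hG]
    apply Finset.sum_eq_zero
    intro l _
    by_cases h : l = i
    · rw [phi_eval_ne d (i := l) (j := j) (h ▸ hij)]; simp
    · rw [phi_eval_ne d (i := l) (j := i) h]; simp
  have hexp : ∀ k a b, G k a b = ∑ i, (G k (nd d i) b / (phi d i).eval (nd d i)) *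
      (phi d i).eval a := by
    intro k a b
    have := congrArg (Polynomial.eval a) (phi_interp d (P k b) (hdeg b k))
    rw [hP, Polynomial.eval_finsetSum] at this
    rw [this]
    simp [hP]
  have hexp2 : ∀ k i b, G k (nd d i) b =
      G k (nd d i) (nd d i) / (phi d i).eval (nd d i) * (phi d i).eval b := by
    intro k i b
    rw [hsymG, hexp, Finset.sum_eq_single i]
    · intro j _ hj
      rw [hvan k j i hj]; simp
    · simp
  obtain ⟨γ, hγ⟩ : ∃ γ : Matrix (Fin (d + 1)) (Fin d) ℝ,
      ∀ k a b, G k a b = ∑ i, γ i k * ((phi d i).eval a * (phi d i).eval b) := by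
    refine ⟨fun i k => G k (nd d i) (nd d i) / (phi d i).eval (nd d i) /
      (phi d i).eval (nd d i), fun k a b => ?_⟩
    rw [hexp]
    refine Finset.sum_congr rfl fun i _ => ?_
    rw [hexp2 k i b]
    ring
  clear hexp hexp2 hvan hdeg hP hsymG
  clear P
  have hone : γ * γ.transpose = 1 := by
    have := phi_indep d (fun i j => (∑ k, γ i k * γ j k) - (if i = j then 1 else 0)) ?_ ?_
    · ext i j
      have h1 := this i j
      simp only [Matrix.mul_apply, Matrix.transpose_apply, Matrix.one_apply]
      linarith
    · intro i j
      congr 1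
      · exact Finset.sum_congr rfl fun k _ => mul_comm _ _
      · simp only [eq_comm]
    · intro a b
      have h1 := hG a b
      simp only [hγ, sq (Finset.sum _ _), Finset.sum_mul_sum] at h1
      rw [Finset.sum_comm] at h1
      simp only [Finset.sum_comm (s := (Finset.univ : Finset (Fin d)))] at h1
      simp only [sub_mul, Finset.sum_sub_distrib, ite_mul, zero_mul, one_mul,
        Finset.sum_ite_eq, Finset.mem_univ, if_true]
      rw [sub_eq_zero]
      simp only [Finset.sum_mul, ← sq]
      rw [h1]
      refine Finset.sum_congr rfl fun i _ => Finset.sum_congr rfl fun j _ =>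
        Finset.sum_congr rfl fun k _ => ?_
      ring
  have hr := Matrix.rank_mul_le_left γ γ.transpose
  rw [hone, Matrix.rank_one] at hr
  have := hr.trans (Matrix.rank_le_width γ)
  simp at this

/-- real polynomials that are nonnegative on the line -/
def PSD (a : Polynomial ℝ) : Prop := ∀ t : ℝ, 0 ≤ a.eval t

theorem PSD.of_mul_sq {f a : Polynomial ℝ} (hf : f ≠ 0) (h : PSD (f ^ 2 * a)) : PSD a := by
  intro t
  by_contra hc
  push Not at hc
  -- `a < 0` near `t`, hence `f = 0` near `t`
  have hev : ∀ᶠ s in nhds t, a.eval s < 0 := a.continuous.continuousAt.eventually_lt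
    continuousAt_const hc
  have hz : ∀ᶠ s in nhds t, f.eval s = 0 := by
    filter_upwards [hev] with s hs
    have := h s
    simp only [Polynomial.eval_mul, Polynomial.eval_pow] at this
    by_contra hne
    have : 0 < f.eval s ^ 2 := by positivity
    nlinarith
  have hinf : {s | f.eval s = 0}.Infinite := infinite_of_mem_nhds t hz
  exact hf (Polynomial.eq_zero_of_infinite_isRoot f hinf)

/-- positive definite monic quadratics -/
noncomputable def quad (u v : ℝ) : Polynomial ℝ :=
  (Polynomial.X - Polynomial.C u) ^ 2 + Polynomial.C v ^ 2

theorem quad_eval (u v t : ℝ) : (quad u v).eval t = (t - u) ^ 2 + v ^ 2 := by simp [quad]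

theorem quad_natDegree (u v : ℝ) : (quad u v).natDegree = 2 := by
  unfold quad
  rw [← Polynomial.C_pow, Polynomial.natDegree_add_C, Polynomial.natDegree_pow,
    Polynomial.natDegree_X_sub_C]

theorem psd_induction (Q : Polynomial ℝ → Prop) (hC : ∀ c : ℝ, 0 < c → Q (Polynomial.C c))
    (hsq : ∀ f a, f ≠ 0 → a ≠ 0 → PSD a → Q a → Q (f ^ 2 * a))
    (hq : ∀ u v a, v ≠ 0 → a ≠ 0 → PSD a → Q a → Q (quad u v * a))
    (a : Polynomial ℝ) (ha : a ≠ 0) (hpsd : PSD a) : Q a := by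
  induction hn : a.natDegree using Nat.strong_induction_on generalizing a with
  | _ n ih =>
    by_cases h0 : a.natDegree = 0
    · obtain ⟨c, rfl⟩ := Polynomial.natDegree_eq_zero.1 h0
      apply hC
      have h1 : 0 ≤ c := by simpa using hpsd 0
      exact lt_of_le_of_ne h1 (fun h => ha (by rw [← h]; simp))
    · obtain ⟨z, hz⟩ := IsAlgClosed.exists_aeval_eq_zero ℂ a
        (fun h => h0 (Polynomial.natDegree_eq_of_degree_eq_some h))
      by_cases him : z.im = 0
      · have hroot : a.IsRoot z.re := by
          have : z = ((z.re : ℝ) : ℂ) := by apply Complex.ext <;> simp [him]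
          rw [this] at hz
          have h2 : ((a.eval z.re : ℝ) : ℂ) = 0 := by
            rw [← hz]
            simpa using (Polynomial.aeval_algebraMap_apply ℂ z.re a).symm
          exact_mod_cast h2
        set u := z.re
        obtain ⟨a1, ha1⟩ := Polynomial.dvd_iff_isRoot.2 hroot
        have hroot1 : a1.IsRoot u := by
          -- sign change otherwise
          by_contra hne
          have hne' : a1.eval u ≠ 0 := hne
          have hval : ∀ t, 0 ≤ (t - u) * a1.eval t := by
            intro t
            have := hpsd t
            rw [ha1] at this
            simpa using this
          rcases lt_or_gt_of_ne hne' with hlt | hgt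
          · have hev : ∀ᶠ s in nhds u, a1.eval s < 0 := a1.continuous.continuousAt.eventually_lt
              continuousAt_const hlt
            obtain ⟨ε, hε, hb⟩ := Metric.eventually_nhds_iff.1 hev
            have h1 := hb (y := u + ε / 2) (by rw [Real.dist_eq]; simp; rw [abs_of_pos (by linarith)]; linarith)
            have h2 := hval (u + ε / 2)
            nlinarith
          · have hev : ∀ᶠ s in nhds u, 0 < a1.eval s := continuousAt_const.eventually_lt
              a1.continuous.continuousAt hgt
            obtain ⟨ε, hε, hb⟩ := Metric.eventually_nhds_iff.1 hev
            have h1 := hb (y := u - ε / 2) (by rw [Real.dist_eq]; simp; rw [abs_of_pos (by linarith)]; linarith)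
            have h2 := hval (u - ε / 2)
            nlinarith
        obtain ⟨a2, ha2⟩ := Polynomial.dvd_iff_isRoot.2 hroot1
        have hX : (Polynomial.X - Polynomial.C u) ≠ 0 := Polynomial.X_sub_C_ne_zero u
        have heq : a = (Polynomial.X - Polynomial.C u) ^ 2 * a2 := by rw [ha1, ha2]; ring
        have ha20 : a2 ≠ 0 := by rintro rfl; simp [heq] at ha
        have hp2 : PSD a2 := PSD.of_mul_sq hX (heq ▸ hpsd)
        rw [heq]
        refine hsq _ _ hX ha20 hp2 (ih _ ?_ a2 ha20 hp2 rfl)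
        rw [← hn, heq, Polynomial.natDegree_mul (pow_ne_zero 2 hX) ha20, Polynomial.natDegree_pow,
          Polynomial.natDegree_X_sub_C]
        omega
      · have hdvd := Polynomial.quadratic_dvd_of_aeval_eq_zero_im_ne_zero a hz him
        have hquad : Polynomial.X ^ 2 - Polynomial.C (2 * z.re) * Polynomial.X +
            Polynomial.C (‖z‖ ^ 2) = quad z.re z.im := by
          unfold quad
          rw [Complex.sq_norm, Complex.normSq_apply]
          simp only [map_mul, map_add, Polynomial.C_ofNat]
          ring
        rw [hquad] at hdvd
        obtain ⟨a2, heq⟩ := hdvd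
        have ha20 : a2 ≠ 0 := by rintro rfl; simp [heq] at ha
        have hp2 : PSD a2 := by
          intro t
          have h1 := hpsd t
          rw [heq, Polynomial.eval_mul, quad_eval] at h1
          have : 0 < (t - z.re) ^ 2 + z.im ^ 2 := by positivity
          exact nonneg_of_mul_nonneg_right h1 this
        have hq0 : quad z.re z.im ≠ 0 := by
          rintro h; simp [heq, h] at ha
        rw [heq]
        refine hq _ _ _ him ha20 hp2 (ih _ ?_ a2 ha20 hp2 rfl)
        rw [← hn, heq, Polynomial.natDegree_mul hq0 ha20, quad_natDegree]
        omega

/-- two quadratics -/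
theorem quad_quad (u v c e : ℝ) (hv : v ≠ 0) (he : e ≠ 0) :
    ∃ S Y Z : Polynomial ℝ, Y ≠ 0 ∧ S ^ 2 + quad c e * Y ^ 2 = quad u v * Z ^ 2 := by
  obtain ⟨l, hl, σ, τ, h⟩ : ∃ l : ℝ, 0 < l ∧ ∃ σ τ : ℝ, ∀ t : ℝ,
      (σ * t + τ) ^ 2 + ((t - c) ^ 2 + e ^ 2) * l = (t - u) ^ 2 + v ^ 2 := by
    have hv2 : 0 < v ^ 2 := by positivity
    have he2 : 0 < e ^ 2 := by positivity
    by_cases huc : u = c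
    · subst huc
      by_cases hve : e ^ 2 ≤ v ^ 2
      · refine ⟨1, one_pos, 0, √(v ^ 2 - e ^ 2), fun t => ?_⟩
        have := Real.sq_sqrt (sub_nonneg.2 hve)
        linarith
      · push Not at hve
        have h1 : v ^ 2 / e ^ 2 < 1 := (div_lt_one he2).2 hve
        refine ⟨v ^ 2 / e ^ 2, by positivity, √(1 - v ^ 2 / e ^ 2),
          - u * √(1 - v ^ 2 / e ^ 2), fun t => ?_⟩
        have h2 := Real.sq_sqrt (sub_nonneg.2 h1.le)
        have : (√(1 - v ^ 2 / e ^ 2) * t + - u * √(1 - v ^ 2 / e ^ 2)) ^ 2 =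
          (1 - v ^ 2 / e ^ 2) * (t - u) ^ 2 := by linear_combination (t - u) ^ 2 * h2
        rw [this]
        field_simp
        ring
    · let D : ℝ → ℝ := fun l => (u - l * c) ^ 2 - (1 - l) * (u ^ 2 + v ^ 2 - l * (c ^ 2 + e ^ 2))
      have hD : ContinuousOn D (Set.Icc 0 1) := by
        apply Continuous.continuousOn; fun_prop
      have h0 : D 0 < 0 := by simp only [D]; nlinarith
      have h1 : 0 < D 1 := by
        have : u - c ≠ 0 := sub_ne_zero.2 huc
        have : 0 < (u - c) ^ 2 := by positivity
        simp only [D]; nlinarith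
      obtain ⟨l, hl, hDl⟩ := intermediate_value_Ioo zero_le_one hD ⟨h0, h1⟩
      have hl1 : 0 < 1 - l := by linarith [hl.2]
      refine ⟨l, hl.1, √(1 - l), - (u - l * c) / √(1 - l), fun t => ?_⟩
      have hs := Real.sq_sqrt hl1.le
      have hs0 : √(1 - l) ≠ 0 := (Real.sqrt_pos.2 hl1).ne'
      have : (√(1 - l) * t + - (u - l * c) / √(1 - l)) ^ 2 =
        (1 - l) * t ^ 2 - 2 * (u - l * c) * t + (u - l * c) ^ 2 / (1 - l) := by
        generalize √(1 - l) = r at hs hs0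
        rw [← hs]
        field_simp
        ring
      rw [this]
      have h3 : (u - l * c) ^ 2 / (1 - l) = u ^ 2 + v ^ 2 - l * (c ^ 2 + e ^ 2) := by
        rw [div_eq_iff hl1.ne']
        simp only [D] at hDl
        linarith
      rw [h3]
      ring
  refine ⟨Polynomial.C σ * Polynomial.X + Polynomial.C τ, Polynomial.C (√l), 1, ?_, ?_⟩
  · simpa using (Real.sqrt_pos.2 hl).ne'
  · apply Polynomial.funext
    intro t
    have := h t
    simp [quad_eval, Real.sq_sqrt hl.le]
    linarith

theorem quad_psd (u v : ℝ) (b : Polynomial ℝ) (hv : v ≠ 0) (hb : b ≠ 0) (hpsd : PSD b) :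
    ∃ S Y Z : Polynomial ℝ, Y ≠ 0 ∧ S ^ 2 + b * Y ^ 2 = quad u v * Z ^ 2 := by
  refine psd_induction (fun b => ∃ S Y Z : Polynomial ℝ, Y ≠ 0 ∧
    S ^ 2 + b * Y ^ 2 = quad u v * Z ^ 2) ?_ ?_ ?_ b hb hpsd
  · intro c hc
    refine ⟨Polynomial.X - Polynomial.C u, Polynomial.C (v / √c), 1, ?_, ?_⟩
    · have := (Real.sqrt_pos.2 hc).ne'
      simp [hv, this]
    · apply Polynomial.funext
      intro t
      have := (Real.sqrt_pos.2 hc).ne'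
      simp only [quad_eval, Polynomial.eval_add, Polynomial.eval_pow, Polynomial.eval_sub,
        Polynomial.eval_X, Polynomial.eval_C, Polynomial.eval_mul, Polynomial.eval_one, div_pow,
        Real.sq_sqrt hc.le]
      field_simp
  · rintro f a - - - ⟨S, Y, Z, hY, h⟩
    refine ⟨f * S, Y, f * Z, hY, ?_⟩
    linear_combination f ^ 2 * h
  · rintro c e a he - - ⟨S2, Y2, Z2, hY2, h2⟩
    obtain ⟨S1, Y1, Z1, hY1, h1⟩ := quad_quad u v c e hv he
    set A := quad u v * Z1 * Z2 + S1 * S2 with hA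
    set B := Z1 * S2 + S1 * Z2 with hB
    set P := Polynomial.X - Polynomial.C u with hP
    set R := Polynomial.C v with hR
    have hq : quad u v = P ^ 2 + R ^ 2 := rfl
    refine ⟨A * P + quad u v * B, Y1 * Y2 * R, A + B * P, ?_, ?_⟩
    · have : R ≠ 0 := by simpa [hR] using hv
      exact mul_ne_zero (mul_ne_zero hY1 hY2) this
    · have e1 : quad c e * Y1 ^ 2 = quad u v * Z1 ^ 2 - S1 ^ 2 := by linear_combination h1
      have e2 : a * Y2 ^ 2 = quad u v * Z2 ^ 2 - S2 ^ 2 := by linear_combination h2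
      have e3 : quad c e * a * (Y1 * Y2 * R) ^ 2 =
        (quad u v * Z1 ^ 2 - S1 ^ 2) * (quad u v * Z2 ^ 2 - S2 ^ 2) * R ^ 2 := by
        rw [← e1, ← e2]; ring
      rw [e3, hA, hB, hq]
      ring

/-- The conic `S² + b Y² = a Z²` has a point over `ℝ[t]` for psd `a`, `b`. -/
theorem conic (a b : Polynomial ℝ) (ha : a ≠ 0) (hap : PSD a) (hb : b ≠ 0) (hbp : PSD b) :
    ∃ S Y Z : Polynomial ℝ, Z ≠ 0 ∧ S ^ 2 + b * Y ^ 2 = a * Z ^ 2 := by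
  refine psd_induction (fun a => ∃ S Y Z : Polynomial ℝ, Z ≠ 0 ∧
    S ^ 2 + b * Y ^ 2 = a * Z ^ 2) ?_ ?_ ?_ a ha hap
  · intro c hc
    refine ⟨Polynomial.C (√c), 0, 1, one_ne_zero, ?_⟩
    rw [← Polynomial.C_pow, Real.sq_sqrt hc.le]
    ring
  · rintro f a - - - ⟨S, Y, Z, hY, h⟩
    refine ⟨f * S, f * Y, Z, hY, ?_⟩
    linear_combination f ^ 2 * h
  · rintro u v a hv - - ⟨S2, Y2, Z2, hZ2, h2⟩
    obtain ⟨S1, Y1, Z1, hY1, h1⟩ := quad_psd u v b hv hb hbp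
    have hZ1 : Z1 ≠ 0 := by
      rintro rfl
      apply mul_ne_zero hb (pow_ne_zero 2 hY1)
      apply Polynomial.funext
      intro t
      have h3 := congrArg (Polynomial.eval t) h1
      have h4 := hbp t
      simp only [Polynomial.eval_add, Polynomial.eval_pow, Polynomial.eval_mul,
        Polynomial.eval_zero] at h3 ⊢
      have h5 := mul_nonneg h4 (sq_nonneg (Y1.eval t))
      nlinarith [sq_nonneg (S1.eval t)]
    refine ⟨S1 * S2 - b * Y1 * Y2, S1 * Y2 + S2 * Y1, Z1 * Z2, mul_ne_zero hZ1 hZ2, ?_⟩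
    have : quad u v * a * (Z1 * Z2) ^ 2 = (quad u v * Z1 ^ 2) * (a * Z2 ^ 2) := by ring
    rw [this, ← h1, ← h2]
    ring

theorem ker_vec (k : ℕ) (c : Fin k → Fin (k + 1) → Polynomial ℝ) :
    ∃ p : Fin (k + 1) → Polynomial ℝ, p ≠ 0 ∧ ∀ j, ∑ i, c j i * p i = 0 := by
  let M : Matrix (Fin (k + 1)) (Fin (k + 1)) (Polynomial ℝ) :=
    Matrix.of (Fin.cons (0 : Fin (k + 1) → Polynomial ℝ) c)
  have hdet : M.det = 0 := Matrix.det_eq_zero_of_row_eq_zero 0 (fun j => by simp [M])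
  obtain ⟨p, hp, h⟩ := Matrix.exists_mulVec_eq_zero_iff.2 hdet
  refine ⟨p, hp, fun j => ?_⟩
  have := congrFun h j.succ
  simpa [M, Matrix.mulVec, dotProduct] using this

theorem psd_dot {ι : Type*} [Fintype ι] (p : ι → Polynomial ℝ) : PSD (∑ i, p i * p i) := by
  intro t
  rw [Polynomial.eval_finsetSum]
  apply Finset.sum_nonneg
  intro i _
  rw [Polynomial.eval_mul]
  exact mul_self_nonneg _

theorem poly_sum_sq {ι : Type*} [Fintype ι] (c : ι → Polynomial ℝ) (h : ∑ i, c i ^ 2 = 0) (i : ι) :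
    c i = 0 := by
  apply Polynomial.funext
  intro t
  rw [Polynomial.eval_zero]
  apply real_sum_sq (fun i => (c i).eval t)
  have := congrArg (Polynomial.eval t) h
  simpa [Polynomial.eval_finsetSum] using this

theorem dot_ne_zero {ι : Type*} [Fintype ι] (p : ι → Polynomial ℝ) (hp : p ≠ 0) :
    ∑ i, p i * p i ≠ 0 := by
  intro h
  apply hp
  funext i
  exact poly_sum_sq p (by simpa [sq] using h) i

theorem exists_w (n : ℕ) (b : Fin n → Fin (n + 2) → Polynomial ℝ) :
    ∃ (w : Fin (n + 2) → Polynomial ℝ) (h : Polynomial ℝ), h ≠ 0 ∧ ∑ i, w i * w i = h ^ 2 ∧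
      ∀ j, ∑ i, b j i * w i = 0 := by
  obtain ⟨p, hp, hpb⟩ := ker_vec (n + 1) (Fin.cons 0 b)
  obtain ⟨r, hr, hrb⟩ := ker_vec (n + 1) (Fin.cons p b)
  have hpb' : ∀ j, ∑ i, b j i * p i = 0 := fun j => by simpa using hpb j.succ
  have hrb' : ∀ j, ∑ i, b j i * r i = 0 := fun j => by simpa using hrb j.succ
  have hpr : ∑ i, p i * r i = 0 := by simpa using hrb 0
  set a := ∑ i, p i * p i with ha
  set c := ∑ i, r i * r i with hc
  have ha0 : a ≠ 0 := dot_ne_zero p hp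
  have hc0 : c ≠ 0 := dot_ne_zero r hr
  have hac : PSD (a * c) := fun t => by
    rw [Polynomial.eval_mul]; exact mul_nonneg (psd_dot p t) (psd_dot r t)
  obtain ⟨S, Y, Z, hZ, h⟩ := conic a (a * c) ha0 (psd_dot p) (mul_ne_zero ha0 hc0) hac
  refine ⟨fun i => S * p i + a * Y * r i, a * Z, mul_ne_zero ha0 hZ, ?_, ?_⟩
  · have : ∀ A B : Polynomial ℝ, ∑ i, (A * p i + B * r i) * (A * p i + B * r i) =
        A ^ 2 * (∑ i, p i * p i) + 2 * A * B * (∑ i, p i * r i) + B ^ 2 * ∑ i, r i * r i := by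
      intro A B
      rw [Finset.mul_sum, Finset.mul_sum, Finset.mul_sum, ← Finset.sum_add_distrib,
        ← Finset.sum_add_distrib]
      refine Finset.sum_congr rfl fun i _ => ?_
      ring
    rw [this, hpr, ← ha, ← hc]
    linear_combination a * h
  · intro j
    have : ∑ i, b j i * (S * p i + a * Y * r i) =
        S * ∑ i, b j i * p i + a * Y * ∑ i, b j i * r i := by
      rw [Finset.mul_sum, Finset.mul_sum, ← Finset.sum_add_distrib]
      refine Finset.sum_congr rfl fun i _ => ?_
      ring
    rw [this, hpb', hrb']
    ring

theorem exists_w_primitive (n : ℕ) (b : Fin n → Fin (n + 2) → Polynomial ℝ) :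
    ∃ (w : Fin (n + 2) → Polynomial ℝ) (h : Polynomial ℝ), h.Monic ∧ ∑ i, w i * w i = h ^ 2 ∧
      (∀ j, ∑ i, b j i * w i = 0) ∧ ∀ g, (∀ i, h ∣ g * w i) → h ∣ g := by
  obtain ⟨w, h, h0, hw, hb⟩ := exists_w n b
  induction hn : h.natDegree using Nat.strong_induction_on generalizing w h with
  | _ N ih =>
    -- division by a common factor
    have hdiv : ∀ c : Polynomial ℝ, c ∣ h → (∀ i, c ∣ w i) → ∃ (w' : Fin (n + 2) → Polynomial ℝ)
        (h' : Polynomial ℝ), h = c * h' ∧ (∀ i, w i = c * w' i) ∧ h' ≠ 0 ∧ c ≠ 0 ∧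
        ∑ i, w' i * w' i = h' ^ 2 ∧ ∀ j, ∑ i, b j i * w' i = 0 := by
      rintro c ⟨h', hh⟩ hcw
      choose w' hw' using hcw
      have hc0 : c ≠ 0 := by rintro rfl; simp [hh] at h0
      have hh0 : h' ≠ 0 := by rintro rfl; simp [hh] at h0
      refine ⟨w', h', hh, hw', hh0, hc0, ?_, ?_⟩
      · apply mul_left_cancel₀ (pow_ne_zero 2 hc0)
        rw [← mul_pow, ← hh, ← hw, Finset.mul_sum]
        refine Finset.sum_congr rfl fun i _ => ?_
        rw [hw' i]; ring
      · intro j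
        apply mul_left_cancel₀ hc0
        rw [mul_zero, ← hb j, Finset.mul_sum]
        refine Finset.sum_congr rfl fun i _ => ?_
        rw [hw' i]; ring
    let I : Ideal (Polynomial ℝ) := Ideal.span (insert h (Set.range w))
    obtain ⟨c, hc⟩ := (IsPrincipalIdealRing.principal I).principal
    have hmem : ∀ x ∈ I, c ∣ x := fun x hx => by
      rw [hc] at hx
      exact Ideal.mem_span_singleton.1 hx
    have hch : c ∣ h := hmem h (Ideal.subset_span (by simp))
    have hcw : ∀ i, c ∣ w i := fun i => hmem _ (Ideal.subset_span (by simp))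
    obtain ⟨w', h', e1, e2, hh0, hc0, e3, e4⟩ := hdiv c hch hcw
    by_cases hdeg : c.natDegree = 0
    · have hcu : IsUnit c := by
        obtain ⟨r, rfl⟩ := Polynomial.natDegree_eq_zero.1 hdeg
        apply Polynomial.isUnit_C.2
        apply IsUnit.mk0
        rintro rfl; simp at hc0
      have hprim : ∀ g, (∀ i, h ∣ g * w i) → h ∣ g := by
        intro g hg
        have hle : I ≤ Submodule.comap (LinearMap.mulLeft (Polynomial ℝ) g) (Ideal.span {h}) := by
          apply Ideal.span_le.2
          rintro x (rfl | ⟨i, rfl⟩)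
          · simp [Ideal.mem_span_singleton]
          · simpa [Ideal.mem_span_singleton] using hg i
        have h1 : (1 : Polynomial ℝ) ∈ I := by
          rw [hc]
          exact Ideal.mem_span_singleton.2 hcu.dvd
        simpa [Ideal.mem_span_singleton] using hle h1
      -- make monic
      have hl0 : h.leadingCoeff ≠ 0 := Polynomial.leadingCoeff_ne_zero.2 h0
      have hlu : IsUnit (Polynomial.C h.leadingCoeff) :=
        Polynomial.isUnit_C.2 (IsUnit.mk0 _ hl0)
      obtain ⟨w1, h1, f1, f2, -, -, f3, f4⟩ := hdiv (Polynomial.C h.leadingCoeff)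
        hlu.dvd (fun i => hlu.dvd)
      refine ⟨w1, h1, ?_, f3, f4, ?_⟩
      · have := congrArg Polynomial.leadingCoeff f1
        rw [Polynomial.leadingCoeff_mul, Polynomial.leadingCoeff_C] at this
        exact (mul_left_cancel₀ hl0 (by rw [mul_one]; exact this)).symm
      · intro g hg
        have : h ∣ g := by
          apply hprim
          intro i
          rw [f1, f2 i, mul_left_comm]
          exact mul_dvd_mul_left _ (hg i)
        exact (Dvd.intro_left _ f1.symm).trans this
    · refine ih h'.natDegree ?_ w' h' hh0 e3 e4 rfl
      rw [← hn, e1, Polynomial.natDegree_mul hc0 hh0]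
      omega

theorem poly_dot_const {ι : Type*} [Fintype ι] (h : Polynomial ℝ) (hm : h.Monic)
    (y y' : ι → Polynomial ℝ) (hy : ∀ i, (y i).natDegree ≤ h.natDegree)
    (hy' : ∀ i, (y' i).natDegree ≤ h.natDegree) (hdvd : h ^ 2 ∣ ∑ i, y i * y' i) :
    ∑ i, y i * y' i = h ^ 2 *
      Polynomial.C (∑ i, (y i).coeff h.natDegree * (y' i).coeff h.natDegree) := by
  obtain ⟨s, hs⟩ := hdvd
  have hm2 : (h ^ 2).Monic := hm.pow 2
  have hdeg2 : (h ^ 2).natDegree = h.natDegree + h.natDegree := by rw [hm.natDegree_pow]; ring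
  have hle : (∑ i, y i * y' i).natDegree ≤ h.natDegree + h.natDegree := by
    apply Polynomial.natDegree_sum_le_of_forall_le
    intro i _
    exact Polynomial.natDegree_mul_le.trans (add_le_add (hy i) (hy' i))
  have hs0 : s.natDegree = 0 := by
    by_cases h0 : s = 0
    · simp [h0]
    · rw [hs, hm2.natDegree_mul' h0, hdeg2] at hle
      omega
  obtain ⟨r, rfl⟩ := Polynomial.natDegree_eq_zero.1 hs0
  rw [hs]
  congr 2
  have h1 := congrArg (fun p => Polynomial.coeff p (h.natDegree + h.natDegree)) hs
  simp only [Polynomial.finsetSum_coeff, Polynomial.coeff_mul_C] at h1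
  rw [← hdeg2, hm2.coeff_natDegree, one_mul, hdeg2] at h1
  rw [← h1]
  refine Finset.sum_congr rfl fun i _ => ?_
  exact Polynomial.coeff_mul_add_eq_of_natDegree_le (hy i) (hy' i)

noncomputable def Dl (k : ℕ) : (Fin k → ℝ) →ₗ[ℝ] Polynomial ℝ :=
  (Polynomial.degreeLT ℝ k).subtype ∘ₗ (Polynomial.degreeLTEquiv ℝ k).symm.toLinearMap

theorem Dl_degree (k : ℕ) (x : Fin k → ℝ) : (Dl k x).degree < k :=
  Polynomial.mem_degreeLT.1 ((Polynomial.degreeLTEquiv ℝ k).symm x).2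

theorem Dl_inj (k : ℕ) (x : Fin k → ℝ) (h : Dl k x = 0) : x = 0 := by
  have : (Polynomial.degreeLTEquiv ℝ k).symm x = 0 := Subtype.ext h
  simpa using this

theorem lift_vec {m : ℕ} (w : Fin m → Polynomial ℝ) (h : Polynomial ℝ) (hm : h.Monic)
    (hw : ∑ i, w i * w i = h ^ 2) (hwd : ∀ i, (w i).natDegree ≤ h.natDegree)
    (hprim : ∀ g, (∀ i, h ∣ g * w i) → h ∣ g) (x : Fin m → ℝ) :
    ∃ (v : Fin m → Polynomial ℝ) (g : Polynomial ℝ),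
      (∀ i, (h * v i + g * w i).natDegree ≤ h.natDegree) ∧ h ∣ ∑ i, v i * w i ∧
      ∀ i, (h * v i + g * w i).coeff h.natDegree = x i := by
  set e := h.natDegree with he
  let V := (Fin m → Fin (e + 1) → ℝ) × (Fin e → ℝ)
  let A : V →ₗ[ℝ] Polynomial ℝ := ∑ i, (LinearMap.mulRight ℝ (w i)) ∘ₗ Dl (e + 1) ∘ₗ
    LinearMap.proj i ∘ₗ LinearMap.fst ℝ _ _
  let Y : Fin m → V →ₗ[ℝ] Polynomial ℝ := fun i =>
    (LinearMap.mulLeft ℝ h) ∘ₗ Dl (e + 1) ∘ₗ LinearMap.proj i ∘ₗ LinearMap.fst ℝ _ _ +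
    (LinearMap.mulRight ℝ (w i)) ∘ₗ Dl e ∘ₗ LinearMap.snd ℝ _ _
  have hA : ∀ z : V, A z = ∑ i, Dl (e + 1) (z.1 i) * w i := by
    intro z; simp [A]; rfl
  have hY : ∀ (z : V) i, Y i z = h * Dl (e + 1) (z.1 i) + Dl e z.2 * w i := by
    intro z i; simp [Y]; rfl
  let T : V →ₗ[ℝ] (Fin e → ℝ) × (Fin m → Fin e → ℝ) :=
    LinearMap.prod (LinearMap.pi fun k => Polynomial.lcoeff ℝ k ∘ₗ Polynomial.modByMonicHom h ∘ₗ A)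
      (LinearMap.pi fun i => LinearMap.pi fun k : Fin e =>
        Polynomial.lcoeff ℝ (e + 1 + k) ∘ₗ Y i)
  -- properties of the kernel
  have hdvd : ∀ z : V, T z = 0 → h ∣ A z := by
    intro z hz
    rw [← Polynomial.modByMonic_eq_zero_iff_dvd hm]
    ext k
    rw [Polynomial.coeff_zero]
    by_cases hk : k < e
    · have := congrFun (congrArg Prod.fst hz) ⟨k, hk⟩
      simpa [T] using this
    · apply Polynomial.coeff_eq_zero_of_degree_lt
      refine lt_of_lt_of_le (Polynomial.degree_modByMonic_lt _ hm) ?_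
      rw [Polynomial.degree_eq_natDegree hm.ne_zero]
      exact_mod_cast not_lt.1 hk
  have hnd1 : ∀ x : Fin (e + 1) → ℝ, (Dl (e + 1) x).natDegree ≤ e := fun x =>
    Polynomial.natDegree_le_of_degree_le (by
      have := Dl_degree (e + 1) x
      exact Order.lt_succ_iff.1 (by exact_mod_cast this))
  have hnd2 : ∀ x : Fin e → ℝ, (Dl e x).natDegree ≤ e := fun x =>
    Polynomial.natDegree_le_of_degree_le (Dl_degree e x).le
  have hYdeg : ∀ (z : V) i, T z = 0 → (Y i z).natDegree ≤ e := by
    intro z i hz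
    rw [Polynomial.natDegree_le_iff_coeff_eq_zero]
    intro N hN
    by_cases hN2 : N < e + 1 + e
    · have := congrFun (congrFun (congrArg Prod.snd hz) i) ⟨N - (e + 1), by omega⟩
      have h2 : e + 1 + (N - (e + 1)) = N := by omega
      simpa [T, h2] using this
    · apply Polynomial.coeff_eq_zero_of_natDegree_lt
      have : (Y i z).natDegree ≤ e + e := by
        rw [hY]
        apply Polynomial.natDegree_add_le_of_degree_le
        · exact Polynomial.natDegree_mul_le.trans (add_le_add le_rfl (hnd1 _))
        · exact Polynomial.natDegree_mul_le.trans (add_le_add (hnd2 _) (hwd i))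
      omega
  have hYY : ∀ z : V, T z = 0 → h ^ 2 ∣ ∑ i, Y i z * Y i z := by
    intro z hz
    obtain ⟨s, hs⟩ := hdvd z hz
    have : ∑ i, Y i z * Y i z = h ^ 2 * (∑ i, Dl (e + 1) (z.1 i) * Dl (e + 1) (z.1 i)) +
        2 * h * Dl e z.2 * A z + Dl e z.2 ^ 2 * ∑ i, w i * w i := by
      rw [hA, Finset.mul_sum, Finset.mul_sum, Finset.mul_sum, ← Finset.sum_add_distrib,
        ← Finset.sum_add_distrib]
      refine Finset.sum_congr rfl fun i _ => ?_
      rw [hY]; ring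
    rw [this, hw, hs]
    exact ⟨(∑ i, Dl (e + 1) (z.1 i) * Dl (e + 1) (z.1 i)) + 2 * Dl e z.2 * s + Dl e z.2 ^ 2, by ring⟩
  let Λ : LinearMap.ker T →ₗ[ℝ] (Fin m → ℝ) :=
    (LinearMap.pi fun i => Polynomial.lcoeff ℝ e ∘ₗ Y i) ∘ₗ (LinearMap.ker T).subtype
  have hΛ : ∀ z i, Λ z i = (Y i z.1).coeff e := fun z i => rfl
  have hinj : Function.Injective Λ := by
    rw [← LinearMap.ker_eq_bot, LinearMap.ker_eq_bot']
    rintro ⟨z, hz⟩ hz0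
    have hz' : T z = 0 := hz
    have hc := poly_dot_const h hm (fun i => Y i z) (fun i => Y i z) (fun i => hYdeg z i hz')
      (fun i => hYdeg z i hz') (hYY z hz')
    have hcoef : ∀ i, (Y i z).coeff e = 0 := fun i => by rw [← hΛ ⟨z, hz⟩ i, hz0]; rfl
    simp only [← he, hcoef, mul_zero, Finset.sum_const_zero, map_zero] at hc
    have hY0 : ∀ i, Y i z = 0 := poly_sum_sq (fun i => Y i z) (by simpa [sq] using hc)
    have hg : h ∣ Dl e z.2 := by
      apply hprim
      intro i
      have := hY0 i
      rw [hY] at this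
      exact ⟨- Dl (e + 1) (z.1 i), by linear_combination this⟩
    have hg0 : Dl e z.2 = 0 := by
      apply Polynomial.eq_zero_of_dvd_of_degree_lt hg
      rw [Polynomial.degree_eq_natDegree hm.ne_zero]
      exact Dl_degree e z.2
    have hv0 : ∀ i, z.1 i = 0 := by
      intro i
      apply Dl_inj
      have := hY0 i
      rw [hY, hg0, zero_mul, add_zero] at this
      exact (mul_eq_zero.1 this).resolve_left hm.ne_zero
    apply Subtype.ext
    exact Prod.ext (funext hv0) (Dl_inj _ _ hg0)
  have hfr : Module.finrank ℝ (LinearMap.ker T) = Module.finrank ℝ (Fin m → ℝ) := by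
    apply le_antisymm (LinearMap.finrank_le_finrank_of_injective hinj)
    have h1 := LinearMap.finrank_range_add_finrank_ker T
    have h2 := Submodule.finrank_le (LinearMap.range T)
    have h3 : Module.finrank ℝ V = m * (e + 1) + e := by
      simp [V, Module.finrank_prod, Module.finrank_pi_fintype]
    have h4 : Module.finrank ℝ ((Fin e → ℝ) × (Fin m → Fin e → ℝ)) = e + m * e := by
      simp [Module.finrank_prod, Module.finrank_pi_fintype]
    rw [Module.finrank_fin_fun]
    rw [h3] at h1
    rw [h4] at h2
    have : m * (e + 1) = m * e + m := by ring
    omega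
  obtain ⟨⟨z, hz⟩, hzx⟩ :=
    (LinearMap.injective_iff_surjective_of_finrank_eq_finrank hfr).1 hinj x
  refine ⟨fun i => Dl (e + 1) (z.1 i), Dl e z.2, fun i => ?_, ?_, fun i => ?_⟩
  · rw [← hY]; exact hYdeg z i hz
  · rw [← hA]; exact hdvd z hz
  · rw [← hY, ← hΛ ⟨z, hz⟩ i, hzx]

theorem reduce (n : ℕ) (b : Fin n → Fin (n + 2) → Polynomial ℝ) :
    ∃ c : Fin n → Fin (n + 1) → Polynomial ℝ, ∀ j j', ∑ i, c j i * c j' i =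
      ∑ i, b j i * b j' i := by
  obtain ⟨w, h, hm, hw, hb, hprim⟩ := exists_w_primitive n b
  have hwd : ∀ i, (w i).natDegree ≤ h.natDegree := by
    apply natDegree_le_of_sum_sq real_sum_sq
    simp only [sq]
    rw [hw, hm.natDegree_pow]
  -- orthonormal basis starting with the leading vector of `w`
  let ω : EuclideanSpace ℝ (Fin (n + 2)) := WithLp.toLp 2 fun i => (w i).coeff h.natDegree
  have hω : ∑ i, (w i).coeff h.natDegree * (w i).coeff h.natDegree = 1 := by
    have h1 := poly_dot_const h hm w w hwd hwd (by rw [hw])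
    rw [hw] at h1
    have h2 := mul_left_cancel₀ (pow_ne_zero 2 hm.ne_zero) ((mul_one _).trans h1)
    exact Polynomial.C_injective (h2.symm.trans Polynomial.C_1.symm)
  have hon : Orthonormal ℝ (Set.domRestrict ({0} : Set (Fin (n + 2))) fun _ => ω) := by
    constructor
    · intro i
      have : ‖ω‖ ^ 2 = 1 := by
        rw [EuclideanSpace.real_norm_sq_eq, ← hω]
        simp [ω, sq]
      have h0 := norm_nonneg ω
      have h1 : ‖ω‖ = 1 := by nlinarith
      exact h1
    · intro i j hij
      exact absurd (Subsingleton.elim i j) hij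
  obtain ⟨B, hB⟩ := hon.exists_orthonormalBasis_extension_of_card_eq (by simp)
  have hB0 : B 0 = ω := hB 0 rfl
  have hBB : ∀ k l, ∑ i, B k i * B l i = if k = l then 1 else 0 := by
    intro k l
    have := orthonormal_iff_ite.1 B.orthonormal k l
    rw [← this, PiLp.inner_apply]
    refine Finset.sum_congr rfl fun i _ => ?_
    simp [mul_comm]
  choose v g hdeg hdvd hcoef using fun k : Fin (n + 1) =>
    lift_vec w h hm hw hwd hprim (fun i => B k.succ i)
  let M : Matrix (Fin (n + 2)) (Fin (n + 2)) (Polynomial ℝ) :=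
    Matrix.of (Fin.cons w fun k i => h * v k i + g k * w i)
  have hM0 : ∀ i, M 0 i = w i := fun i => rfl
  have hMs : ∀ (k : Fin (n + 1)) i, M k.succ i = h * v k i + g k * w i := fun k i => rfl
  have hMdeg : ∀ k i, (M k i).natDegree ≤ h.natDegree := by
    intro k i
    refine Fin.cases ?_ (fun k => ?_) k
    · exact hwd i
    · exact hdeg k i
  have hMcoef : ∀ k i, (M k i).coeff h.natDegree = B k i := by
    intro k i
    refine Fin.cases ?_ (fun k => ?_) k
    · rw [hM0, hB0]
    · exact hcoef k i
  -- every row has the shape `h v + g w`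
  have hshape : ∀ k, ∃ (v' : Fin (n + 2) → Polynomial ℝ) (g' : Polynomial ℝ),
      (∀ i, M k i = h * v' i + g' * w i) ∧ h ∣ ∑ i, v' i * w i := by
    intro k
    refine Fin.cases ?_ (fun k => ?_) k
    · exact ⟨0, 1, fun i => by simp [hM0], by simp⟩
    · exact ⟨v k, g k, fun i => hMs k i, hdvd k⟩
  have hMdvd : ∀ k l, h ^ 2 ∣ ∑ i, M k i * M l i := by
    intro k l
    obtain ⟨v1, g1, e1, s1, d1⟩ := hshape k
    obtain ⟨v2, g2, e2, s2, d2⟩ := hshape l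
    have : ∑ i, M k i * M l i = h ^ 2 * (∑ i, v1 i * v2 i) +
        h * g2 * (∑ i, v1 i * w i) + h * g1 * (∑ i, v2 i * w i) + g1 * g2 * ∑ i, w i * w i := by
      rw [Finset.mul_sum, Finset.mul_sum, Finset.mul_sum, Finset.mul_sum,
        ← Finset.sum_add_distrib, ← Finset.sum_add_distrib, ← Finset.sum_add_distrib]
      refine Finset.sum_congr rfl fun i _ => ?_
      rw [e1, e2]; ring
    rw [this, hw, d1, d2]
    exact ⟨(∑ i, v1 i * v2 i) + g2 * s1 + g1 * s2 + g1 * g2, by ring⟩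
  have hMM : M * M.transpose = (h ^ 2) • (1 : Matrix _ _ (Polynomial ℝ)) := by
    ext1 k l
    rw [Matrix.mul_apply]
    simp only [Matrix.transpose_apply]
    rw [poly_dot_const h hm (M k) (M l) (hMdeg k) (hMdeg l) (hMdvd k l)]
    simp only [hMcoef, hBB]
    rw [Matrix.smul_apply, Matrix.one_apply]
    split_ifs <;> simp
  have hMM' : M.transpose * M = (h ^ 2) • (1 : Matrix _ _ (Polynomial ℝ)) := by
    have hdet : M.det ≠ 0 := by
      intro h0
      have := congrArg Matrix.det hMM
      rw [Matrix.det_mul, h0, zero_mul, Matrix.det_smul, Matrix.det_one, mul_one] at this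
      exact pow_ne_zero _ (pow_ne_zero 2 hm.ne_zero) this.symm
    have h1 : M * (M.transpose * M - (h ^ 2) • (1 : Matrix _ _ (Polynomial ℝ))) = 0 := by
      rw [mul_sub, ← mul_assoc, hMM]
      simp
    have h2 := congrArg (fun N => M.adjugate * N) h1
    simp only [← mul_assoc, Matrix.adjugate_mul, mul_zero, smul_mul_assoc, one_mul] at h2
    exact sub_eq_zero.1 ((smul_eq_zero.1 h2).resolve_left hdet)
  refine ⟨fun j k => ∑ i, b j i * v k i, fun j j' => ?_⟩
  apply mul_left_cancel₀ (pow_ne_zero 2 hm.ne_zero)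
  have hc : ∀ j k, h * ∑ i, b j i * v k i = ∑ i, b j i * M k.succ i := by
    intro j k
    have : ∑ i, b j i * M k.succ i = h * (∑ i, b j i * v k i) + g k * ∑ i, b j i * w i := by
      rw [Finset.mul_sum, Finset.mul_sum, ← Finset.sum_add_distrib]
      refine Finset.sum_congr rfl fun i _ => ?_
      rw [hMs]; ring
    rw [this, hb, mul_zero, add_zero]
  calc h ^ 2 * ∑ k, (∑ i, b j i * v k i) * ∑ i, b j' i * v k i
      = ∑ k : Fin (n + 1), (∑ i, b j i * M k.succ i) * ∑ i, b j' i * M k.succ i := by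
        rw [Finset.mul_sum]
        refine Finset.sum_congr rfl fun k _ => ?_
        rw [← hc, ← hc]; ring
    _ = ∑ k : Fin (n + 2), (∑ i, b j i * M k i) * ∑ i, b j' i * M k i := by
        rw [Fin.sum_univ_succ (n := n + 1)]
        have : ∑ i, b j i * M 0 i = 0 := hb j
        rw [this, zero_mul, zero_add]
    _ = ∑ i, ∑ i', b j i * b j' i' * (M.transpose * M) i i' := by
        simp only [Finset.sum_mul_sum]
        simp only [Matrix.mul_apply, Matrix.transpose_apply, Finset.mul_sum]
        rw [Finset.sum_comm]
        refine Finset.sum_congr rfl fun i _ => ?_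
        rw [Finset.sum_comm]
        refine Finset.sum_congr rfl fun i' _ => Finset.sum_congr rfl fun k _ => ?_
        ring
    _ = h ^ 2 * ∑ i, b j i * b j' i := by
        rw [hMM', Finset.mul_sum]
        refine Finset.sum_congr rfl fun i _ => ?_
        simp only [Matrix.smul_apply, Matrix.one_apply, smul_eq_mul, mul_ite, mul_one, mul_zero,
          Finset.sum_ite_eq, Finset.mem_univ, if_true]
        ring

theorem reduce_all (n m : ℕ) (b : Fin n → Fin m → Polynomial ℝ) :
    ∃ c : Fin n → Fin (n + 1) → Polynomial ℝ, ∀ j j', ∑ i, c j i * c j' i =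
      ∑ i, b j i * b j' i := by
  induction m with
  | zero => exact ⟨0, fun j j' => by simp⟩
  | succ m ih =>
    obtain ⟨c, hc⟩ := ih (fun j i => b j i.castSucc)
    obtain ⟨c', hc'⟩ := reduce n (fun j => Fin.snoc (c j) (b j (Fin.last m)))
    refine ⟨c', fun j j' => ?_⟩
    rw [hc', Fin.sum_univ_castSucc, Fin.sum_univ_castSucc (n := m), ← hc]
    simp

theorem bipoly_expand (d : ℕ) (q : Polynomial (Polynomial ℝ)) (h : q.natDegree ≤ d) :
    q = ∑ j : Fin (d + 1), Polynomial.C (q.coeff j) * Polynomial.X ^ (j : ℕ) := by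
  conv_lhs => rw [q.as_sum_range_C_mul_X_pow' (n := d + 1) (by omega)]
  rw [Fin.sum_univ_eq_sum_range (fun j => Polynomial.C (q.coeff j) * Polynomial.X ^ j)]

theorem sum_sq_gram {ι : Type*} [Fintype ι] (n : ℕ) (c : Fin n → ι → Polynomial ℝ) :
    ∑ i, (∑ j : Fin n, Polynomial.C (c j i) * Polynomial.X ^ (j : ℕ)) ^ 2 =
      ∑ j : Fin n, ∑ j' : Fin n, Polynomial.C (∑ i, c j i * c j' i) *
        Polynomial.X ^ ((j : ℕ) + (j' : ℕ)) := by
  simp only [sq, Finset.sum_mul_sum]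
  rw [Finset.sum_comm]
  refine Finset.sum_congr rfl fun j _ => ?_
  rw [Finset.sum_comm]
  refine Finset.sum_congr rfl fun j' _ => ?_
  rw [map_sum, Finset.sum_mul]
  refine Finset.sum_congr rfl fun i _ => ?_
  rw [map_mul, pow_add]; ring

theorem bipoly_reduce (d k : ℕ) (q : Fin k → Polynomial (Polynomial ℝ))
    (h : ∀ i, (q i).natDegree ≤ d) :
    ∃ Q : Fin (d + 2) → Polynomial (Polynomial ℝ), ∑ i, Q i ^ 2 = ∑ i, q i ^ 2 := by
  obtain ⟨c, hc⟩ := reduce_all (d + 1) k (fun j i => (q i).coeff j)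
  refine ⟨fun i => ∑ j : Fin (d + 1), Polynomial.C (c j i) * Polynomial.X ^ (j : ℕ), ?_⟩
  rw [sum_sq_gram]
  simp only [hc]
  rw [← sum_sq_gram]
  exact Finset.sum_congr rfl fun i _ => by rw [← bipoly_expand d (q i) (h i)]

/-- dehomogenisation -/
noncomputable def dehom : MvPolynomial (Fin 3) ℝ →ₐ[ℝ] Polynomial (Polynomial ℝ) :=
  aeval ![Polynomial.C Polynomial.X, 1, Polynomial.X]

theorem dehom_natDegree (n : ℕ) (p : MvPolynomial (Fin 3) ℝ) (hp : p.IsHomogeneous n) :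
    (dehom p).natDegree ≤ n := by
  rw [p.as_sum, map_sum]
  apply Polynomial.natDegree_sum_le_of_forall_le
  intro s hs
  have hs' := hp (mem_support_iff.1 hs)
  rw [dehom, aeval_monomial]
  have h2 : (s.prod fun i k => (![Polynomial.C Polynomial.X, 1, Polynomial.X] :
      Fin 3 → Polynomial (Polynomial ℝ)) i ^ k) =
      Polynomial.C (Polynomial.X ^ (s 0)) * Polynomial.X ^ (s 2) := by
    rw [Finsupp.prod_fintype _ _ (by simp), Fin.prod_univ_three]
    simp
  rw [h2, ← mul_assoc]
  have h3 : (algebraMap ℝ (Polynomial (Polynomial ℝ))) (coeff s p) =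
      Polynomial.C (Polynomial.C (coeff s p)) := rfl
  rw [h3, ← map_mul]
  refine (Polynomial.natDegree_C_mul_X_pow_le _ _).trans ?_
  rw [← hs', Finsupp.weight_apply, Finsupp.sum_fintype _ _ (by simp), Fin.sum_univ_three]
  simp

/-- value of a bivariate polynomial -/
noncomputable def bival (s t : ℝ) : Polynomial (Polynomial ℝ) →+* ℝ :=
  Polynomial.eval₂RingHom (Polynomial.evalRingHom s) t

theorem bival_dehom (s t : ℝ) (p : MvPolynomial (Fin 3) ℝ) :
    bival s t (dehom p) = eval ![s, 1, t] p := by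
  induction p using MvPolynomial.induction_on with
  | C a =>
    have h3 : dehom (C a) = Polynomial.C (Polynomial.C a) := by
      rw [dehom, aeval_C]; rfl
    rw [h3]; simp [bival]
  | add p q hp hq => rw [map_add, map_add, map_add, hp, hq]
  | mul_X p i hp =>
    rw [map_mul, map_mul, map_mul, hp]
    congr 1
    rw [dehom, aeval_X, eval_X]
    fin_cases i <;> simp [bival]

theorem hom_eval (n : ℕ) (p : MvPolynomial (Fin 3) ℝ) (hp : p.IsHomogeneous n) (x y z : ℝ)
    (hy : y ≠ 0) : eval ![x, y, z] p = y ^ n * eval ![x / y, 1, z / y] p := by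
  rw [eval_eq', eval_eq', Finset.mul_sum]
  refine Finset.sum_congr rfl fun s hs => ?_
  have hs' := hp (mem_support_iff.1 hs)
  rw [Finsupp.weight_apply, Finsupp.sum_fintype _ _ (by simp), Fin.sum_univ_three] at hs'
  simp only [Pi.one_apply, smul_eq_mul, mul_one] at hs'
  rw [Fin.prod_univ_three, Fin.prod_univ_three, ← hs']
  simp only [Matrix.cons_val]
  rw [div_pow, div_pow, pow_add, pow_add]
  field_simp
  try ring

theorem rehom (Q : Polynomial (Polynomial ℝ)) : ∃ N0 : ℕ, ∀ N, N0 ≤ N →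
    ∃ R : MvPolynomial (Fin 3) ℝ, ∀ x y z : ℝ, y ≠ 0 →
      eval ![x, y, z] R = y ^ N * bival (x / y) (z / y) Q := by
  have hadd : ∀ P Q : Polynomial (Polynomial ℝ),
      (∃ N0 : ℕ, ∀ N, N0 ≤ N → ∃ R : MvPolynomial (Fin 3) ℝ, ∀ x y z : ℝ, y ≠ 0 →
        eval ![x, y, z] R = y ^ N * bival (x / y) (z / y) P) →
      (∃ N0 : ℕ, ∀ N, N0 ≤ N → ∃ R : MvPolynomial (Fin 3) ℝ, ∀ x y z : ℝ, y ≠ 0 →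
        eval ![x, y, z] R = y ^ N * bival (x / y) (z / y) Q) →
      (∃ N0 : ℕ, ∀ N, N0 ≤ N → ∃ R : MvPolynomial (Fin 3) ℝ, ∀ x y z : ℝ, y ≠ 0 →
        eval ![x, y, z] R = y ^ N * bival (x / y) (z / y) (P + Q)) := by
    rintro P Q ⟨N1, h1⟩ ⟨N2, h2⟩
    refine ⟨max N1 N2, fun N hN => ?_⟩
    obtain ⟨R1, e1⟩ := h1 N ((le_max_left _ _).trans hN)
    obtain ⟨R2, e2⟩ := h2 N ((le_max_right _ _).trans hN)
    refine ⟨R1 + R2, fun x y z hy => ?_⟩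
    rw [map_add, e1 x y z hy, e2 x y z hy, map_add, mul_add]
  induction Q using Polynomial.induction_on' with
  | add P Q hP hQ => exact hadd P Q hP hQ
  | monomial n a =>
    induction a using Polynomial.induction_on' with
    | add a b ha hb =>
      rw [map_add]
      exact hadd _ _ ha hb
    | monomial k r =>
      refine ⟨n + k, fun N hN => ?_⟩
      obtain ⟨M, rfl⟩ := Nat.exists_eq_add_of_le hN
      refine ⟨C r * X 0 ^ k * X 2 ^ n * X 1 ^ M, fun x y z hy => ?_⟩
      simp only [bival, Polynomial.coe_eval₂RingHom, Polynomial.eval₂_monomial,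
        Polynomial.coe_evalRingHom, Polynomial.eval_monomial, map_mul, map_pow, eval_C, eval_X,
        Matrix.cons_val]
      rw [div_pow, div_pow, pow_add, pow_add]
      field_simp

/-- divisibility by the second variable -/
noncomputable def killY : MvPolynomial (Fin 3) ℝ →ₐ[ℝ] MvPolynomial (Fin 3) ℝ :=
  aeval ![X 0, 0, X 2]

theorem killY_dvd (T : MvPolynomial (Fin 3) ℝ) : X 1 ∣ T - killY T := by
  induction T using MvPolynomial.induction_on with
  | C a => simp [killY]
  | add p q hp hq =>
    rw [map_add, add_sub_add_comm]
    exact dvd_add hp hq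
  | mul_X p i hp =>
    rw [map_mul]
    have h1 : p * X i - killY p * killY (X i) =
        (p - killY p) * X i + killY p * (X i - killY (X i)) := by ring
    rw [h1]
    refine dvd_add (hp.mul_right _) (Dvd.dvd.mul_left ?_ _)
    rw [killY, aeval_X]
    fin_cases i <;> simp

theorem mv_sum_sq {ι : Type*} [Fintype ι] (T : ι → MvPolynomial (Fin 3) ℝ)
    (h : ∑ i, T i ^ 2 = 0) (i : ι) : T i = 0 := by
  apply MvPolynomial.funext
  intro x
  rw [map_zero]
  refine real_sum_sq (fun i => eval x (T i)) ?_ i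
  have := congrArg (eval x) h
  simpa using this

theorem descent {ι : Type*} [Fintype ι] (p : MvPolynomial (Fin 3) ℝ) (N : ℕ)
    (h : ∃ T : ι → MvPolynomial (Fin 3) ℝ, (X 1) ^ (2 * N) * p = ∑ i, T i ^ 2) :
    ∃ T : ι → MvPolynomial (Fin 3) ℝ, p = ∑ i, T i ^ 2 := by
  induction N with
  | zero => simpa using h
  | succ N ih =>
    obtain ⟨T, hT⟩ := h
    apply ih
    have h0 : ∑ i, killY (T i) ^ 2 = 0 := by
      have := congrArg killY hT
      rw [map_mul, map_pow, map_sum] at this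
      have h1 : killY (X 1) = 0 := by simp [killY]
      rw [h1, zero_pow (by omega), zero_mul] at this
      simpa using this.symm
    have h1 : ∀ i, X 1 ∣ T i := by
      intro i
      have := killY_dvd (T i)
      rwa [mv_sum_sq _ h0 i, sub_zero] at this
    choose S hS using h1
    refine ⟨S, ?_⟩
    have hX : (X 1 : MvPolynomial (Fin 3) ℝ) ≠ 0 := X_ne_zero 1
    apply mul_left_cancel₀ (pow_ne_zero 2 hX)
    calc X 1 ^ 2 * (X 1 ^ (2 * N) * p) = X 1 ^ (2 * (N + 1)) * p := by ring
      _ = ∑ i, T i ^ 2 := hT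
      _ = X 1 ^ 2 * ∑ i, S i ^ 2 := by
        rw [Finset.mul_sum]
        exact Finset.sum_congr rfl fun i _ => by rw [hS i]; ring

theorem upper_bound (d : ℕ) (p : MvPolynomial (Fin 3) ℝ) (hp : p.IsHomogeneous (2 * d))
    (h : ∃ (k : ℕ) (q : Fin k → MvPolynomial (Fin 3) ℝ), p = ∑ i, (q i) ^ 2) :
    ∃ q : Fin (d + 2) → MvPolynomial (Fin 3) ℝ, p = ∑ i, (q i) ^ 2 := by
  obtain ⟨k, q, hq⟩ := h
  have h1 : dehom p = ∑ i, dehom (q i) ^ 2 := by rw [hq, map_sum]; simp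
  have h2 : ∀ i, (dehom (q i)).natDegree ≤ d :=
    natDegree_le_of_sum_sq poly_sum_sq (fun i => dehom (q i)) d
      (by rw [← h1]; exact dehom_natDegree _ _ hp)
  obtain ⟨Q, hQ⟩ := bipoly_reduce d k _ h2
  choose N0 hN0 using fun i => rehom (Q i)
  let N := d + ∑ i, N0 i
  have hN : ∀ i, N0 i ≤ N := fun i =>
    (Finset.single_le_sum (f := N0) (fun _ _ => Nat.zero_le _) (Finset.mem_univ i)).trans
      (Nat.le_add_left _ _)
  choose R hR using fun i => hN0 i N (hN i)
  apply descent p (∑ i : Fin (d + 2), N0 i)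
  refine ⟨R, ?_⟩
  have hX : (X 1 : MvPolynomial (Fin 3) ℝ) ≠ 0 := X_ne_zero 1
  apply mul_left_cancel₀ hX
  apply MvPolynomial.funext
  intro x
  have hx : x = ![x 0, x 1, x 2] := by ext i; fin_cases i <;> rfl
  rw [hx, map_mul, map_mul, map_mul, map_pow, eval_X, map_sum]
  by_cases hy : x 1 = 0
  · simp [hy]
  · simp only [map_pow, hR _ _ _ _ hy]
    simp only [N]
    generalize (∑ i : Fin (d + 2), N0 i) = K
    rw [hom_eval _ _ hp _ _ _ hy, ← bival_dehom, h1, ← hQ, map_sum, Finset.mul_sum,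
      Finset.mul_sum, Finset.mul_sum, Finset.mul_sum]
    refine Finset.sum_congr rfl fun i _ => ?_
    simp only [map_pow, Matrix.cons_val]
    ring

/-- Scheiderer's bound on the Pythagoras number of ternary forms, `d ≥ 4`:
(a) every ternary form of degree `2d` that is a sum of squares is a sum of at most
`d + 2` squares; (b) some ternary form of degree `2d` is a sum of squares but not a sum
of `d` squares. Hence `Π(ν_d(ℙ²)) ∈ {d + 1, d + 2}`. -/
theorem scheiderer_pythagoras_ternary (d : ℕ) (hd : 4 ≤ d) :
    (∀ p : MvPolynomial (Fin 3) ℝ, p.IsHomogeneous (2 * d) →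
      (∃ (k : ℕ) (q : Fin k → MvPolynomial (Fin 3) ℝ), p = ∑ i, (q i) ^ 2) →
      ∃ q : Fin (d + 2) → MvPolynomial (Fin 3) ℝ, p = ∑ i, (q i) ^ 2) ∧
    (∃ p : MvPolynomial (Fin 3) ℝ, p.IsHomogeneous (2 * d) ∧
      (∃ (k : ℕ) (q : Fin k → MvPolynomial (Fin 3) ℝ), p = ∑ i, (q i) ^ 2) ∧
      ¬ ∃ q : Fin d → MvPolynomial (Fin 3) ℝ, p = ∑ i, (q i) ^ 2) := by
  exact ⟨fun p hp h => upper_bound d p hp h, starForm d, starForm_hom d,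
    ⟨d + 1, _, rfl⟩, starForm_not d⟩
end
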